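/- arXiv:1705.05758 — 3 statements merged into one kernel-verified Lean document; each statement's English description precedes it below -/
import Mathlib

section
/- Let G be a finite connected simple graph with minimum degree δ ≥ 2 and maximum degree Δ. Then D'(G) ≤ ⌈Δ^(1/δ)⌉ + 1, i.e. G admits a distinguishing edge labeling with ⌈Δ^(1/δ)⌉ + 1 labels. -/
/-- An edge labeling `f` of `G` with values in `Fin d` is *distinguishing* if the identity is the
only automorphism of `G` preserving it. -/
def SimpleGraph.IsDistinguishingEdgeLabeling {V : Type*} (G : SimpleGraph V) {d : ℕ}
    (f : G.edgeSet → Fin d) : Prop :=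
  ∀ φ : G ≃g G, (∀ e : G.edgeSet, f (φ.mapEdgeSet e) = f e) → ∀ v : V, φ v = v

/-- The distinguishing index `D'(G)`: the least number of labels in a distinguishing edge
labeling of `G`. -/
noncomputable def SimpleGraph.distinguishingIndex {V : Type*} (G : SimpleGraph V) : ℕ :=
  sInf {d : ℕ | ∃ f : G.edgeSet → Fin d, G.IsDistinguishingEdgeLabeling f}

namespace SimpleGraph

/-- A rooted spanning tree of `G`, given by its parent and depth functions. The value of `parent`
at the root is irrelevant. -/
structure SpanningArborescence {V : Type*} (G : SimpleGraph V) where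
  root : V
  parent : V → V
  depth : V → ℕ
  depth_root : depth root = 0
  adj_parent : ∀ v, v ≠ root → G.Adj (parent v) v
  depth_eq : ∀ v, v ≠ root → depth v = depth (parent v) + 1

namespace SpanningArborescence

variable {V : Type*} {G : SimpleGraph V} (T : G.SpanningArborescence)

/-- `T.IsChild u v` means that `v` is a child of `u`. -/
def IsChild (u v : V) : Prop := v ≠ T.root ∧ T.parent v = u

/-- `T.Anc u v` means that `u` is an ancestor of `v`, possibly `v` itself. -/
def Anc (u v : V) : Prop := Relation.ReflTransGen T.IsChild u v

/-- A leaf is a vertex without children. -/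
def IsLeaf (v : V) : Prop := ∀ w, ¬ T.IsChild v w

/-- The sum of the depths of all vertices. -/
def totalDepth [Fintype V] : ℕ := ∑ v, T.depth v

variable {T}

lemma IsChild.adj {u v : V} (h : T.IsChild u v) : G.Adj u v := h.2 ▸ T.adj_parent v h.1

lemma IsChild.depth_eq {u v : V} (h : T.IsChild u v) : T.depth v = T.depth u + 1 :=
  h.2 ▸ T.depth_eq v h.1

lemma isChild_parent {v : V} (h : v ≠ T.root) : T.IsChild (T.parent v) v := ⟨h, rfl⟩

lemma anc_iff {u v : V} : T.Anc u v ↔ u = v ∨ v ≠ T.root ∧ T.Anc u (T.parent v) := by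
  constructor
  · intro h
    rcases Relation.ReflTransGen.cases_tail h with h | ⟨w, hw, hr, rfl⟩
    · exact Or.inl h.symm
    · exact Or.inr ⟨hr, hw⟩
  · rintro (rfl | ⟨h, h'⟩)
    · exact Relation.ReflTransGen.refl
    · exact h'.tail (isChild_parent h)

lemma Anc.eq_or_depth_lt {u v : V} (h : T.Anc u v) : u = v ∨ T.depth u < T.depth v := by
  induction h with
  | refl => exact Or.inl rfl
  | tail _ h ih => right; rw [h.depth_eq]; rcases ih with rfl | ih <;> omega

lemma Anc.eq_of_depth_eq {u v w : V} (hu : T.Anc u w) (hv : T.Anc v w)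
    (h : T.depth u = T.depth v) : u = v := by
  induction hu with
  | refl => rcases hv.eq_or_depth_lt with h' | h' <;> grind
  | @tail b c hb hc ih =>
    rcases anc_iff.1 hv with rfl | ⟨_, hv⟩
    · have h1 : T.depth u ≤ T.depth b := by
        rcases Anc.eq_or_depth_lt hb with h' | h' <;> grind
      have := hc.depth_eq
      omega
    · exact ih (hc.2 ▸ hv)

lemma root_anc (v : V) : T.Anc T.root v := by
  induction hd : T.depth v generalizing v with
  | zero =>
    have : v = T.root := by
      by_contra h
      have := T.depth_eq v h
      omega
    subst this
    exact Relation.ReflTransGen.refl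
  | succ n ih =>
    by_cases h : v = T.root
    · subst h; exact Relation.ReflTransGen.refl
    · have := T.depth_eq v h
      exact anc_iff.2 (Or.inr ⟨h, ih _ (by omega)⟩)

lemma exists_anc_depth_eq (v : V) {i : ℕ} (hi : i ≤ T.depth v) :
    ∃ u, T.Anc u v ∧ T.depth u = i := by
  induction hd : T.depth v - i generalizing v with
  | zero => exact ⟨v, Relation.ReflTransGen.refl, by omega⟩
  | succ n ih =>
    have hv : v ≠ T.root := by
      rintro rfl
      have := T.depth_root
      omega
    have := T.depth_eq v hv
    obtain ⟨u, hu, hu'⟩ := ih (T.parent v) (by omega) (by omega)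
    exact ⟨u, anc_iff.2 (Or.inr ⟨hv, hu⟩), hu'⟩

lemma range_subset_image_depth [Fintype V] (v : V) :
    Finset.range (T.depth v + 1) ⊆ Finset.univ.image T.depth := by
  intro i hi
  obtain ⟨u, -, hu⟩ := exists_anc_depth_eq (T := T) v (i := i) (by simp at hi; omega)
  exact Finset.mem_image.2 ⟨u, Finset.mem_univ _, hu⟩

lemma depth_lt_card [Fintype V] (v : V) : T.depth v < Fintype.card V := by
  have := (Finset.card_le_card (range_subset_image_depth (T := T) v)).trans Finset.card_image_le
  simpa using this

lemma depth_injective_of_depth_add_one_eq_card [Fintype V] {v : V}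
    (h : T.depth v + 1 = Fintype.card V) : Function.Injective T.depth := by
  have h1 := Finset.card_le_card (range_subset_image_depth (T := T) v)
  rw [Finset.card_range, h] at h1
  have h2 := Finset.card_image_iff.1 (le_antisymm (Finset.card_image_le (s := Finset.univ)) h1)
  exact fun a b hab => h2 (by simp) (by simp) hab

variable (T) in
open Classical in
/-- Move the subtree of `x` so that `x` becomes a child of `y`. -/
noncomputable def reattach {x y : V} (hx : x ≠ T.root) (hxy : G.Adj y x) (h : ¬ T.Anc x y) :
    G.SpanningArborescence where
  root := T.root
  parent := Function.update T.parent x y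
  depth v := if T.Anc x v then T.depth v - T.depth x + (T.depth y + 1) else T.depth v
  depth_root := by
    have : ¬ T.Anc x T.root := by
      rw [anc_iff]
      rintro (h | h)
      exacts [hx h, h.1 rfl]
    simp [this, T.depth_root]
  adj_parent v hv := by
    by_cases hvx : v = x
    · subst hvx; simpa
    · simpa [hvx] using T.adj_parent v hv
  depth_eq v hv := by
    by_cases hvx : v = x
    · subst hvx
      have : T.Anc v v := Relation.ReflTransGen.refl
      simp [h, this]
    · have h1 : T.Anc x v ↔ T.Anc x (T.parent v) := by
        rw [anc_iff]; simp [hv, Ne.symm hvx]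
      have h2 := T.depth_eq v hv
      rw [Function.update_of_ne hvx]
      simp only [h1]
      split_ifs with h3
      · have : T.depth x ≤ T.depth (T.parent v) := by
          rcases h3.eq_or_depth_lt with h' | h' <;> grind
        omega
      · exact h2

variable (T) in
open Classical in
/-- Make the child `c` of the root the new root, keeping the edges of the tree. -/
noncomputable def reroot {c : V} (hc : T.IsChild T.root c) : G.SpanningArborescence where
  root := c
  parent := Function.update T.parent T.root c
  depth v := if T.Anc c v then T.depth v - 1 else T.depth v + 1
  depth_root := by
    have : T.Anc c c := Relation.ReflTransGen.refl
    simp [this, hc.depth_eq, T.depth_root]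
  adj_parent v hv := by
    by_cases hvr : v = T.root
    · subst hvr; simpa using hc.adj.symm
    · simpa [hvr] using T.adj_parent v hvr
  depth_eq v hv := by
    have hcc : T.Anc c c := Relation.ReflTransGen.refl
    by_cases hvr : v = T.root
    · subst hvr
      have : ¬ T.Anc c T.root := by
        rw [anc_iff]
        rintro (h | h)
        exacts [hv h.symm, h.1 rfl]
      simp [this, hcc, hc.depth_eq, T.depth_root]
    · have h1 : T.Anc c v ↔ T.Anc c (T.parent v) := by
        rw [anc_iff]; simp [hvr, Ne.symm hv]
      have h2 := T.depth_eq v hvr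
      rw [Function.update_of_ne hvr]
      simp only [h1]
      split_ifs with h3
      · have h4 : T.depth c ≤ T.depth (T.parent v) := by
          rcases h3.eq_or_depth_lt with h' | h' <;> grind
        have h5 := hc.depth_eq
        omega
      · omega

variable (T) in
open Classical in
/-- Make the leaf `l`, adjacent to the root, the new root, with the old root as its only child. -/
noncomputable def rerootLeaf {l : V} (hl : T.IsLeaf l) (h : G.Adj T.root l) :
    G.SpanningArborescence where
  root := l
  parent := Function.update T.parent T.root l
  depth v := if v = l then 0 else T.depth v + 1
  depth_root := by simp
  adj_parent v hv := by
    by_cases hvr : v = T.root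
    · subst hvr; simpa using h.symm
    · simpa [hvr] using T.adj_parent v hvr
  depth_eq v hv := by
    by_cases hvr : v = T.root
    · subst hvr
      simp [hv, T.depth_root]
    · have h1 : T.parent v ≠ l := fun h' => hl v ⟨hvr, h'⟩
      simp [hvr, hv, h1, T.depth_eq v hvr]

section Maximal

variable [Fintype V]

lemma anc_or_anc_of_maximal
    (hmax : ∀ T' : G.SpanningArborescence, T'.totalDepth ≤ T.totalDepth)
    {x y : V} (hxy : G.Adj x y) : T.Anc x y ∨ T.Anc y x := by
  wlog hle : T.depth x ≤ T.depth y generalizing x y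
  · exact (this hxy.symm (by omega)).symm
  left
  by_contra h
  have hx : x ≠ T.root := by
    rintro rfl
    exact h (root_anc y)
  refine absurd (hmax (T.reattach hx hxy.symm h)) (not_le.2 ?_)
  refine Finset.sum_lt_sum (fun v _ => ?_) ⟨x, Finset.mem_univ _, ?_⟩
  · simp only [reattach]
    split_ifs <;> omega
  · have : T.Anc x x := Relation.ReflTransGen.refl
    simp only [reattach, if_pos this]
    omega

lemma isChild_root_unique_of_maximal
    (hmax : ∀ T' : G.SpanningArborescence, T'.totalDepth ≤ T.totalDepth)
    {a b : V} (ha : T.IsChild T.root a)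
    (hb : T.IsChild T.root b) : a = b := by
  classical
  by_contra hab
  let D (c : V) : Finset V := Finset.univ.filter (T.Anc c)
  wlog hle : (D a).card ≤ (D b).card generalizing a b
  · exact this hb ha (Ne.symm hab) (by omega)
  have hdisj : Disjoint (D a) (D b) := by
    rw [Finset.disjoint_left]
    intro v hva hvb
    simp only [D, Finset.mem_filter, Finset.mem_univ, true_and] at hva hvb
    exact hab (hva.eq_of_depth_eq hvb (by rw [ha.depth_eq, hb.depth_eq]))
  have hroot : T.root ∉ D a ∪ D b := by
    simp only [D, Finset.mem_union, Finset.mem_filter, Finset.mem_univ, true_and, not_or]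
    constructor <;> rw [anc_iff] <;> rintro (h | h)
    exacts [ha.1 h, h.1 rfl, hb.1 h, h.1 rfl]
  have hcard : (D a).card + (D b).card < Fintype.card V := by
    rw [← Finset.card_union_of_disjoint hdisj]
    exact Finset.card_lt_univ_of_notMem hroot
  have hsum : T.totalDepth + Fintype.card V ≤ (T.reroot ha).totalDepth + 2 * (D a).card := by
    have h1 : 2 * (D a).card = ∑ v, if T.Anc a v then 2 else 0 := by
      rw [← Finset.sum_filter]; simp [D, mul_comm]
    have h2 : Fintype.card V = ∑ _v : V, 1 := by simp
    rw [h1, h2, totalDepth, totalDepth, ← Finset.sum_add_distrib, ← Finset.sum_add_distrib]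
    refine Finset.sum_le_sum fun v _ => ?_
    simp only [reroot]
    split_ifs <;> omega
  have := hmax (T.reroot ha)
  omega

lemma depth_add_one_eq_card_of_maximal
    (hmax : ∀ T' : G.SpanningArborescence, T'.totalDepth ≤ T.totalDepth)
    {l : V} (hl : T.IsLeaf l) (h : G.Adj T.root l) :
    T.depth l + 1 = Fintype.card V := by
  classical
  have hsum : T.totalDepth + Fintype.card V = (T.rerootLeaf hl h).totalDepth + (T.depth l + 1) := by
    have h1 : T.depth l + 1 = ∑ v, if v = l then T.depth l + 1 else 0 := by simp
    have h2 : Fintype.card V = ∑ _v : V, 1 := by simp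
    rw [h1, h2, totalDepth, totalDepth, ← Finset.sum_add_distrib, ← Finset.sum_add_distrib]
    refine Finset.sum_congr rfl fun v _ => ?_
    simp only [rerootLeaf]
    split_ifs with hv
    · subst hv; omega
    · omega
  have := hmax (T.rerootLeaf hl h)
  have := depth_lt_card (T := T) l
  omega

end Maximal

lemma exists_of_connected (hG : G.Connected) : Nonempty G.SpanningArborescence := by
  obtain ⟨r⟩ := hG.nonempty
  have key : ∀ v, ∃ u, v ≠ r → G.Adj u v ∧ G.dist v r = G.dist u r + 1 := by
    intro v
    by_cases hv : v = r
    · exact ⟨v, fun h => absurd hv h⟩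
    obtain ⟨p, hp⟩ := (hG v r).exists_walk_length_eq_dist
    cases p with
    | nil => exact absurd rfl hv
    | @cons _ u _ h q =>
      refine ⟨u, fun _ => ⟨h.symm, le_antisymm ?_ ?_⟩⟩
      · have := hG.dist_triangle (u := v) (v := u) (w := r)
        rw [SimpleGraph.dist_eq_one_iff_adj.2 h] at this
        omega
      · have := SimpleGraph.dist_le q
        rw [SimpleGraph.Walk.length_cons] at hp
        omega
  choose p hp using key
  exact ⟨⟨r, p, fun v => G.dist v r, by simp, fun v hv => (hp v hv).1, fun v hv => (hp v hv).2⟩⟩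

lemma exists_maximal [Fintype V] (hG : G.Connected) :
    ∃ T : G.SpanningArborescence, ∀ T' : G.SpanningArborescence, T'.totalDepth ≤ T.totalDepth := by
  have := exists_of_connected hG
  have hb : BddAbove (Set.range fun T : G.SpanningArborescence => T.totalDepth) := by
    refine ⟨∑ _v : V, Fintype.card V, ?_⟩
    rintro _ ⟨T, rfl⟩
    exact Finset.sum_le_sum fun v _ => (depth_lt_card v).le
  obtain ⟨T, hT⟩ := Nat.sSup_mem (Set.range_nonempty _) hb
  exact ⟨T, fun T' => (le_csSup hb ⟨T', rfl⟩).trans_eq hT.symm⟩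

variable (T) in
/-- The three consequences of maximal total depth used below. -/
structure IsDeep [Fintype V] : Prop where
  anc_or_anc : ∀ ⦃x y⦄, G.Adj x y → T.Anc x y ∨ T.Anc y x
  isChild_root_unique : ∀ ⦃a b⦄, T.IsChild T.root a → T.IsChild T.root b → a = b
  depth_add_one_eq_card : ∀ ⦃l⦄, T.IsLeaf l → G.Adj T.root l → T.depth l + 1 = Fintype.card V

lemma exists_isDeep [Fintype V] (hG : G.Connected) : ∃ T : G.SpanningArborescence, T.IsDeep := by
  obtain ⟨T, hT⟩ := exists_maximal hG
  exact ⟨T, fun _ _ => anc_or_anc_of_maximal hT, fun _ _ => isChild_root_unique_of_maximal hT,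
    fun _ => depth_add_one_eq_card_of_maximal hT⟩

lemma Anc.eq_or_exists_isChild {u v : V} (h : T.Anc u v) : u = v ∨ ∃ w, T.IsChild u w := by
  rcases Relation.ReflTransGen.cases_head h with h | ⟨w, hw, -⟩
  exacts [Or.inl h, Or.inr ⟨w, hw⟩]

namespace IsDeep

variable [Fintype V]

lemma anc_of_isLeaf (hT : T.IsDeep) {l w : V} (hl : T.IsLeaf l) (h : G.Adj l w) : T.Anc w l := by
  rcases hT.anc_or_anc h with h' | h'
  · rcases h'.eq_or_exists_isChild with rfl | ⟨x, hx⟩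
    exacts [h', absurd hx (hl x)]
  · exact h'

lemma not_isLeaf_of_adj (hT : T.IsDeep) {l w : V} (hl : T.IsLeaf l) (h : G.Adj l w) :
    ¬ T.IsLeaf w := by
  rcases (hT.anc_of_isLeaf hl h).eq_or_exists_isChild with rfl | ⟨x, hx⟩
  exacts [absurd rfl h.ne, fun h' => h' x hx]

lemma eq_parent_or_depth_lt (hT : T.IsDeep) {l w : V} (hl : T.IsLeaf l) (h : G.Adj l w) :
    w = T.parent l ∨ T.depth w < T.depth (T.parent l) := by
  rcases anc_iff.1 (hT.anc_of_isLeaf hl h) with rfl | h'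
  exacts [absurd rfl h.ne, h'.2.eq_or_depth_lt]

lemma eq_of_depth_eq (hT : T.IsDeep) {l u w : V} (hl : T.IsLeaf l) (hu : G.Adj l u)
    (hw : G.Adj l w) (h : T.depth u = T.depth w) : u = w :=
  (hT.anc_of_isLeaf hl hu).eq_of_depth_eq (hT.anc_of_isLeaf hl hw) h

/-- The root has a child, and this child is not a leaf. -/
lemma exists_isChild_root (hT : T.IsDeep) (hV : 3 ≤ Fintype.card V) :
    ¬ T.IsLeaf T.root ∧ ∃ c, T.IsChild T.root c ∧ ¬ T.IsLeaf c := by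
  classical
  obtain ⟨v, hv⟩ := Fintype.exists_ne_of_one_lt_card (by omega : 1 < Fintype.card V) T.root
  rcases (root_anc (T := T) v).eq_or_exists_isChild with h | ⟨c, hc⟩
  · exact absurd h.symm hv
  refine ⟨fun h => h c hc, c, hc, fun hl => ?_⟩
  have hall : (Finset.univ : Finset V) ⊆ {T.root, c} := by
    intro w _
    rcases Relation.ReflTransGen.cases_head (root_anc (T := T) w) with h | ⟨d, hd, hdw⟩
    · simp [h]
    · obtain rfl := hT.isChild_root_unique hc hd
      rcases Anc.eq_or_exists_isChild hdw with rfl | ⟨x, hx⟩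
      · simp
      · exact absurd hx (hl x)
  have := (Finset.card_le_card hall).trans Finset.card_le_two
  rw [Finset.card_univ] at this
  omega

end IsDeep

open Classical in
variable (T) in
/-- The set of children of `v`. -/
noncomputable def children [Fintype V] (v : V) : Finset V := Finset.univ.filter (T.IsChild v)

lemma mem_children [Fintype V] {u v : V} : v ∈ T.children u ↔ T.IsChild u v := by
  simp [children]

lemma card_children_le_degree [Fintype V] [DecidableRel G.Adj] (v : V) :
    (T.children v).card ≤ G.degree v :=
  Finset.card_le_card fun w hw => by simpa using (mem_children.1 hw).adj

lemma card_children_lt_degree [Fintype V] [DecidableRel G.Adj] {v : V} (hv : v ≠ T.root) :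
    (T.children v).card < G.degree v := by
  refine Finset.card_lt_card ((Finset.ssubset_iff_of_subset fun w hw => ?_).2
    ⟨T.parent v, ?_, fun h => ?_⟩)
  · simpa using (mem_children.1 hw).adj
  · simpa using (T.adj_parent v hv).symm
  · have h1 := (mem_children.1 h).depth_eq
    have h2 := T.depth_eq v hv
    omega

lemma _root_.Finset.exists_image_eq_range_card {α : Type*} (s : Finset α) :
    ∃ g : α → ℕ, s.image g = Finset.range s.card := by
  classical
  refine ⟨fun x => if h : x ∈ s then s.equivFin ⟨x, h⟩ else 0, ?_⟩
  ext i
  simp only [Finset.mem_image, Finset.mem_range]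
  constructor
  · rintro ⟨x, hx, rfl⟩
    simp [hx]
  · intro hi
    refine ⟨s.equivFin.symm ⟨i, hi⟩, Finset.coe_mem _, ?_⟩
    simp

variable (T) in
/-- A typing of the vertices by residues modulo `M` such that the types of the children of each
vertex `v` form the cyclic interval starting at the type of `v`. -/
structure IsTyping [Fintype V] (M : ℕ) (τ : V → ℕ) : Prop where
  lt : ∀ v, τ v < M
  image_children : ∀ v, (T.children v).image τ =
    (Finset.range (T.children v).card).image fun j => (τ v + j) % M
  injOn : ∀ v, Set.InjOn τ (T.children v)
  eq_one : Function.Injective T.depth → ∀ v, τ v = 1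

variable (T) in
lemma exists_isTyping [Fintype V] {M : ℕ} (hM : 2 ≤ M) (h : ∀ v, (T.children v).card ≤ M) :
    ∃ τ, T.IsTyping M τ := by
  choose g hg using fun v => Finset.exists_image_eq_range_card (T.children v)
  let τ (v : V) : ℕ := (1 + ∑ i ∈ Finset.range (T.depth v),
    g (T.parent (T.parent^[i] v)) (T.parent^[i] v)) % M
  have hroot : τ T.root = 1 := by
    simp [τ, T.depth_root, Nat.mod_eq_of_lt (by omega : 1 < M)]
  have hchild : ∀ u v, T.IsChild u v → τ v = (τ u + g u v) % M := by
    rintro u v h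
    obtain ⟨-, rfl⟩ := id h
    simp only [τ, h.depth_eq, Finset.sum_range_succ', Function.iterate_succ_apply,
      Function.iterate_zero, id]
    rw [Nat.mod_add_mod, add_assoc]
  have hlt : ∀ u v, T.IsChild u v → g u v < (T.children u).card := fun u v huv =>
    Finset.mem_range.1 (hg u ▸ Finset.mem_image_of_mem _ (mem_children.2 huv))
  refine ⟨τ, fun v => Nat.mod_lt _ (by omega), fun v => ?_, fun u v hv w hw hvw => ?_, fun hi => ?_⟩
  · rw [← hg, Finset.image_image]
    exact Finset.image_congr fun w hw => hchild v w (mem_children.1 hw)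
  · have hinj : Set.InjOn (g u) (T.children u) := by
      rw [← Finset.card_image_iff, hg, Finset.card_range]
    refine hinj hv hw ?_
    have hv' := mem_children.1 hv
    have hw' := mem_children.1 hw
    rw [hchild u v hv', hchild u w hw'] at hvw
    exact Nat.ModEq.eq_of_lt_of_lt (Nat.ModEq.add_left_cancel' _ hvw)
      ((hlt u v hv').trans_le (h u)) ((hlt u w hw').trans_le (h u))
  · intro v
    induction hd : T.depth v generalizing v with
    | zero => rw [hi (hd.trans T.depth_root.symm), hroot]
    | succ n ih =>
      have hv : v ≠ T.root := by
        rintro rfl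
        have := T.depth_root
        omega
      have hc := isChild_parent hv
      have h1 : (T.children (T.parent v)).card ≤ 1 := Finset.card_le_one.2 fun a ha b hb => hi (by
        rw [(mem_children.1 ha).depth_eq, (mem_children.1 hb).depth_eq])
      have h2 := hlt _ _ hc
      have h3 := T.depth_eq v hv
      rw [hchild _ _ hc, ih _ (by omega), Nat.lt_one_iff.1 (h2.trans_le h1)]
      exact Nat.mod_eq_of_lt (by omega)

/-- A proper nonempty cyclic interval determines its starting point. -/
lemma _root_.Nat.eq_of_image_add_mod_eq {M m a b : ℕ} (ha : a < M) (hb : b < M) (hm : 0 < m)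
    (hmM : m < M) (h : ((Finset.range m).image fun j => (a + j) % M) =
      (Finset.range m).image fun j => (b + j) % M) : a = b := by
  by_contra hab
  have h1 : a ∈ (Finset.range m).image fun j => (b + j) % M := by
    rw [← h]
    exact Finset.mem_image.2 ⟨0, by simpa using hm, by simpa using Nat.mod_eq_of_lt ha⟩
  obtain ⟨j, hj, hja⟩ := Finset.mem_image.1 h1
  rw [Finset.mem_range] at hj
  obtain _ | j := j
  · exact hab (by simpa [Nat.mod_eq_of_lt hb] using hja.symm)
  have h2 : (b + j) % M ∈ (Finset.range m).image fun j => (a + j) % M := by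
    rw [h]
    exact Finset.mem_image.2 ⟨j, by simp; omega, rfl⟩
  obtain ⟨i, hi, hij⟩ := Finset.mem_image.1 h2
  rw [Finset.mem_range] at hi
  have h3 : a + (i + 1) ≡ a + 0 [MOD M] := by
    calc a + (i + 1) = a + i + 1 := by ring
      _ ≡ b + j + 1 [MOD M] := Nat.ModEq.add_right 1 hij
      _ ≡ a + 0 [MOD M] := by
        rw [add_assoc b]
        exact hja.trans (Nat.mod_eq_of_lt ha).symm |>.trans rfl
  have h4 := Nat.ModEq.eq_of_lt_of_lt (Nat.ModEq.add_left_cancel' _ h3) (by omega) (by omega)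
  omega

lemma _root_.Nat.mod_pow_eq_of_digits_eq {k n a b : ℕ}
    (h : ∀ i < n, a / k ^ i % k = b / k ^ i % k) : a % k ^ n = b % k ^ n := by
  induction n with
  | zero => simp [Nat.mod_one]
  | succ n ih =>
    rw [Nat.mod_pow_succ, Nat.mod_pow_succ, ih fun i hi => h i (by omega), h n (by omega)]

lemma _root_.Finset.exists_card_filter_lt_eq {α : Type*} {s : Finset α} {f : α → ℕ}
    (hf : Set.InjOn f s) {i : ℕ} (hi : i < s.card) :
    ∃ w ∈ s, (s.filter fun x => f x < f w).card = i := by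
  classical
  let g (w : α) : ℕ := (s.filter fun x => f x < f w).card
  have hlt : ∀ v ∈ s, ∀ w, f v < f w → g v < g w := by
    intro v hv w hvw
    refine Finset.card_lt_card ((Finset.ssubset_iff_of_subset fun x hx => ?_).2 ⟨v, ?_, ?_⟩)
    · rw [Finset.mem_filter] at hx ⊢
      exact ⟨hx.1, hx.2.trans hvw⟩
    · simp [hv, hvw]
    · simp
  have hinj : Set.InjOn g s := by
    intro v hv w hw hvw
    rcases lt_trichotomy (f v) (f w) with h | h | h
    · exact absurd hvw (hlt v hv w h).ne
    · exact hf hv hw h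
    · exact absurd hvw (hlt w hw v h).ne'
  have himage : s.image g = Finset.range s.card := by
    refine Finset.eq_of_subset_of_card_le (fun j hj => ?_) ?_
    · obtain ⟨w, hw, rfl⟩ := Finset.mem_image.1 hj
      exact Finset.mem_range.2 (Finset.card_lt_card (Finset.filter_ssubset.2 ⟨w, hw, by simp⟩))
    · rw [Finset.card_image_iff.2 hinj, Finset.card_range]
  obtain ⟨w, hw, h⟩ := Finset.mem_image.1 (himage ▸ Finset.mem_range.2 hi)
  exact ⟨w, hw, h⟩

lemma apply_ne_root {φ : G ≃g G} (hroot : φ T.root = T.root) {v : V} (hv : v ≠ T.root) :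
    φ v ≠ T.root :=
  fun h => hv (φ.injective (h.trans hroot.symm))

section Label

variable [Fintype V] [DecidableRel G.Adj]

variable (T) in
/-- The number of neighbours of `l` of smaller depth than `w`. -/
def depthRank (l w : V) : ℕ := ((G.neighborFinset l).filter fun x => T.depth x < T.depth w).card

open Classical in
variable (T) in
/-- The contribution of the endpoint `x` to the label of `{x, y}`: at a leaf, the edges ordered by
the depth of their other end carry the base `k` digits of the type of the leaf. -/
noncomputable def leafLabel (τ : V → ℕ) (k : ℕ) (x y : V) : ℕ :=
  if T.IsLeaf x then 1 + τ x / k ^ T.depthRank x y % k else 0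

open Classical in
variable (T) in
/-- The label of the edge `{x, y}`; it is `0` exactly on the tree edges without leaf ends. -/
noncomputable def label (τ : V → ℕ) (k : ℕ) (x y : V) : ℕ :=
  T.leafLabel τ k x y + T.leafLabel τ k y x +
    if ¬ T.IsLeaf x ∧ ¬ T.IsLeaf y ∧ ¬ T.IsChild x y ∧ ¬ T.IsChild y x then 1 else 0

lemma label_comm (τ : V → ℕ) (k : ℕ) (x y : V) : T.label τ k x y = T.label τ k y x := by
  unfold label
  rw [add_comm (T.leafLabel τ k x y)]
  split_ifs <;> first | omega | tauto

lemma label_eq_zero_iff {τ : V → ℕ} {k : ℕ} {x y : V} : T.label τ k x y = 0 ↔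
    ¬ T.IsLeaf x ∧ ¬ T.IsLeaf y ∧ (T.IsChild x y ∨ T.IsChild y x) := by
  unfold label leafLabel
  by_cases hx : T.IsLeaf x <;> by_cases hy : T.IsLeaf y <;> simp [hx, hy]
  tauto

lemma IsDeep.label_of_isLeaf (hT : T.IsDeep) {τ : V → ℕ} {k : ℕ} {x y : V} (hx : T.IsLeaf x)
    (h : G.Adj x y) : T.label τ k x y = 1 + τ x / k ^ T.depthRank x y % k := by
  simp [label, leafLabel, hx, hT.not_isLeaf_of_adj hx h]

lemma IsDeep.label_lt (hT : T.IsDeep) {τ : V → ℕ} {k : ℕ} (hk : 0 < k) {x y : V}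
    (h : G.Adj x y) : T.label τ k x y < k + 1 := by
  by_cases hx : T.IsLeaf x
  · rw [hT.label_of_isLeaf hx h]
    have := Nat.mod_lt (τ x / k ^ T.depthRank x y) hk
    omega
  by_cases hy : T.IsLeaf y
  · rw [label_comm, hT.label_of_isLeaf hy h.symm]
    have := Nat.mod_lt (τ y / k ^ T.depthRank y x) hk
    omega
  simp only [label, leafLabel, hx, hy, if_false]
  split_ifs <;> omega

lemma parent_apply_of_not_isLeaf {τ : V → ℕ} {k : ℕ} {φ : G ≃g G}
    (hφ : ∀ x y, G.Adj x y → T.label τ k (φ x) (φ y) = T.label τ k x y)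
    (hroot : φ T.root = T.root) {v : V} (hvl : ¬ T.IsLeaf v) :
    T.depth (φ v) = T.depth v ∧ (v ≠ T.root → T.parent (φ v) = φ (T.parent v)) := by
  induction hd : T.depth v generalizing v with
  | zero =>
    have hv : v = T.root := by
      by_contra h
      have := T.depth_eq v h
      omega
    subst hv
    exact ⟨by rw [hroot, hd], fun h => absurd rfl h⟩
  | succ n ih =>
    have hv : v ≠ T.root := by
      rintro rfl
      have := T.depth_root
      omega
    have hp := isChild_parent hv
    have hpd := hp.depth_eq
    have hpl : ¬ T.IsLeaf (T.parent v) := fun h => h v hp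
    obtain ⟨ih1, ih2⟩ := ih hpl (by omega)
    have h0 : T.label τ k (φ (T.parent v)) (φ v) = 0 := by
      rw [hφ _ _ hp.adj]
      exact label_eq_zero_iff.2 ⟨hpl, hvl, Or.inl hp⟩
    rcases (label_eq_zero_iff.1 h0).2.2 with h | h
    · exact ⟨by rw [h.depth_eq, ih1], fun _ => h.2⟩
    · have hpr : T.parent v ≠ T.root := fun h' => h.1 (by rw [h', hroot])
      have h1 := φ.injective ((ih2 hpr).symm.trans h.2)
      have h2 := T.depth_eq _ hpr
      rw [h1] at h2
      omega

namespace IsDeep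

variable {τ : V → ℕ} {k : ℕ} {φ : G ≃g G}

lemma isLeaf_iff_forall_label_ne_zero (hT : T.IsDeep) (τ : V → ℕ) (k : ℕ)
    (hV : 3 ≤ Fintype.card V) {v : V} :
    T.IsLeaf v ↔ ∀ w, G.Adj v w → T.label τ k v w ≠ 0 := by
  constructor
  · intro hv w _ h
    exact (label_eq_zero_iff.1 h).1 hv
  · intro h
    by_contra hv
    by_cases hr : v = T.root
    · subst hr
      obtain ⟨hr, c, hc, hcl⟩ := hT.exists_isChild_root hV
      exact h c hc.adj (label_eq_zero_iff.2 ⟨hr, hcl, Or.inl hc⟩)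
    · have hp := isChild_parent hr
      exact h _ hp.adj.symm (label_eq_zero_iff.2 ⟨hv, fun h => h v hp, Or.inr hp⟩)

lemma depthRank_apply (hT : T.IsDeep)
    (hφ : ∀ x y, G.Adj x y → T.label τ k (φ x) (φ y) = T.label τ k x y)
    (hroot : φ T.root = T.root) {l w : V} (hl : T.IsLeaf l) (h : G.Adj l w) :
    T.depthRank (φ l) (φ w) = T.depthRank l w := by
  have hd : ∀ x, G.Adj l x → T.depth (φ x) = T.depth x := fun x hx =>
    (parent_apply_of_not_isLeaf hφ hroot (hT.not_isLeaf_of_adj hl hx)).1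
  refine (Finset.card_equiv φ.toEquiv fun x => ?_).symm
  simp only [Finset.mem_filter, mem_neighborFinset, RelIso.coe_fn_toEquiv, φ.map_adj_iff, hd w h]
  exact and_congr_right fun hx => by rw [hd x hx]

lemma isLeaf_apply_iff (hT : T.IsDeep) (hV : 3 ≤ Fintype.card V)
    (hφ : ∀ x y, G.Adj x y → T.label τ k (φ x) (φ y) = T.label τ k x y)
    (v : V) : T.IsLeaf (φ v) ↔ T.IsLeaf v := by
  rw [hT.isLeaf_iff_forall_label_ne_zero τ k hV, hT.isLeaf_iff_forall_label_ne_zero τ k hV]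
  constructor
  · intro h w hw
    rw [← hφ v w hw]
    exact h _ (φ.map_adj_iff.2 hw)
  · intro h w hw
    obtain ⟨w, rfl⟩ := φ.surjective w
    rw [φ.map_adj_iff] at hw
    rw [hφ v w hw]
    exact h w hw

lemma apply_root (hT : T.IsDeep) (hV : 3 ≤ Fintype.card V)
    (hφ : ∀ x y, G.Adj x y → T.label τ k (φ x) (φ y) = T.label τ k x y)
    {M : ℕ} (hτ : T.IsTyping M τ) (hk : 2 ≤ k) : φ T.root = T.root := by
  by_contra hu
  obtain ⟨hr, c, hc, hcl⟩ := hT.exists_isChild_root hV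
  have huniq : ∀ w, G.Adj (φ T.root) w → T.label τ k (φ T.root) w = 0 → w = φ c := by
    intro w hw hw0
    obtain ⟨w, rfl⟩ := φ.surjective w
    rw [φ.map_adj_iff] at hw
    rw [hφ _ _ hw, label_eq_zero_iff] at hw0
    rcases hw0.2.2 with h | h
    · rw [hT.isChild_root_unique h hc]
    · exact absurd rfl h.1
  have hul : ¬ T.IsLeaf (φ T.root) := by rwa [hT.isLeaf_apply_iff hV hφ]
  have hp := isChild_parent hu
  have hpar := huniq _ hp.adj.symm (label_eq_zero_iff.2 ⟨hul, fun h => h _ hp, Or.inr hp⟩)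
  obtain ⟨w, hw⟩ : ∃ w, T.IsChild (φ T.root) w := by simpa [IsLeaf] using hul
  have hwl : T.IsLeaf w := by
    by_contra hwl
    have h1 := huniq w hw.adj (label_eq_zero_iff.2 ⟨hul, hwl, Or.inl hw⟩)
    have h2 := hw.depth_eq
    have h3 := hp.depth_eq
    rw [h1, ← hpar] at h2
    omega
  -- The root is adjacent to a leaf, so the tree is a path and that leaf is its last vertex.
  obtain ⟨l, rfl⟩ := φ.surjective w
  have hll : T.IsLeaf l := (hT.isLeaf_apply_iff hV hφ l).1 hwl
  have hrl : G.Adj T.root l := φ.map_adj_iff.1 hw.adj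
  have hl := hT.depth_add_one_eq_card hll hrl
  have hinj := depth_injective_of_depth_add_one_eq_card hl
  have hfix : φ l = l := by
    obtain ⟨a, ha, had⟩ := exists_anc_depth_eq (T := T) l (i := T.depth (φ l)) (by
      have := depth_lt_card (T := T) (φ l)
      omega)
    obtain rfl := hinj had
    rcases ha.eq_or_exists_isChild with h | ⟨x, hx⟩
    exacts [h, absurd hx (hwl x)]
  have hcol := hφ l T.root hrl.symm
  rw [hfix] at hcol hw
  rw [hT.label_of_isLeaf hll hw.adj.symm, hT.label_of_isLeaf hll hrl.symm, hτ.eq_one hinj] at hcol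
  have h0 : T.depthRank l T.root = 0 := by simp [depthRank, T.depth_root]
  have h1 : T.depthRank l (φ T.root) ≠ 0 := by
    refine (Finset.card_pos.2 ⟨T.root, ?_⟩).ne'
    have := hp.depth_eq
    simp only [Finset.mem_filter, mem_neighborFinset, T.depth_root]
    exact ⟨hrl.symm, by omega⟩
  rw [h0, Nat.div_eq_of_lt (Nat.one_lt_pow h1 (by omega))] at hcol
  simp [Nat.mod_eq_of_lt (by omega : 1 < k)] at hcol

lemma parent_apply (hT : T.IsDeep) (hV : 3 ≤ Fintype.card V)
    (hφ : ∀ x y, G.Adj x y → T.label τ k (φ x) (φ y) = T.label τ k x y)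
    (hroot : φ T.root = T.root) {v : V} (hv : v ≠ T.root) : T.parent (φ v) = φ (T.parent v) := by
  by_cases hvl : T.IsLeaf v
  · have hφl := (hT.isLeaf_apply_iff hV hφ v).2 hvl
    have hφv := apply_ne_root hroot hv
    obtain ⟨q, hq⟩ := φ.surjective (T.parent (φ v))
    have hqv : G.Adj v q := by
      rw [← φ.map_adj_iff, hq]
      exact (T.adj_parent _ hφv).symm
    have hpv : G.Adj v (T.parent v) := (T.adj_parent v hv).symm
    have hdq := (parent_apply_of_not_isLeaf hφ hroot (hT.not_isLeaf_of_adj hvl hqv)).1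
    have hdp := (parent_apply_of_not_isLeaf hφ hroot (hT.not_isLeaf_of_adj hvl hpv)).1
    rw [← hq]
    rcases hT.eq_parent_or_depth_lt hvl hqv with h | h
    · rw [h]
    · rcases hT.eq_parent_or_depth_lt hφl (φ.map_adj_iff.2 hpv) with h' | h'
      · rw [h', hq]
      · rw [← hq] at h'
        omega
  · exact (parent_apply_of_not_isLeaf hφ hroot hvl).2 hv

lemma mem_children_apply_iff (hT : T.IsDeep) (hV : 3 ≤ Fintype.card V)
    (hφ : ∀ x y, G.Adj x y → T.label τ k (φ x) (φ y) = T.label τ k x y)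
    (hroot : φ T.root = T.root) {u v : V} : φ v ∈ T.children (φ u) ↔ v ∈ T.children u := by
  rw [mem_children, mem_children]
  by_cases hv : v = T.root
  · subst hv
    exact ⟨fun h => absurd hroot h.1, fun h => absurd rfl h.1⟩
  · simp only [IsChild, hT.parent_apply hV hφ hroot hv, φ.injective.eq_iff, hv,
      apply_ne_root hroot hv, ne_eq, not_false_eq_true, true_and]

variable {M δ : ℕ}

lemma type_apply (hT : T.IsDeep) (hV : 3 ≤ Fintype.card V)
    (hφ : ∀ x y, G.Adj x y → T.label τ k (φ x) (φ y) = T.label τ k x y)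
    (hroot : φ T.root = T.root) (hτ : T.IsTyping M τ) (hM : ∀ v, G.degree v ≤ M)
    (hδ : ∀ v, δ ≤ G.degree v) (hk : M ≤ k ^ δ) (v : V) : τ (φ v) = τ v := by
  induction hd : Fintype.card V - T.depth v using Nat.strong_induction_on generalizing v with
  | _ n ih =>
  subst hd
  by_cases hvr : v = T.root
  · rw [hvr, hroot]
  by_cases hvl : T.IsLeaf v
  · have hφl := (hT.isLeaf_apply_iff hV hφ v).2 hvl
    rw [← Nat.mod_eq_of_lt ((hτ.lt v).trans_le hk), ← Nat.mod_eq_of_lt ((hτ.lt (φ v)).trans_le hk)]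
    refine Nat.mod_pow_eq_of_digits_eq fun i hi => ?_
    obtain ⟨w, hw, rfl⟩ := Finset.exists_card_filter_lt_eq (s := G.neighborFinset v) (f := T.depth)
      (fun x hx y hy hxy => hT.eq_of_depth_eq hvl (by simpa using hx) (by simpa using hy) hxy)
      (hi.trans_le (hδ v))
    rw [mem_neighborFinset] at hw
    have h := hφ v w hw
    rw [hT.label_of_isLeaf hvl hw, hT.label_of_isLeaf hφl (φ.map_adj_iff.2 hw),
      hT.depthRank_apply hφ hroot hvl hw] at h
    exact Nat.add_left_cancel h
  · classical
    have himage : T.children (φ v) = (T.children v).map φ.toEquiv.toEmbedding := by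
      ext w
      obtain ⟨w, rfl⟩ := φ.surjective w
      rw [hT.mem_children_apply_iff hV hφ hroot]
      exact (Finset.mem_map' φ.toEquiv.toEmbedding).symm
    have hcard : (T.children (φ v)).card = (T.children v).card := by rw [himage, Finset.card_map]
    have htypes : (T.children (φ v)).image τ = (T.children v).image τ := by
      rw [himage, Finset.map_eq_image, Finset.image_image]
      refine Finset.image_congr fun w hw => ih _ ?_ w rfl
      have h1 := (mem_children.1 hw).depth_eq
      have h2 := depth_lt_card (T := T) w
      omega
    rw [hτ.image_children, hτ.image_children, hcard] at htypes
    obtain ⟨w, hw⟩ : ∃ w, T.IsChild v w := by simpa [IsLeaf] using hvl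
    exact Nat.eq_of_image_add_mod_eq (hτ.lt _) (hτ.lt _)
      (Finset.card_pos.2 ⟨w, mem_children.2 hw⟩)
      ((card_children_lt_degree hvr).trans_le (hM v)) htypes

lemma apply_eq (hT : T.IsDeep) (hV : 3 ≤ Fintype.card V)
    (hφ : ∀ x y, G.Adj x y → T.label τ k (φ x) (φ y) = T.label τ k x y)
    (hroot : φ T.root = T.root) (hτ : T.IsTyping M τ) (hM : ∀ v, G.degree v ≤ M)
    (hδ : ∀ v, δ ≤ G.degree v) (hk : M ≤ k ^ δ) (v : V) : φ v = v := by
  induction hd : T.depth v generalizing v with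
  | zero =>
    have hv : v = T.root := by
      by_contra h
      have := T.depth_eq v h
      omega
    rw [hv, hroot]
  | succ n ih =>
    have hv : v ≠ T.root := by
      rintro rfl
      have := T.depth_root
      omega
    have hp := isChild_parent hv
    have hpd := hp.depth_eq
    have hmem := (hT.mem_children_apply_iff hV hφ hroot).2 (mem_children.2 hp)
    rw [ih _ (by omega)] at hmem
    exact hτ.injOn _ hmem (mem_children.2 hp) (hT.type_apply hV hφ hroot hτ hM hδ hk v)

end IsDeep

end Label

end SpanningArborescence

lemma distinguishingIndex_le_of_label {V : Type*} {G : SimpleGraph V} {d : ℕ} (c : V → V → ℕ)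
    (hcomm : ∀ x y, c x y = c y x) (hlt : ∀ x y, G.Adj x y → c x y < d)
    (h : ∀ φ : G ≃g G, (∀ x y, G.Adj x y → c (φ x) (φ y) = c x y) → ∀ v, φ v = v) :
    G.distinguishingIndex ≤ d := by
  have hlt' : ∀ e ∈ G.edgeSet, Sym2.lift ⟨c, hcomm⟩ e < d := by
    intro e
    induction e with
    | _ x y => exact hlt x y
  refine Nat.sInf_le ⟨fun e => ⟨Sym2.lift ⟨c, hcomm⟩ e, hlt' e e.2⟩, fun φ hφ => h φ ?_⟩
  intro x y hxy
  have := congrArg Fin.val (hφ ⟨s(x, y), hxy⟩)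
  simpa using this

end SimpleGraph

theorem distinguishingIndex_le_ceil_rootMinDegree_maxDegree_add_one
    {V : Type*} [Fintype V] (G : SimpleGraph V) [DecidableRel G.Adj]
    (hconn : G.Connected) (hδ : 2 ≤ G.minDegree) :
    G.distinguishingIndex ≤ ⌈(G.maxDegree : ℝ) ^ ((1 : ℝ) / (G.minDegree : ℝ))⌉₊ + 1 := by
  set k := ⌈(G.maxDegree : ℝ) ^ ((1 : ℝ) / (G.minDegree : ℝ))⌉₊ with hkdef
  obtain ⟨v⟩ := hconn.nonempty
  have hdeg := (hδ.trans (G.minDegree_le_degree v))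
  have hΔ : 2 ≤ G.maxDegree := hdeg.trans (G.degree_le_maxDegree v)
  have hV : 3 ≤ Fintype.card V := by
    have := G.degree_lt_card_verts v
    omega
  have hpow : G.maxDegree ≤ k ^ G.minDegree := by
    have h1 : (G.maxDegree : ℝ) ^ ((1 : ℝ) / (G.minDegree : ℝ)) ≤ k := Nat.le_ceil _
    have h2 := pow_le_pow_left₀ (by positivity) h1 G.minDegree
    rw [one_div, Real.rpow_inv_natCast_pow (by positivity) (by omega)] at h2
    exact_mod_cast h2
  have hk : 2 ≤ k := by
    by_contra hk
    have := Nat.pow_le_one_iff (by omega : G.minDegree ≠ 0) |>.2 (by omega : k ≤ 1)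
    omega
  obtain ⟨T, hT⟩ := SimpleGraph.SpanningArborescence.exists_isDeep hconn
  obtain ⟨τ, hτ⟩ := T.exists_isTyping hΔ fun v =>
    (SimpleGraph.SpanningArborescence.card_children_le_degree v).trans (G.degree_le_maxDegree v)
  refine SimpleGraph.distinguishingIndex_le_of_label (T.label τ k)
    (SimpleGraph.SpanningArborescence.label_comm τ k) (fun x y => hT.label_lt (by omega))
    fun φ hφ => ?_
  exact hT.apply_eq hV hφ (hT.apply_root hV hφ hτ hk) hτ G.degree_le_maxDegree
    G.minDegree_le_degree hpow
end

section
/- Let G be a finite connected k-regular simple graph with k ≥ 5. Then D'(G) ≤ 2, i.e. G admits a distinguishing edge labeling with 2 labels. -/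
namespace SimpleGraph.RegularDistinguishing

open Finset
open scoped Classical

set_option linter.unusedSectionVars false

variable {V : Type*} [Fintype V]

/-- The neighbourhood of `v` in `H`, as a finset. -/
noncomputable def nb (H : SimpleGraph V) (v : V) : Finset V := univ.filter (H.Adj v)

/-- The permutation `γ` is an automorphism of `H`. -/
def Pres (γ : Equiv.Perm V) (H : SimpleGraph V) : Prop :=
  ∀ u v, H.Adj (γ u) (γ v) ↔ H.Adj u v

/-- The orbit of `v` under the permutation group `Γ`. -/
noncomputable def orb (Γ : Subgroup (Equiv.Perm V)) (v : V) : Finset V :=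
  univ.filter fun w => ∃ γ ∈ Γ, γ v = w

/-- The subgroup of `Γ` of those permutations that are automorphisms of `R`. -/
def stab (Γ : Subgroup (Equiv.Perm V)) (R : SimpleGraph V) : Subgroup (Equiv.Perm V) where
  carrier := {γ | γ ∈ Γ ∧ Pres γ R}
  mul_mem' := fun ha hb => ⟨Γ.mul_mem ha.1 hb.1, fun u v => (ha.2 _ _).trans (hb.2 u v)⟩
  one_mem' := ⟨Γ.one_mem, fun _ _ => Iff.rfl⟩
  inv_mem' := fun {a} ha => ⟨Γ.inv_mem ha.1, fun u v => by
    simpa using (ha.2 (a⁻¹ u) (a⁻¹ v)).symm⟩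

section Basic

variable {G H E R : SimpleGraph V} {Γ : Subgroup (Equiv.Perm V)} {γ : Equiv.Perm V} {u v w : V}

@[simp] lemma mem_nb : u ∈ nb H v ↔ H.Adj v u := by simp [nb]

lemma mem_orb : u ∈ orb Γ v ↔ ∃ γ ∈ Γ, γ v = u := by simp [orb]

lemma self_mem_orb : v ∈ orb Γ v := mem_orb.2 ⟨1, Γ.one_mem, rfl⟩

lemma apply_mem_orb (hγ : γ ∈ Γ) : γ v ∈ orb Γ v := mem_orb.2 ⟨γ, hγ, rfl⟩

lemma orb_eq_of_mem (h : u ∈ orb Γ v) : orb Γ u = orb Γ v := by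
  obtain ⟨γ, hγ, rfl⟩ := mem_orb.1 h
  ext w
  simp only [mem_orb]
  constructor
  · rintro ⟨δ, hδ, rfl⟩
    exact ⟨δ * γ, Γ.mul_mem hδ hγ, rfl⟩
  · rintro ⟨δ, hδ, rfl⟩
    exact ⟨δ * γ⁻¹, Γ.mul_mem hδ (Γ.inv_mem hγ), by simp⟩

lemma apply_mem_orb_iff (hγ : γ ∈ Γ) : γ u ∈ orb Γ v ↔ u ∈ orb Γ v := by
  have h : orb Γ (γ u) = orb Γ u := orb_eq_of_mem (apply_mem_orb hγ)
  constructor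
  · intro hu
    rw [← orb_eq_of_mem hu, h]
    exact self_mem_orb
  · intro hu
    rw [← orb_eq_of_mem hu]
    exact apply_mem_orb hγ

lemma disjoint_orb (h : orb Γ u ≠ orb Γ v) (hw : w ∈ orb Γ u) : w ∉ orb Γ v := fun hv =>
  h ((orb_eq_of_mem hw).symm.trans (orb_eq_of_mem hv))

lemma orb_mono {Γ' : Subgroup (Equiv.Perm V)} (h : Γ' ≤ Γ) : orb Γ' v ⊆ orb Γ v := by
  intro u hu
  obtain ⟨γ, hγ, rfl⟩ := mem_orb.1 hu
  exact apply_mem_orb (h hγ)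

lemma stab_le : stab Γ R ≤ Γ := fun _ h => h.1

lemma orb_eq_singleton (h : ∀ γ ∈ Γ, γ v = v) : orb Γ v = {v} := by
  ext u
  simp only [mem_orb, mem_singleton]
  constructor
  · rintro ⟨γ, hγ, rfl⟩
    exact h γ hγ
  · rintro rfl
    exact ⟨1, Γ.one_mem, rfl⟩

lemma card_orb_eq_one (h : ∀ γ ∈ Γ, γ v = v) : (orb Γ v).card = 1 := by
  rw [orb_eq_singleton h, card_singleton]

lemma two_le_card_orb (hγ : γ ∈ Γ) (h : γ v ≠ v) : 2 ≤ (orb Γ v).card :=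
  Finset.one_lt_card.2 ⟨γ v, apply_mem_orb hγ, v, self_mem_orb, h⟩

lemma Pres.card_filter_nb (h : Pres γ H) (p : V → Prop) [DecidablePred p]
    (hp : ∀ u, p (γ u) ↔ p u) (v : V) :
    ((nb H (γ v)).filter p).card = ((nb H v).filter p).card := by
  symm
  refine Finset.card_bij (fun u _ => γ u) ?_ ?_ ?_
  · intro u hu
    simp only [mem_filter, mem_nb] at hu ⊢
    exact ⟨(h _ _).2 hu.1, (hp u).2 hu.2⟩
  · intro a _ b _ hab
    exact γ.injective hab
  · intro b hb
    simp only [mem_filter, mem_nb] at hb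
    refine ⟨γ.symm b, ?_, by simp⟩
    simp only [mem_filter, mem_nb]
    rw [← h, ← hp]
    simpa using hb

lemma Pres.card_nb (h : Pres γ H) (v : V) : (nb H (γ v)).card = (nb H v).card := by
  simpa using h.card_filter_nb (fun _ => True) (by simp) v

lemma Pres.sdiff (h : Pres γ H) (h' : Pres γ E) : Pres γ (H \ E) := fun u v => by
  simp only [sdiff_adj, h u v, h' u v]

lemma nb_mono (h : E ≤ H) (v : V) : nb E v ⊆ nb H v := fun _ hu => mem_nb.2 (h (mem_nb.1 hu))

lemma card_nb_sdiff (h : E ≤ H) (v : V) :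
    (nb (H \ E) v).card = (nb H v).card - (nb E v).card := by
  have : nb (H \ E) v = nb H v \ nb E v := by
    ext u
    simp
  rw [this, card_sdiff_of_subset (nb_mono h v)]

lemma card_nb_pos_iff : 0 < (nb H v).card ↔ ∃ u, H.Adj v u := by
  rw [Finset.card_pos]
  exact ⟨fun ⟨u, hu⟩ => ⟨u, mem_nb.1 hu⟩, fun ⟨u, hu⟩ => ⟨u, mem_nb.2 hu⟩⟩

/-- An enumeration of a finset by an initial segment of the natural numbers. -/
lemma exists_enum {α : Type*} (s : Finset α) : ∃ f : α → ℕ, Set.InjOn f s ∧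
    (∀ a ∈ s, f a < s.card) ∧ ∀ i < s.card, ∃ a ∈ s, f a = i := by
  refine ⟨fun a => if h : a ∈ s then s.equivFin ⟨a, h⟩ else 0, ?_, ?_, ?_⟩
  · intro a ha b hb hab
    have ha' : a ∈ s := ha
    have hb' : b ∈ s := hb
    simp only [ha', hb', dif_pos] at hab
    simpa using s.equivFin.injective (Fin.ext hab)
  · intro a ha
    simp [ha]
  · intro i hi
    refine ⟨s.equivFin.symm ⟨i, hi⟩, (s.equivFin.symm ⟨i, hi⟩).2, ?_⟩
    simp

lemma card_filter_enum {α : Type*} {s : Finset α} {f : α → ℕ} (hf : Set.InjOn f s)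
    (hlt : ∀ a ∈ s, f a < s.card) (hs : ∀ i < s.card, ∃ a ∈ s, f a = i) (p : ℕ → Prop)
    [DecidablePred p] [DecidablePred fun a => p (f a)] :
    (s.filter fun a => p (f a)).card = ((range s.card).filter p).card := by
  refine Finset.card_bij (fun a _ => f a) ?_ ?_ ?_
  · intro a ha
    simp only [mem_filter, mem_range] at ha ⊢
    exact ⟨hlt a ha.1, ha.2⟩
  · intro a ha b hb hab
    exact hf (mem_filter.1 ha).1 (mem_filter.1 hb).1 hab
  · intro i hi
    simp only [mem_filter, mem_range] at hi
    obtain ⟨a, ha, rfl⟩ := hs i hi.1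
    exact ⟨a, by simp [ha, hi.2], rfl⟩

lemma card_filter_add_le {m i : ℕ} (hi : i < m) :
    ((range m).filter fun j => j ≠ i ∧ m ≤ i + j).card = if m ≤ 2 * i then i - 1 else i := by
  have h : ((range m).filter fun j => j ≠ i ∧ m ≤ i + j) = (Ico (m - i) m).erase i := by
    ext j
    simp only [mem_filter, mem_range, mem_erase, mem_Ico]
    omega
  rw [h, card_erase_eq_ite, Nat.card_Ico]
  simp only [mem_Ico]
  split_ifs <;> omega

/-- The setting: `Γ` acts on the `k`-regular connected graph `G`, preserves
its subgraph `H` of uncoloured edges and fixes some vertex. -/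
structure Base (k : ℕ) (G H : SimpleGraph V) (Γ : Subgroup (Equiv.Perm V)) : Prop where
  le : H ≤ G
  conn : G.Connected
  deg : ∀ v, (nb G v).card = k
  presG : ∀ γ ∈ Γ, Pres γ G
  pres : ∀ γ ∈ Γ, Pres γ H
  fix : ∃ v, ∀ γ ∈ Γ, γ v = v

/-- Every nontrivial orbit touching an already coloured edge is at most as large as the number of
uncoloured edges at each of its vertices. -/
structure Good (k : ℕ) (G H : SimpleGraph V) (Γ : Subgroup (Equiv.Perm V)) : Prop
    extends Base k G H Γ where
  orb_le : ∀ v, (nb H v).card < k → 2 ≤ (orb Γ v).card → (orb Γ v).card ≤ (nb H v).card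

/-- There is a red subgraph of `H` breaking all symmetries in `Γ` and leaving a blue edge at every
non-isolated vertex of `H`. -/
def Breakable (H : SimpleGraph V) (Γ : Subgroup (Equiv.Perm V)) : Prop :=
  ∃ R ≤ H, (∀ γ ∈ Γ, Pres γ R → γ = 1) ∧
    ∀ v, (∃ u, H.Adj v u) → ∃ u, H.Adj v u ∧ ¬ R.Adj v u

lemma Breakable.of_sdiff {RE : SimpleGraph V} (hE : E ≤ H) (hR : RE ≤ E)
    (hpres : ∀ γ ∈ Γ, Pres γ E)
    (hblue : ∀ v, (∃ u, E.Adj v u) →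
      (∃ u, (H \ E).Adj v u) ∨ ∃ u, E.Adj v u ∧ ¬ RE.Adj v u)
    (h : Breakable (H \ E) (stab Γ RE)) : Breakable H Γ := by
  obtain ⟨R', hR', htriv, hb⟩ := h
  have hcap : ∀ a b, R'.Adj a b → ¬ E.Adj a b := fun a b hab => (hR' hab).2
  refine ⟨RE ⊔ R', sup_le (hR.trans hE) (hR'.trans sdiff_le), ?_, ?_⟩
  · intro γ hγ hP
    have h1 : Pres γ RE := fun u v => by
      have e1 := hP u v
      have e2 := hpres γ hγ u v
      simp only [sup_adj] at e1
      constructor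
      · intro h
        exact (e1.1 (Or.inl h)).resolve_right fun h' => hcap _ _ h' (e2.1 (hR h))
      · intro h
        exact (e1.2 (Or.inl h)).resolve_right fun h' => hcap _ _ h' (e2.2 (hR h))
    refine htriv γ ⟨hγ, h1⟩ fun u v => ?_
    have e1 := hP u v
    have e2 := hpres γ hγ u v
    simp only [sup_adj] at e1
    constructor
    · intro h
      exact (e1.1 (Or.inr h)).resolve_left fun h' => hcap _ _ h (e2.2 (hR h'))
    · intro h
      exact (e1.2 (Or.inr h)).resolve_left fun h' => hcap _ _ h (e2.1 (hR h'))
  · rintro v ⟨u, hu⟩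
    have key : (∃ u, (H \ E).Adj v u) ∨ ∃ u, E.Adj v u ∧ ¬ RE.Adj v u := by
      by_cases hv : ∃ u, E.Adj v u
      · exact hblue v hv
      · exact Or.inl ⟨u, hu, fun h => hv ⟨u, h⟩⟩
    rcases key with h | ⟨w, hw, hw'⟩
    · obtain ⟨w, hw, hw'⟩ := hb v h
      exact ⟨w, hw.1, fun h => h.elim (fun h => hw.2 (hR h)) hw'⟩
    · exact ⟨w, hE hw, fun h => h.elim hw' fun h => hcap _ _ h hw⟩

lemma Base.sdiff {k : ℕ} {RE : SimpleGraph V} (hB : Base k G H Γ) (hpres : ∀ γ ∈ Γ, Pres γ E) :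
    Base k G (H \ E) (stab Γ RE) where
  le := sdiff_le.trans hB.le
  conn := hB.conn
  deg := hB.deg
  presG := fun γ hγ => hB.presG γ hγ.1
  pres := fun γ hγ => (hB.pres γ hγ.1).sdiff (hpres γ hγ.1)
  fix := hB.fix.imp fun _ h γ hγ => h γ hγ.1

lemma Base.good_sdiff {k : ℕ} {RE : SimpleGraph V} (hB : Base k G H Γ) (hE : E ≤ H)
    (hpres : ∀ γ ∈ Γ, Pres γ E)
    (hI : ∀ v, (∃ u, E.Adj v u) → 2 ≤ (orb (stab Γ RE) v).card →
      (orb (stab Γ RE) v).card ≤ (nb H v).card - (nb E v).card)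
    (hI' : ∀ v, (∀ u, ¬ E.Adj v u) → (nb H v).card < k → 2 ≤ (orb Γ v).card →
      (orb Γ v).card ≤ (nb H v).card) :
    Good k G (H \ E) (stab Γ RE) where
  toBase := hB.sdiff hpres
  orb_le := by
    intro v hv h2
    rw [card_nb_sdiff hE] at hv ⊢
    by_cases ht : ∃ u, E.Adj v u
    · exact hI v ht h2
    · have h0 : (nb E v).card = 0 := by
        by_contra h
        exact ht (card_nb_pos_iff.1 (Nat.pos_of_ne_zero h))
      have hle := card_le_card (orb_mono (stab_le : stab Γ RE ≤ Γ) (v := v))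
      push Not at ht
      have := hI' v ht (by omega) (by omega)
      omega

lemma Good.breakable_of_step {k : ℕ} {RE : SimpleGraph V} (hG : Good k G H Γ)
    (IH : ∀ H' < H, ∀ Γ', Good k G H' Γ' → Breakable H' Γ')
    (hE : E ≤ H) (hR : RE ≤ E) (hne : ∃ a b, E.Adj a b) (hpres : ∀ γ ∈ Γ, Pres γ E)
    (hI : ∀ v, (∃ u, E.Adj v u) → 2 ≤ (orb (stab Γ RE) v).card →
      (orb (stab Γ RE) v).card ≤ (nb H v).card - (nb E v).card)
    (hblue : ∀ v, (∃ u, E.Adj v u) →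
      (nb E v).card < (nb H v).card ∨ ∃ u, E.Adj v u ∧ ¬ RE.Adj v u) : Breakable H Γ := by
  refine Breakable.of_sdiff hE hR hpres ?_ (IH _ ?_ _ (hG.toBase.good_sdiff hE hpres hI
    fun v _ => hG.orb_le v))
  · intro v hv
    refine (hblue v hv).imp_left fun h => ?_
    rw [← card_nb_pos_iff, card_nb_sdiff hE]
    omega
  · refine lt_of_le_of_ne sdiff_le fun h => ?_
    obtain ⟨a, b, hab⟩ := hne
    have : (H \ E).Adj a b := by
      rw [h]
      exact hE hab
    exact this.2 hab

lemma Base.card_nb_le {k : ℕ} (hB : Base k G H Γ) (v : V) : (nb H v).card ≤ k :=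
  (card_le_card (nb_mono hB.le v)).trans (hB.deg v).le

lemma card_nb_eq_of_mem_orb (h : ∀ γ ∈ Γ, Pres γ H) (hu : u ∈ orb Γ v) :
    (nb H u).card = (nb H v).card := by
  obtain ⟨γ, hγ, rfl⟩ := mem_orb.1 hu
  exact (h γ hγ).card_nb v

end Basic

section CompletePair

/-- The graph of those pairs between the disjoint sets `O` and `U` that satisfy `ρ`. -/
def joinGraph (O U : Finset V) (ρ : V → V → Prop) : SimpleGraph V :=
  SimpleGraph.fromRel fun a b => a ∈ O ∧ b ∈ U ∧ ρ a b

section JoinGraph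

variable {O U : Finset V} {ρ : V → V → Prop} {a b : V}

lemma joinGraph_adj (hd : ∀ w, w ∈ O → w ∉ U) : (joinGraph O U ρ).Adj a b ↔
    (a ∈ O ∧ b ∈ U ∧ ρ a b) ∨ (a ∈ U ∧ b ∈ O ∧ ρ b a) := by
  simp only [joinGraph, fromRel_adj]
  constructor
  · rintro ⟨_, h | h⟩
    · exact Or.inl h
    · exact Or.inr ⟨h.2.1, h.1, h.2.2⟩
  · rintro (h | h)
    · refine ⟨?_, Or.inl h⟩
      rintro rfl
      exact hd _ h.1 h.2.1
    · refine ⟨?_, Or.inr ⟨h.2.1, h.1, h.2.2⟩⟩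
      rintro rfl
      exact hd _ h.2.1 h.1

lemma joinGraph_adj_left (hd : ∀ w, w ∈ O → w ∉ U) (ha : a ∈ O) :
    (joinGraph O U ρ).Adj a b ↔ b ∈ U ∧ ρ a b := by
  have := hd a ha
  rw [joinGraph_adj hd]
  tauto

lemma joinGraph_adj_right (hd : ∀ w, w ∈ O → w ∉ U) (ha : a ∈ U) :
    (joinGraph O U ρ).Adj a b ↔ b ∈ O ∧ ρ b a := by
  have : a ∉ O := fun h => hd a h ha
  rw [joinGraph_adj hd]
  tauto

end JoinGraph

variable {G H : SimpleGraph V} {Γ : Subgroup (Equiv.Perm V)} {k : ℕ} {x u : V}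

/-- If two distinct orbits are completely joined in `H`, then all edges between them can be
coloured in a nested way. -/
lemma Good.breakable_of_complete (hG : Good k G H Γ)
    (IH : ∀ H' < H, ∀ Γ', Good k G H' Γ' → Breakable H' Γ')
    (hne : orb Γ x ≠ orb Γ u) (hle : (orb Γ x).card ≤ (orb Γ u).card)
    (h2 : 2 ≤ (orb Γ u).card) (hadj : ∀ a ∈ orb Γ x, ∀ b ∈ orb Γ u, H.Adj a b) :
    Breakable H Γ := by
  have hdisj : ∀ w, w ∈ orb Γ x → w ∉ orb Γ u := fun w hw => disjoint_orb hne hw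
  have hxO : x ∈ orb Γ x := self_mem_orb
  have huU : u ∈ orb Γ u := self_mem_orb
  have hOinv : ∀ γ ∈ Γ, ∀ v, γ v ∈ orb Γ x ↔ v ∈ orb Γ x := fun γ hγ v => apply_mem_orb_iff hγ
  have hUinv : ∀ γ ∈ Γ, ∀ v, γ v ∈ orb Γ u ↔ v ∈ orb Γ u := fun γ hγ v => apply_mem_orb_iff hγ
  have hUorb : ∀ b ∈ orb Γ u, orb Γ b = orb Γ u := fun b hb => orb_eq_of_mem hb
  generalize orb Γ x = O at *
  generalize orb Γ u = U at *
  obtain ⟨f, finj, flt, fsurj⟩ := exists_enum O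
  obtain ⟨g, ginj, glt, gsurj⟩ := exists_enum U
  have hOpos : 0 < O.card := card_pos.2 ⟨x, hxO⟩
  set t := min O.card (U.card - 1) with ht
  let E : SimpleGraph V := joinGraph O U fun _ _ => True
  let RE : SimpleGraph V := joinGraph O U fun a b => f a < t ∧ g b ≤ f a
  have hEO : ∀ a b, a ∈ O → (E.Adj a b ↔ b ∈ U) := fun a b ha => by
    simp [E, joinGraph_adj_left hdisj ha]
  have hEU : ∀ a b, a ∈ U → (E.Adj a b ↔ b ∈ O) := fun a b ha => by
    simp [E, joinGraph_adj_right hdisj ha]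
  have hRO : ∀ a b, a ∈ O → (RE.Adj a b ↔ b ∈ U ∧ f a < t ∧ g b ≤ f a) := fun a b ha =>
    joinGraph_adj_left hdisj ha
  have hEtouch : ∀ v, (∃ w, E.Adj v w) → v ∈ O ∨ v ∈ U := by
    rintro v ⟨w, hw⟩
    exact (joinGraph_adj hdisj).1 hw |>.imp And.left fun h => h.1
  have hcardEU : ∀ v ∈ U, (nb E v) = O := by
    intro v hv
    ext w
    rw [mem_nb, hEU v w hv]
  have hRcard : ∀ a ∈ O, (nb RE a).card = if f a < t then f a + 1 else 0 := by
    intro a ha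
    split_ifs with hfa
    · have h1 : nb RE a = U.filter fun b => g b ≤ f a := by
        ext b
        rw [mem_nb, hRO a b ha, mem_filter]
        tauto
      rw [h1, card_filter_enum ginj glt gsurj (fun j => j ≤ f a)]
      have h3 : (range U.card).filter (fun j => j ≤ f a) = range (f a + 1) := by
        ext j
        simp only [mem_filter, mem_range]
        omega
      rw [h3, card_range]
    · rw [card_eq_zero]
      ext b
      simp only [mem_nb, hRO a b ha]
      simp [hfa]
  have hfixO : ∀ γ ∈ stab Γ RE, ∀ a ∈ O, γ a = a := by
    intro γ hγ a ha
    have ha' : γ a ∈ O := (hOinv γ hγ.1 a).2 ha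
    have h1 := hγ.2.card_nb a
    rw [hRcard _ ha', hRcard _ ha] at h1
    have h3 := flt _ ha
    have h4 := flt _ ha'
    refine finj ha' ha ?_
    split_ifs at h1 <;> omega
  have hmono : ∀ γ ∈ stab Γ RE, ∀ b ∈ U, g b < t → g (γ b) ≤ g b := by
    intro γ hγ b hb hbt
    obtain ⟨a, ha, hab⟩ := fsurj (g b) (by omega)
    have h1 : RE.Adj a b := (hRO a b ha).2 ⟨hb, by omega, by omega⟩
    have h3 := (hγ.2 a b).2 h1
    rw [hfixO γ hγ a ha, hRO a _ ha] at h3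
    omega
  have hfixU : ∀ γ ∈ stab Γ RE, ∀ b ∈ U, g b < t → γ b = b := by
    intro γ hγ b hb hbt
    have hb' : γ b ∈ U := (hUinv γ hγ.1 b).2 hb
    have h1 := hmono γ hγ b hb hbt
    have h3 := hmono γ⁻¹ ((stab Γ RE).inv_mem hγ) (γ b) hb' (by omega)
    rw [Equiv.Perm.coe_inv, Equiv.symm_apply_apply] at h3
    exact ginj hb' hb (by omega)
  have hfdU : ∀ b ∈ U, U.card ≤ (nb H b).card := by
    intro b hb
    rcases lt_or_ge (nb H b).card k with h | h
    · have h1 := hG.orb_le b h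
      rw [hUorb b hb] at h1
      exact h1 h2
    · refine (card_le_card ?_).trans ((hG.card_nb_le x).trans h)
      intro w hw
      exact mem_nb.2 (hadj x hxO w hw)
  refine hG.breakable_of_step IH (E := E) (RE := RE) ?_ ?_ ?_ ?_ ?_ ?_
  · intro a b hab
    rcases (joinGraph_adj hdisj).1 hab with h | h
    · exact hadj a h.1 b h.2.1
    · exact (hadj b h.2.1 a h.1).symm
  · intro a b hab
    rw [joinGraph_adj hdisj] at hab ⊢
    exact hab.imp (fun h => ⟨h.1, h.2.1, trivial⟩) fun h => ⟨h.1, h.2.1, trivial⟩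
  · exact ⟨x, u, (hEO x u hxO).2 huU⟩
  · intro γ hγ a b
    simp only [E, joinGraph_adj hdisj, hOinv γ hγ, hUinv γ hγ]
  · intro v hv hv2
    rcases hEtouch v hv with h | h
    · rw [card_orb_eq_one fun γ hγ => hfixO γ hγ v h] at hv2
      omega
    · rw [hcardEU v h]
      by_cases hvt : g v < t
      · rw [card_orb_eq_one fun γ hγ => hfixU γ hγ v h hvt] at hv2
        omega
      have hsub : orb (stab Γ RE) v ⊆ U.filter fun b => t ≤ g b := by
        intro w hw
        obtain ⟨γ, hγ, rfl⟩ := mem_orb.1 hw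
        have hw' : γ v ∈ U := (hUinv γ hγ.1 v).2 h
        refine mem_filter.2 ⟨hw', ?_⟩
        by_contra hcon
        have := hfixU γ⁻¹ ((stab Γ RE).inv_mem hγ) (γ v) hw' (by omega)
        rw [Equiv.Perm.coe_inv, Equiv.symm_apply_apply] at this
        rw [← this] at hcon
        omega
      have h5 := card_le_card hsub
      rw [card_filter_enum ginj glt gsurj (fun j => t ≤ j)] at h5
      have h3 : (range U.card).filter (fun j => t ≤ j) = Ico t U.card := by
        ext j
        simp only [mem_filter, mem_range, mem_Ico]
        omega
      rw [h3, Nat.card_Ico] at h5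
      have := hfdU v h
      omega
  · intro v hv
    rcases hEtouch v hv with h | h
    · right
      obtain ⟨b, hb, hgb⟩ := gsurj (U.card - 1) (by omega)
      refine ⟨b, (hEO v b h).2 hb, fun hr => ?_⟩
      rw [hRO v b h] at hr
      omega
    · rw [hcardEU v h]
      rcases hle.eq_or_lt with heq | hlt
      · right
        obtain ⟨a, ha, hfa⟩ := fsurj (O.card - 1) (by omega)
        refine ⟨a, (hEU v a h).2 ha, fun hr => ?_⟩
        rw [RE.adj_comm, hRO a v ha] at hr
        omega
      · left
        have := hfdU v h
        omega

end CompletePair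

section Inner

/-- A regular graph on `O` which is neither empty nor complete can be coloured so that
colour-preserving automorphisms have small orbits. -/
lemma exists_inner_coloring (O : Finset V) (F : SimpleGraph V) {s : ℕ}
    (hF : ∀ a b, F.Adj a b → b ∈ O) (hdeg : ∀ v ∈ O, (nb F v).card = s) (hs : 1 ≤ s)
    (hsm : s + 2 ≤ O.card) :
    ∃ R ≤ F, ∃ x ∈ O, nb R x = nb F x ∧ (2 ≤ s → ∀ v ∈ O, v ≠ x → (nb R v).card < s) ∧
      ∀ Γ : Subgroup (Equiv.Perm V),
        (∀ γ ∈ Γ, (∀ v, γ v ∈ O ↔ v ∈ O) ∧ Pres γ F ∧ Pres γ R) →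
        ∀ v ∈ O, (orb Γ v).card ≤ max 2 (O.card - 1 - s) := by
  obtain ⟨x, hx⟩ : O.Nonempty := card_pos.1 (by omega)
  obtain ⟨Y, hY⟩ : ∃ Y, Y = nb F x := ⟨_, rfl⟩
  have hYadj : ∀ y, y ∈ Y ↔ F.Adj x y := fun y => by rw [hY, mem_nb]
  have hYO : Y ⊆ O := fun y hy => hF x y ((hYadj y).1 hy)
  have hYc : Y.card = s := by rw [hY, hdeg x hx]
  have hxY : x ∉ Y := fun h => F.loopless.irrefl x ((hYadj x).1 h)
  obtain ⟨Z, hZ⟩ : ∃ Z, Z = O \ insert x Y := ⟨_, rfl⟩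
  have hZmem : ∀ z, z ∈ Z ↔ z ∈ O ∧ z ≠ x ∧ z ∉ Y := fun z => by
    rw [hZ, mem_sdiff, mem_insert, not_or]
  have hZc : Z.card = O.card - 1 - s := by
    rw [hZ, card_sdiff_of_subset (insert_subset hx hYO), card_insert_of_notMem hxY]
    omega
  obtain ⟨f, finj, flt, fsurj⟩ := exists_enum Y
  let n : V → ℕ := fun y => (Y.filter fun y' => (y' ≠ y ∧ s ≤ f y + f y') ∧ ¬ F.Adj y y').card
  have hn : ∀ y ∈ Y, n y ≤ ((nb F y).filter (· ∈ Z)).card := by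
    intro y hy
    have h1 : n y ≤ ((Y.erase y).filter fun y' => ¬ F.Adj y y').card := by
      refine card_le_card fun y' hy' => ?_
      simp only [mem_filter, mem_erase] at hy' ⊢
      tauto
    have h2 := card_filter_add_card_filter_not (s := Y.erase y) (fun y' => F.Adj y y')
    have h3 : nb F y ⊆ insert x ((Y.erase y).filter (fun y' => F.Adj y y') ∪
        (nb F y).filter (· ∈ Z)) := by
      intro w hw
      have hw' := mem_nb.1 hw
      have hwy : w ≠ y := hw'.ne'
      have := hF y w hw'
      simp only [mem_insert, mem_union, mem_filter, mem_erase, hZmem]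
      tauto
    have h4 := card_le_card h3
    have h5 := card_insert_le x ((Y.erase y).filter (fun y' => F.Adj y y') ∪
        (nb F y).filter (· ∈ Z))
    have h6 := card_union_le ((Y.erase y).filter (fun y' => F.Adj y y'))
        ((nb F y).filter (· ∈ Z))
    rw [hdeg y (hYO hy)] at h4
    rw [card_erase_of_mem hy, hYc] at h2
    omega
  have hT : ∀ y, ∃ T ⊆ (nb F y).filter (· ∈ Z), y ∈ Y → T.card = n y := by
    intro y
    by_cases hy : y ∈ Y
    · obtain ⟨T, hT, hT'⟩ := exists_subset_card_eq (hn y hy)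
      exact ⟨T, hT, fun _ => hT'⟩
    · exact ⟨∅, empty_subset _, fun h => absurd h hy⟩
  choose T hTsub hTcard using hT
  have hTZ : ∀ y z, z ∈ T y → F.Adj y z ∧ z ∈ Z := fun y z hz => by
    simpa using hTsub y hz
  let ρ : V → V → Prop := fun a b =>
    (a = x ∧ b ∈ Y) ∨ (a ∈ Y ∧ b ∈ Y ∧ F.Adj a b ∧ s ≤ f a + f b) ∨ (a ∈ Y ∧ b ∈ T a)
  have hρF : ∀ a b, ρ a b → F.Adj a b := by
    rintro a b (⟨rfl, h⟩ | h | h)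
    · exact (hYadj b).1 h
    · exact h.2.2.1
    · exact (hTZ a b h.2).1
  let R : SimpleGraph V := SimpleGraph.fromRel ρ
  have hR : ∀ a b, R.Adj a b ↔ ρ a b ∨ ρ b a := by
    intro a b
    simp only [R, fromRel_adj]
    refine ⟨fun h => h.2, fun h => ⟨?_, h⟩⟩
    rcases h with h | h
    · exact (hρF a b h).ne
    · exact (hρF b a h).ne'
  have hRF : R ≤ F := by
    intro a b hab
    rcases (hR a b).1 hab with h | h
    · exact hρF a b h
    · exact (hρF b a h).symm
  have hxZ : x ∉ Z := fun h => ((hZmem x).1 h).2.1 rfl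
  have hRx : nb R x = nb F x := by
    rw [← hY]
    ext w
    have h1 : x ∉ T w := fun h => hxZ (hTZ w x h).2
    simp only [mem_nb, hR, ρ]
    tauto
  have hRy : ∀ y ∈ Y, (nb R y).card = 1 + if s ≤ 2 * f y then f y - 1 else f y := by
    intro y hy
    have hyx : y ≠ x := fun h => hxY (h ▸ hy)
    have hyT : ∀ w, y ∉ T w := fun w h => ((hZmem y).1 (hTZ w y h).2).2.2 hy
    have h1 : nb R y = insert x ((Y.filter fun y' => (y' ≠ y ∧ s ≤ f y + f y') ∧ F.Adj y y') ∪
        T y) := by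
      ext w
      have h2 := hyT w
      have h3 : F.Adj w y ↔ F.Adj y w := F.adj_comm w y
      have h4 : F.Adj y w → w ≠ y := fun h => h.ne'
      have h5 : f w + f y = f y + f w := add_comm _ _
      simp only [mem_nb, hR, ρ, mem_insert, mem_union, mem_filter, h3, h5]
      tauto
    have hd : Disjoint (Y.filter fun y' => (y' ≠ y ∧ s ≤ f y + f y') ∧ F.Adj y y') (T y) := by
      rw [Finset.disjoint_left]
      intro w hw hw'
      exact ((hZmem w).1 (hTZ y w hw').2).2.2 (mem_filter.1 hw).1
    have hxn : x ∉ (Y.filter fun y' => (y' ≠ y ∧ s ≤ f y + f y') ∧ F.Adj y y') ∪ T y := by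
      rw [mem_union, mem_filter]
      rintro (h | h)
      · exact hxY h.1
      · exact hxZ (hTZ y x h).2
    rw [h1, card_insert_of_notMem hxn, card_union_of_disjoint hd, hTcard y hy]
    have h2 := card_filter_add_card_filter_not
      (s := Y.filter fun y' => y' ≠ y ∧ s ≤ f y + f y') (fun y' => F.Adj y y')
    rw [filter_filter, filter_filter] at h2
    simp only [n]
    rw [h2]
    have h3 : (Y.filter fun y' => y' ≠ y ∧ s ≤ f y + f y') =
        Y.filter fun y' => f y' ≠ f y ∧ s ≤ f y + f y' := by
      refine filter_congr fun y' hy' => ?_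
      have : f y' ≠ f y ↔ y' ≠ y := (finj.eq_iff hy' hy).not
      rw [this]
    rw [h3, card_filter_enum finj flt fsurj (fun j => j ≠ f y ∧ s ≤ f y + j), hYc,
      card_filter_add_le (hYc ▸ flt y hy), add_comm]
  have hRz : ∀ z ∈ Z, (nb R z).card < s := by
    intro z hz
    have hz' := (hZmem z).1 hz
    obtain ⟨y, hy, hy0⟩ := fsurj 0 (by omega)
    have hTy : T y = ∅ := by
      rw [← card_eq_zero, hTcard y hy]
      simp only [n]
      rw [card_eq_zero, filter_eq_empty_iff]
      intro y' hy' h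
      have := flt y' hy'
      omega
    have h1 : nb R z ⊆ Y.erase y := by
      intro w hw
      have hzw : z ≠ w := (mem_nb.1 hw).ne
      simp only [mem_nb, hR, ρ] at hw
      rw [mem_erase]
      have : w ∈ Y ∧ z ∈ T w := by tauto
      refine ⟨?_, this.1⟩
      rintro rfl
      rw [hTy] at this
      exact notMem_empty _ this.2
    have h2 := card_le_card h1
    rw [card_erase_of_mem hy] at h2
    omega
  have hO : ∀ v ∈ O, v = x ∨ v ∈ Y ∨ v ∈ Z := by
    intro v hv
    rw [hZmem]
    tauto
  have huniq : 2 ≤ s → ∀ v ∈ O, v ≠ x → (nb R v).card < s := by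
    intro hs2 v hv hvx
    rcases hO v hv with h | h | h
    · exact absurd h hvx
    · have h1 := flt v h
      rw [hRy v h]
      split_ifs <;> omega
    · exact hRz v h
  refine ⟨R, hRF, x, hx, hRx, huniq, ?_⟩
  intro Γ hΓ v hv
  have hZinv : (∀ γ ∈ Γ, ∀ w, γ w ∈ Z ↔ w ∈ Z) → v ∈ Z → (orb Γ v).card ≤ O.card - 1 - s := by
    intro h hvZ
    rw [← hZc]
    refine card_le_card fun w hw => ?_
    obtain ⟨γ, hγ, rfl⟩ := mem_orb.1 hw
    exact (h γ hγ v).2 hvZ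
  rcases hs.eq_or_lt with hs1 | hs2
  · obtain ⟨y, hy⟩ := card_eq_one.1 (hYc.trans hs1.symm)
    have hyY : y ∈ Y := by simp [hy]
    have hRpos : ∀ w ∈ O, w ∈ Z ↔ (nb R w).card = 0 := by
      intro w hw
      rcases hO w hw with h | h | h
      · subst h
        simp [hxZ, hRx, hdeg w hx, ← hs1]
      · have h1 : w ∉ Z := fun hz => ((hZmem w).1 hz).2.2 h
        simp [h1, hRy w h]
      · have := hRz w h
        simp only [h, true_iff]
        omega
    have hinv : ∀ γ ∈ Γ, ∀ w, γ w ∈ Z ↔ w ∈ Z := by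
      intro γ hγ w
      obtain ⟨h1, -, h3⟩ := hΓ γ hγ
      have hZO : ∀ z, z ∈ Z → z ∈ O := fun z hz => ((hZmem z).1 hz).1
      by_cases hw : w ∈ O
      · rw [hRpos _ ((h1 w).2 hw), hRpos w hw, h3.card_nb]
      · exact ⟨fun h => absurd ((h1 w).1 (hZO _ h)) hw, fun h => absurd (hZO _ h) hw⟩
    by_cases hvZ : v ∈ Z
    · exact (hZinv hinv hvZ).trans (le_max_right _ _)
    · refine le_trans ?_ (le_max_left _ _)
      refine (card_le_card (t := {x, y}) fun w hw => ?_).trans card_le_two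
      obtain ⟨γ, hγ, rfl⟩ := mem_orb.1 hw
      have h1 : γ v ∈ O := ((hΓ γ hγ).1 v).2 hv
      have h2 : γ v ∉ Z := fun h => hvZ ((hinv γ hγ v).1 h)
      rcases hO _ h1 with h | h | h
      · simp [h]
      · rw [hy, mem_singleton] at h
        simp [h]
      · exact absurd h h2
  · have hfix : ∀ γ ∈ Γ, γ x = x := by
      intro γ hγ
      by_contra hne
      obtain ⟨h1, -, h3⟩ := hΓ γ hγ
      have h4 := huniq hs2 (γ x) ((h1 x).2 hx) hne
      rw [h3.card_nb, hRx, hdeg x hx] at h4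
      omega
    have hYinv : ∀ γ ∈ Γ, ∀ w, γ w ∈ Y ↔ w ∈ Y := by
      intro γ hγ w
      have := (hΓ γ hγ).2.1 x w
      rwa [hfix γ hγ, ← hYadj, ← hYadj] at this
    rcases hO v hv with h | h | h
    · subst h
      rw [card_orb_eq_one hfix]
      exact le_trans (by norm_num) (le_max_left _ _)
    · refine le_trans ?_ (le_max_left _ _)
      obtain ⟨j, hj⟩ : ∃ j, j = if s ≤ 2 * f v then f v - 1 else f v := ⟨_, rfl⟩
      have h1 : (orb Γ v).image f ⊆ {j, j + 1} := by
        intro i hi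
        obtain ⟨w, hw, rfl⟩ := mem_image.1 hi
        obtain ⟨γ, hγ, rfl⟩ := mem_orb.1 hw
        have h2 := (hΓ γ hγ).2.2.card_nb v
        rw [hRy _ ((hYinv γ hγ v).2 h), hRy v h, ← hj] at h2
        simp only [mem_insert, mem_singleton]
        split_ifs at h2 <;> omega
      have h2 : Set.InjOn f (orb Γ v) := by
        refine finj.mono fun w hw => ?_
        obtain ⟨γ, hγ, rfl⟩ := mem_orb.1 hw
        exact (hYinv γ hγ v).2 h
      rw [← card_image_of_injOn h2]
      exact (card_le_card h1).trans card_le_two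
    · refine (hZinv (fun γ hγ w => ?_) h).trans (le_max_right _ _)
      rw [hZmem, hZmem, (hΓ γ hγ).1 w, hYinv γ hγ w]
      have : γ w = x ↔ w = x := by
        rw [← hfix γ hγ, EmbeddingLike.apply_eq_iff_eq, hfix γ hγ]
      rw [Ne, this]

variable {G H : SimpleGraph V} {Γ : Subgroup (Equiv.Perm V)} {k : ℕ}

/-- The subgraph of `H` induced on `O`, as a graph on all of `V`. -/
def inside (H : SimpleGraph V) (O : Finset V) : SimpleGraph V where
  Adj a b := H.Adj a b ∧ a ∈ O ∧ b ∈ O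
  symm := ⟨fun _ _ h => ⟨h.1.symm, h.2.2, h.2.1⟩⟩
  loopless := ⟨fun _ h => h.1.ne rfl⟩

lemma inside_adj {O : Finset V} {a b : V} :
    (inside H O).Adj a b ↔ H.Adj a b ∧ a ∈ O ∧ b ∈ O := Iff.rfl

lemma inside_le {O : Finset V} : inside H O ≤ H := fun _ _ h => h.1

lemma nb_inside {O : Finset V} {v : V} (hv : v ∈ O) : nb (inside H O) v = nb H v ∩ O := by
  ext w
  simp [inside_adj, hv]

lemma Pres.inside {γ : Equiv.Perm V} {O : Finset V} (h : Pres γ H) (hO : ∀ v, γ v ∈ O ↔ v ∈ O) :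
    Pres γ (inside H O) := fun a b => by
  rw [inside_adj, inside_adj, h a b, hO, hO]

lemma Good.breakable_of_inside (hG : Good k G H Γ)
    (IH : ∀ H' < H, ∀ Γ', Good k G H' Γ' → Breakable H' Γ') {x : V} {s : ℕ}
    (hdeg : ∀ v ∈ orb Γ x, (nb H v ∩ orb Γ x).card = s) (hs : 1 ≤ s)
    (hsm : s + 2 ≤ (orb Γ x).card) (hk : (nb H x).card < k) : Breakable H Γ := by
  have hfd : ∀ v ∈ orb Γ x, (orb Γ x).card ≤ (nb H v).card := by
    intro v hv
    rw [card_nb_eq_of_mem_orb hG.pres hv]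
    exact hG.orb_le x hk (by omega)
  have hdeg' : ∀ v ∈ orb Γ x, (nb (inside H (orb Γ x)) v).card = s := fun v hv => by
    rw [nb_inside hv, hdeg v hv]
  have hpres : ∀ γ ∈ Γ, Pres γ (inside H (orb Γ x)) := fun γ hγ =>
    (hG.pres γ hγ).inside fun v => apply_mem_orb_iff hγ
  obtain ⟨R, hR, -, -, -, -, horb⟩ := exists_inner_coloring (orb Γ x) (inside H (orb Γ x))
    (fun a b h => h.2.2) hdeg' hs hsm
  refine hG.breakable_of_step IH inside_le hR ?_ hpres ?_ ?_
  · obtain ⟨u, hu⟩ := card_nb_pos_iff.1 (hs.trans (hdeg' x self_mem_orb).ge)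
    exact ⟨x, u, hu⟩
  · rintro v ⟨u, hu⟩ -
    have h1 := horb (stab Γ R) (fun γ hγ => ⟨fun v => apply_mem_orb_iff hγ.1, hpres γ hγ.1, hγ.2⟩)
      v hu.2.1
    have h2 := hfd v hu.2.1
    rw [hdeg' v hu.2.1]
    omega
  · rintro v ⟨u, hu⟩
    left
    have h2 := hfd v hu.2.1
    rw [hdeg' v hu.2.1]
    omega

end Inner

section Touching

variable {G H : SimpleGraph V} {Γ : Subgroup (Equiv.Perm V)} {k : ℕ}

/-- The subgraph of the edges of `H` with an endpoint in `O`. -/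
def touching (H : SimpleGraph V) (O : Finset V) : SimpleGraph V where
  Adj a b := H.Adj a b ∧ (a ∈ O ∨ b ∈ O)
  symm := ⟨fun _ _ h => ⟨h.1.symm, h.2.symm⟩⟩
  loopless := ⟨fun _ h => h.1.ne rfl⟩

lemma touching_adj {O : Finset V} {a b : V} :
    (touching H O).Adj a b ↔ H.Adj a b ∧ (a ∈ O ∨ b ∈ O) := Iff.rfl

lemma touching_le {O : Finset V} : touching H O ≤ H := fun _ _ h => h.1

lemma nb_touching_of_notMem {O : Finset V} {v : V} (hv : v ∉ O) :
    nb (touching H O) v = nb H v ∩ O := by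
  ext w
  simp [touching_adj, hv]

lemma Pres.touching {γ : Equiv.Perm V} {O : Finset V} (h : Pres γ H)
    (hO : ∀ v, γ v ∈ O ↔ v ∈ O) : Pres γ (touching H O) := fun a b => by
  rw [touching_adj, touching_adj, h a b, hO, hO]

/-- If `γ` fixes `O` pointwise, then `v` and `γ v` have the same neighbours in `O`. -/
lemma Pres.nb_inter_eq {γ : Equiv.Perm V} {O : Finset V} (h : Pres γ H)
    (hO : ∀ v ∈ O, γ v = v) (v : V) : nb H (γ v) ∩ O = nb H v ∩ O := by
  ext w
  simp only [mem_inter, mem_nb]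
  refine and_congr_left fun hw => ?_
  have := h v w
  rwa [hO w hw] at this

/-- Double counting of the edges between two orbits. -/
lemma card_orb_mul (hpres : ∀ γ ∈ Γ, Pres γ H) (x u : V) :
    (orb Γ u).card * (nb H u ∩ orb Γ x).card = (orb Γ x).card * (nb H x ∩ orb Γ u).card := by
  have hconst : ∀ a b, ∀ c ∈ orb Γ a, (nb H c ∩ orb Γ b).card = (nb H a ∩ orb Γ b).card := by
    intro a b c hc
    obtain ⟨γ, hγ, rfl⟩ := mem_orb.1 hc
    have := (hpres γ hγ).card_filter_nb (· ∈ orb Γ b) (fun w => apply_mem_orb_iff hγ) a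
    rwa [filter_mem_eq_inter, filter_mem_eq_inter] at this
  have h := Finset.sum_card_bipartiteAbove_eq_sum_card_bipartiteBelow (s := orb Γ u)
    (t := orb Γ x) H.Adj
  have h1 : ∀ c ∈ orb Γ u, ((orb Γ x).bipartiteAbove H.Adj c).card = (nb H u ∩ orb Γ x).card := by
    intro c hc
    rw [← hconst u x c hc]
    congr 1
    ext w
    simp [bipartiteAbove, and_comm]
  have h2 : ∀ c ∈ orb Γ x, ((orb Γ u).bipartiteBelow H.Adj c).card = (nb H x ∩ orb Γ u).card := by
    intro c hc
    rw [← hconst x u c hc]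
    congr 1
    ext w
    simp [bipartiteBelow, and_comm, H.adj_comm]
  rw [sum_congr rfl h1, sum_congr rfl h2, sum_const, sum_const, smul_eq_mul, smul_eq_mul] at h
  exact h

/-- Colouring all edges touching a smallest suitable orbit `O`, with distinct red degrees on
`O`. -/
lemma Good.breakable_of_touching (hG : Good k G H Γ)
    (IH : ∀ H' < H, ∀ Γ', Good k G H' Γ' → Breakable H' Γ') {x : V} (hk : (nb H x).card < k)
    (h2 : 2 ≤ (orb Γ x).card)
    (hmin : ∀ u, (nb H u).card < k → 2 ≤ (orb Γ u).card → (orb Γ x).card ≤ (orb Γ u).card)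
    (hnc : ∀ a b, orb Γ a ≠ orb Γ b → (orb Γ a).card ≤ (orb Γ b).card → 2 ≤ (orb Γ b).card →
      ∃ a' ∈ orb Γ a, ∃ b' ∈ orb Γ b, ¬ H.Adj a' b')
    {RE : SimpleGraph V} (hR : RE ≤ touching H (orb Γ x)) {f : V → ℕ}
    (finj : Set.InjOn f (orb Γ x)) (flt : ∀ a ∈ orb Γ x, f a < (orb Γ x).card)
    (hRcard : ∀ a ∈ orb Γ x, (nb RE a).card = f a)
    (hfresh : (∀ γ ∈ stab Γ RE, ∀ a ∈ orb Γ x, γ a = a) → ∀ u ∉ orb Γ x, (nb H u).card = k →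
      (nb H u ∩ orb Γ x).Nonempty → 2 ≤ (orb (stab Γ RE) u).card →
      (orb (stab Γ RE) u).card + (nb H u ∩ orb Γ x).card ≤ k) : Breakable H Γ := by
  have hfd : ∀ v ∈ orb Γ x, (orb Γ x).card ≤ (nb H v).card := by
    intro v hv
    rw [card_nb_eq_of_mem_orb hG.pres hv]
    exact hG.orb_le x hk h2
  have hfix : ∀ γ ∈ stab Γ RE, ∀ a ∈ orb Γ x, γ a = a := by
    intro γ hγ a ha
    have ha' : γ a ∈ orb Γ x := (apply_mem_orb_iff hγ.1).2 ha
    refine finj ha' ha ?_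
    rw [← hRcard _ ha', ← hRcard _ ha, hγ.2.card_nb]
  have hpres : ∀ γ ∈ Γ, Pres γ (touching H (orb Γ x)) := fun γ hγ =>
    (hG.pres γ hγ).touching fun v => apply_mem_orb_iff hγ
  have hm := hfd x self_mem_orb
  have hqm : ∀ u, (nb H u ∩ orb Γ x).card ≤ (orb Γ x).card := fun u =>
    card_le_card inter_subset_right
  have hold : ∀ u ∉ orb Γ x, (nb H u).card < k → (nb H u ∩ orb Γ x).Nonempty →
      (nb H u ∩ orb Γ x).card < (nb H u).card ∧
      (orb (stab Γ RE) u).card + (nb H u ∩ orb Γ x).card ≤ (nb H u).card := by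
    intro u hu huk hne
    have hou : orb Γ x ≠ orb Γ u := fun h => hu (h ▸ self_mem_orb)
    have hall : ¬ orb Γ x ⊆ nb H u := by
      intro hsub
      have hcomp : ∀ b ∈ orb Γ u, ∀ a ∈ orb Γ x, H.Adj b a := by
        intro b hb a ha
        obtain ⟨γ, hγ, rfl⟩ := mem_orb.1 hb
        have h1 : γ⁻¹ a ∈ orb Γ x := (apply_mem_orb_iff (Γ.inv_mem hγ)).2 ha
        have h3 := (hG.pres γ hγ u (γ⁻¹ a)).2 (mem_nb.1 (hsub h1))
        simpa using h3
      rcases le_total (orb Γ x).card (orb Γ u).card with h | h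
      · obtain ⟨a, ha, b, hb, hab⟩ := hnc x u hou h (h2.trans h)
        exact hab (hcomp b hb a ha).symm
      · obtain ⟨b, hb, a, ha, hab⟩ := hnc u x hou.symm h h2
        exact hab (hcomp b hb a ha)
    have hρ2 : 2 ≤ (orb Γ u).card := by
      by_contra hlt
      have hpos : 0 < (orb Γ u).card := card_pos.2 ⟨u, self_mem_orb⟩
      obtain ⟨w, hw⟩ := card_eq_one.1 (show (orb Γ u).card = 1 by omega)
      have hfixu : ∀ γ ∈ Γ, γ u = u := by
        intro γ hγ
        have h1 : γ u ∈ orb Γ u := apply_mem_orb hγ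
        have h3 : u ∈ orb Γ u := self_mem_orb
        rw [hw, mem_singleton] at h1 h3
        rw [h1]
        exact h3.symm
      refine hall fun a ha => ?_
      obtain ⟨c, hc⟩ := hne
      rw [mem_inter, mem_nb] at hc
      rw [← orb_eq_of_mem hc.2] at ha
      obtain ⟨γ, hγ, rfl⟩ := mem_orb.1 ha
      have h1 := (hG.pres γ hγ u c).2 hc.1
      rw [hfixu γ hγ] at h1
      exact mem_nb.2 h1
    have hρ := hmin u huk hρ2
    have hρfd := hG.orb_le u huk hρ2
    have hqlt : (nb H u ∩ orb Γ x).card < (orb Γ x).card := by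
      refine card_lt_card ⟨inter_subset_right, fun h => hall fun a ha => ?_⟩
      exact (mem_inter.1 (h ha)).1
    refine ⟨by omega, ?_⟩
    obtain ⟨x', hx', hx'u⟩ := not_subset.1 hall
    have hcount := card_orb_mul hG.pres x' u
    rw [orb_eq_of_mem hx'] at hcount
    have hqp : (nb H u ∩ orb Γ x).card ≤ (nb H x' ∩ orb Γ u).card := by
      by_contra hlt
      push Not at hlt
      have h1 : (orb Γ x).card * (nb H x' ∩ orb Γ u).card
          ≤ (orb Γ u).card * (nb H x' ∩ orb Γ u).card := Nat.mul_le_mul_right _ hρ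
      have h3 : (orb Γ u).card * (nb H x' ∩ orb Γ u).card
          < (orb Γ u).card * (nb H u ∩ orb Γ x).card :=
        Nat.mul_lt_mul_of_pos_left hlt (by omega)
      omega
    have hdisj : Disjoint (orb (stab Γ RE) u) (nb H x' ∩ orb Γ u) := by
      rw [Finset.disjoint_left]
      intro w hw hw'
      obtain ⟨γ, hγ, rfl⟩ := mem_orb.1 hw
      have h1 := (hG.pres γ hγ.1).nb_inter_eq (hfix γ hγ) u
      have h3 : x' ∈ nb H (γ u) ∩ orb Γ x :=
        mem_inter.2 ⟨mem_nb.2 (mem_nb.1 (mem_inter.1 hw').1).symm, hx'⟩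
      rw [h1] at h3
      exact hx'u (mem_inter.1 h3).1
    have hsub := card_le_card (union_subset (orb_mono (stab_le : stab Γ RE ≤ Γ) (v := u))
      (inter_subset_right (s₁ := nb H x') (s₂ := orb Γ u)))
    rw [card_union_of_disjoint hdisj] at hsub
    omega
  have hQne : ∀ v ∉ orb Γ x, (∃ u, (touching H (orb Γ x)).Adj v u) →
      (nb H v ∩ orb Γ x).Nonempty := by
    rintro v hv ⟨u, hu⟩
    exact ⟨u, mem_inter.2 ⟨mem_nb.2 hu.1, hu.2.resolve_left hv⟩⟩
  refine hG.breakable_of_step IH touching_le hR ?_ hpres ?_ ?_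
  · obtain ⟨u, hu⟩ := card_nb_pos_iff.1 (show 0 < (nb H x).card by omega)
    exact ⟨x, u, hu, Or.inl self_mem_orb⟩
  · intro v hv hv2
    by_cases hvO : v ∈ orb Γ x
    · rw [card_orb_eq_one fun γ hγ => hfix γ hγ v hvO] at hv2
      omega
    · rw [nb_touching_of_notMem hvO]
      have hne := hQne v hvO hv
      rcases (hG.card_nb_le v).lt_or_eq with h | h
      · have := hold v hvO h hne
        omega
      · have := hfresh hfix v hvO h hne hv2
        omega
  · intro v hv
    by_cases hvO : v ∈ orb Γ x
    · right
      have h1 : (nb RE v).card < (nb H v).card := by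
        rw [hRcard v hvO]
        exact (flt v hvO).trans_le (hfd v hvO)
      obtain ⟨w, hw, hw'⟩ := exists_mem_notMem_of_card_lt_card h1
      exact ⟨w, ⟨mem_nb.1 hw, Or.inl hvO⟩, fun h => hw' (mem_nb.2 h)⟩
    · left
      rw [nb_touching_of_notMem hvO]
      have hne := hQne v hvO hv
      rcases (hG.card_nb_le v).lt_or_eq with h | h
      · exact (hold v hvO h hne).1
      · have := hqm v
        omega

/-- The case of an orbit inducing a clique. -/
lemma Good.breakable_of_clique (hG : Good k G H Γ)
    (IH : ∀ H' < H, ∀ Γ', Good k G H' Γ' → Breakable H' Γ') {x : V} (hk : (nb H x).card < k)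
    (h2 : 2 ≤ (orb Γ x).card)
    (hmin : ∀ u, (nb H u).card < k → 2 ≤ (orb Γ u).card → (orb Γ x).card ≤ (orb Γ u).card)
    (hnc : ∀ a b, orb Γ a ≠ orb Γ b → (orb Γ a).card ≤ (orb Γ b).card → 2 ≤ (orb Γ b).card →
      ∃ a' ∈ orb Γ a, ∃ b' ∈ orb Γ b, ¬ H.Adj a' b')
    (hcl : ∀ v ∈ orb Γ x, (nb H v ∩ orb Γ x).card = (orb Γ x).card - 1) : Breakable H Γ := by
  have hfdeq : ∀ v ∈ orb Γ x, (nb H v).card = (nb H x).card := fun v hv =>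
    card_nb_eq_of_mem_orb hG.pres hv
  have hm : (orb Γ x).card ≤ (nb H x).card := hG.orb_le x hk h2
  obtain ⟨O, hO⟩ : ∃ O, O = orb Γ x := ⟨_, rfl⟩
  obtain ⟨f, finj, flt, fsurj⟩ := exists_enum O
  have hO2 : 2 ≤ O.card := hO ▸ h2
  rw [← hO] at hcl hfdeq hm
  have hclO : ∀ v ∈ O, nb H v ∩ O = O.erase v := by
    intro v hv
    refine eq_of_subset_of_card_le (fun w hw => ?_) ?_
    · rw [mem_inter, mem_nb] at hw
      exact mem_erase.2 ⟨hw.1.ne', hw.2⟩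
    · rw [hcl v hv, card_erase_of_mem hv]
  have hout : ∀ v ∈ O, (nb H v \ O).card = (nb H x).card - (O.card - 1) := by
    intro v hv
    have h := card_sdiff_add_card_inter (nb H v) O
    rw [hcl v hv, hfdeq v hv] at h
    omega
  have hT : ∀ v, ∃ T ⊆ nb H v \ O, v ∈ O → T.card = if O.card ≤ 2 * f v then 1 else 0 := by
    intro v
    by_cases hv : v ∈ O
    · have hle : (if O.card ≤ 2 * f v then 1 else 0) ≤ (nb H v \ O).card := by
        rw [hout v hv]
        split_ifs <;> omega
      obtain ⟨T, hT, hT'⟩ := exists_subset_card_eq hle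
      exact ⟨T, hT, fun _ => hT'⟩
    · exact ⟨∅, empty_subset _, fun h => absurd h hv⟩
  choose T hTsub hTcard using hT
  have hTmem : ∀ v w, w ∈ T v → H.Adj v w ∧ w ∉ O := fun v w hw => by
    simpa using hTsub v hw
  let ρ : V → V → Prop := fun a b =>
    a ∈ O ∧ ((b ∈ O ∧ H.Adj a b ∧ O.card ≤ f a + f b) ∨ b ∈ T a)
  have hρH : ∀ a b, ρ a b → H.Adj a b := by
    rintro a b ⟨-, h | h⟩
    · exact h.2.1
    · exact (hTmem a b h).1
  let RE : SimpleGraph V := SimpleGraph.fromRel ρ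
  have hRE : ∀ a b, RE.Adj a b ↔ ρ a b ∨ ρ b a := by
    intro a b
    simp only [RE, fromRel_adj]
    refine ⟨fun h => h.2, fun h => ⟨?_, h⟩⟩
    rcases h with h | h
    · exact (hρH a b h).ne
    · exact (hρH b a h).ne'
  have hRcard : ∀ a ∈ O, (nb RE a).card = f a := by
    intro a ha
    have h1 : nb RE a = (O.filter fun b => f b ≠ f a ∧ O.card ≤ f a + f b) ∪ T a := by
      ext b
      have h3 : H.Adj b a ↔ H.Adj a b := H.adj_comm b a
      have h5 : f b + f a = f a + f b := add_comm _ _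
      have h6 : a ∉ T b := fun h => (hTmem b a h).2 ha
      have h7 : b ∈ O → (H.Adj a b ↔ f b ≠ f a) := by
        intro hb
        have h8 : b ∈ nb H a ∩ O ↔ b ∈ O.erase a := by rw [hclO a ha]
        rw [mem_inter, mem_nb, mem_erase] at h8
        have : f b ≠ f a ↔ b ≠ a := (finj.eq_iff hb ha).not
        tauto
      simp only [mem_nb, hRE, ρ, mem_union, mem_filter, h3, h5]
      tauto
    have hd : Disjoint (O.filter fun b => f b ≠ f a ∧ O.card ≤ f a + f b) (T a) := by
      rw [Finset.disjoint_left]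
      intro w hw hw'
      exact (hTmem a w hw').2 (mem_filter.1 hw).1
    rw [h1, card_union_of_disjoint hd, hTcard a ha,
      card_filter_enum finj flt fsurj (fun j => j ≠ f a ∧ O.card ≤ f a + j),
      card_filter_add_le (flt a ha)]
    split_ifs <;> omega
  have hsub : RE ≤ touching H O := by
    intro a b hab
    rcases (hRE a b).1 hab with h | h
    · exact ⟨hρH a b h, Or.inl h.1⟩
    · exact ⟨(hρH b a h).symm, Or.inr h.1⟩
  subst hO
  refine hG.breakable_of_touching IH hk h2 hmin hnc hsub finj flt hRcard ?_
  intro hfix u hu huk hne _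
  obtain ⟨a, ha⟩ := hne
  rw [mem_inter, mem_nb] at ha
  have h1 : orb (stab Γ RE) u ⊆ nb H a \ orb Γ x := by
    intro w hw
    obtain ⟨γ, hγ, rfl⟩ := mem_orb.1 hw
    have h3 := (hG.pres γ hγ.1 u a).2 ha.1
    rw [hfix γ hγ a ha.2] at h3
    refine mem_sdiff.2 ⟨mem_nb.2 h3.symm, fun h => hu ?_⟩
    exact (apply_mem_orb_iff hγ.1).1 h
  have h3 := card_le_card h1
  rw [hout a ha.2] at h3
  have h4 : (nb H u ∩ orb Γ x).card ≤ (orb Γ x).card := card_le_card inter_subset_right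
  omega

end Touching

section Splitting

variable {ι β : Type*}

lemma card_image_le_of_refines {s : Finset β} {c c' : β → Finset ι} {x : ι}
    (h : ∀ u ∈ s, c u = (c' u).erase x) : (s.image c).card ≤ (s.image c').card := by
  have : s.image c = (s.image c').image fun t => t.erase x := by
    rw [image_image]
    exact image_congr h
  rw [this]
  exact card_image_le

lemma card_image_lt_of_refines {s : Finset β} {c c' : β → Finset ι} {x : ι}
    (h : ∀ u ∈ s, c u = (c' u).erase x) {u v : β} (hu : u ∈ s) (hv : v ∈ s)
    (huv : c u = c v) (huv' : c' u ≠ c' v) : (s.image c).card < (s.image c').card := by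
  have hs : s.image c = (s.image c').image fun t => t.erase x := by
    rw [image_image]
    exact image_congr h
  rw [hs]
  refine lt_of_le_of_ne card_image_le fun heq => huv' ?_
  refine card_image_iff.1 heq (mem_image_of_mem _ hu) (mem_image_of_mem _ hv) ?_
  rw [← h u hu, ← h v hv, huv]

/-- Each of the pieces into which `c` splits `s` avoids the representatives of the others. -/
lemma card_filter_add_card_image_le {γ : Type*} [DecidableEq γ] (s : Finset β)
    (c : β → γ) (u : β) :
    (s.filter fun v => c v = c u).card + (s.image c).card ≤ s.card + 1 := by
  have h1 : (s.image c) ⊆ insert (c u) ((s.filter fun v => ¬ c v = c u).image c) := by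
    intro y hy
    obtain ⟨v, hv, rfl⟩ := mem_image.1 hy
    by_cases h : c v = c u
    · simp [h]
    · exact mem_insert_of_mem (mem_image_of_mem _ (mem_filter.2 ⟨hv, h⟩))
  have h2 := (card_le_card h1).trans (card_insert_le _ _)
  have h3 := card_image_le (s := s.filter fun v => ¬ c v = c u) (f := c)
  have h4 := card_filter_add_card_filter_not (s := s) fun v => c v = c u
  omega

/-- Given disjoint classes `{u ∈ W | c u = q}`, each contained in or disjoint from every `N x`,
there are sets `S x ⊆ N x` of prescribed sizes such that each `x` whose prescribed size is not too
close to the extremes splits every class inside `N x` further. -/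
lemma exists_splitting [Nonempty β] (O : Finset ι) (N : ι → Finset β) (W : Finset β)
    (c : β → Finset ι) (f : ι → ℕ) {b : ℕ} (hc : ∀ u ∈ W, ∀ x ∈ O, x ∈ c u → u ∈ N x)
    (hN : ∀ x ∈ O, (N x).card = b) (hf : ∀ x ∈ O, f x ≤ b) (D : ι → ℕ)
    (hD : ∀ x ∈ O, ((W.image c).filter fun q =>
      x ∈ q ∧ 2 ≤ (W.filter fun u => c u = q).card).card ≤ D x) (P : Finset ι) (hP : P ⊆ O) :
    ∃ S : ι → Finset β, (∀ x ∈ P, S x ⊆ N x ∧ (S x).card = f x) ∧ ∀ q,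
      min (W.filter fun u => c u = q).card
        (1 + (P.filter fun x => x ∈ q ∧ D x ≤ f x ∧ f x + D x ≤ b).card) ≤
      ((W.filter fun u => c u = q).image fun u => P.filter fun x => u ∈ S x).card := by
  induction P using Finset.induction_on with
  | empty =>
    refine ⟨fun _ => ∅, by simp, fun q => ?_⟩
    rcases (W.filter fun u => c u = q).eq_empty_or_nonempty with h | h
    · simp [h]
    · have := card_pos.2 (h.image fun _ => (∅ : Finset ι))
      simp only [filter_empty, card_empty]
      omega
  | insert x P hxP ih =>
    obtain ⟨S, hS, hpieces⟩ := ih ((subset_insert x P).trans hP)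
    have hxO : x ∈ O := hP (mem_insert_self x P)
    obtain ⟨code, hcode⟩ : ∃ code : β → Finset ι, code = fun u => P.filter fun y => u ∈ S y :=
      ⟨_, rfl⟩
    have hSx : ∃ T ⊆ N x, T.card = f x ∧ (D x ≤ f x → f x + D x ≤ b → ∀ q, x ∈ q →
        2 ≤ (W.filter fun u => c u = q).card →
        Set.InjOn code (W.filter fun u => c u = q) ∨ ∃ u ∈ W.filter fun u => c u = q,
          ∃ v ∈ W.filter fun u => c u = q, code u = code v ∧ u ∈ T ∧ v ∉ T) := by
      by_cases hgood : D x ≤ f x ∧ f x + D x ≤ b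
      swap
      · obtain ⟨T, hT, hT'⟩ := exists_subset_card_eq ((hf x hxO).trans (hN x hxO).ge)
        exact ⟨T, hT, hT', fun h h' => absurd ⟨h, h'⟩ hgood⟩
      have hpair : ∀ q, 2 ≤ (W.filter fun u => c u = q).card → ∃ p : β × β,
          (p.1 ∈ W ∧ c p.1 = q) ∧ (p.2 ∈ W ∧ c p.2 = q) ∧ p.1 ≠ p.2 ∧
          (Set.InjOn code (W.filter fun u => c u = q) ∨ code p.1 = code p.2) := by
        intro q hq
        by_cases hinj : Set.InjOn code (W.filter fun u => c u = q)
        · obtain ⟨u, hu, v, hv, huv⟩ := one_lt_card.1 hq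
          exact ⟨(u, v), mem_filter.1 hu, mem_filter.1 hv, huv, Or.inl hinj⟩
        · simp only [Set.InjOn] at hinj
          push Not at hinj
          obtain ⟨u, hu, v, hv, huv, hne⟩ := hinj
          exact ⟨(u, v), mem_filter.1 hu, mem_filter.1 hv, hne, Or.inr huv⟩
      choose! p hp1 hp2 hpne hpc using hpair
      obtain ⟨Q, hQ⟩ : ∃ Q, Q = (W.image c).filter fun q =>
        x ∈ q ∧ 2 ≤ (W.filter fun u => c u = q).card := ⟨_, rfl⟩
      have hQmem : ∀ q ∈ Q, x ∈ q ∧ 2 ≤ (W.filter fun u => c u = q).card := fun q hq => by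
        rw [hQ] at hq
        exact (mem_filter.1 hq).2
      have hQc : Q.card ≤ D x := hQ ▸ hD x hxO
      have hins : (Q.image fun q => (p q).1) ⊆ N x \ Q.image fun q => (p q).2 := by
        intro u hu
        obtain ⟨q, hq, rfl⟩ := mem_image.1 hu
        obtain ⟨h1, h2⟩ := hQmem q hq
        refine mem_sdiff.2 ⟨hc _ (hp1 q h2).1 x hxO ?_, fun h => ?_⟩
        · rw [(hp1 q h2).2]
          exact h1
        · obtain ⟨q', hq', heq⟩ := mem_image.1 h
          obtain ⟨h3, h4⟩ := hQmem q' hq'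
          have h5 := (hp2 q' h4).2
          rw [heq, (hp1 q h2).2] at h5
          subst h5
          exact hpne q h2 heq.symm
      have hi : (Q.image fun q => (p q).1).card ≤ D x := card_image_le.trans hQc
      have ho : (Q.image fun q => (p q).2).card ≤ D x := card_image_le.trans hQc
      have hsd := le_card_sdiff (Q.image fun q => (p q).2) (N x)
      rw [hN x hxO] at hsd
      obtain ⟨T, hT1, hT2, hT3⟩ := exists_subsuperset_card_eq (n := f x) hins (by omega) (by omega)
      refine ⟨T, hT2.trans sdiff_subset, hT3, fun _ _ q hxq hq => ?_⟩
      have hqQ : q ∈ Q := by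
        rw [hQ, mem_filter]
        exact ⟨mem_image.2 ⟨_, (hp1 q hq).1, (hp1 q hq).2⟩, hxq, hq⟩
      refine (hpc q hq).imp_right fun h => ⟨(p q).1, mem_filter.2 (hp1 q hq), (p q).2,
        mem_filter.2 (hp2 q hq), h, hT1 (mem_image_of_mem (fun q => (p q).1) hqQ), fun h' => ?_⟩
      exact (mem_sdiff.1 (hT2 h')).2 (mem_image_of_mem (fun q => (p q).2) hqQ)
    obtain ⟨T, hTN, hTc, hT⟩ := hSx
    have hupd : ∀ y ∈ P, Function.update S x T y = S y := fun y hy =>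
      Function.update_of_ne (fun h => hxP (by rwa [← h])) _ _
    have hcode' : ∀ u, code u =
        ((insert x P).filter fun y => u ∈ Function.update S x T y).erase x := by
      intro u
      ext y
      simp only [hcode, mem_filter, mem_erase, mem_insert]
      constructor
      · rintro ⟨hy, h⟩
        exact ⟨fun h => hxP (by rwa [← h]), Or.inr hy, by rwa [hupd y hy]⟩
      · rintro ⟨hyx, hy | hy, h⟩
        · exact absurd hy hyx
        · exact ⟨hy, by rwa [hupd y hy] at h⟩
    refine ⟨Function.update S x T, ?_, fun q => ?_⟩
    · intro y hy
      rcases mem_insert.1 hy with rfl | hy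
      · simp [hTN, hTc]
      · rw [hupd y hy]
        exact hS y hy
    · have h1 := hpieces q
      have h2 := card_image_le_of_refines (s := W.filter fun u => c u = q) fun u _ => hcode' u
      simp only [hcode] at h2
      by_cases hg : x ∈ q ∧ D x ≤ f x ∧ f x + D x ≤ b
      swap
      · rw [filter_insert, if_neg hg]
        omega
      rw [filter_insert, if_pos hg, card_insert_of_notMem fun h => hxP (mem_filter.1 h).1]
      rcases Nat.lt_or_ge (W.filter fun u => c u = q).card 2 with hlt | hge
      · omega
      rcases hT hg.2.1 hg.2.2 q hg.1 hge with hinj | ⟨u, hu, v, hv, huv, huT, hvT⟩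
      · rw [← card_image_iff, hcode] at hinj
        omega
      · have h3 := card_image_lt_of_refines (s := W.filter fun u => c u = q)
          (fun u _ => hcode' u) hu hv huv (fun h => hvT (by
            have h4 : x ∈ (insert x P).filter fun y => u ∈ Function.update S x T y := by
              simp [huT]
            rw [h] at h4
            simpa using h4))
        simp only [hcode] at h3
        omega

end Splitting

section Independent

variable {G H : SimpleGraph V} {Γ : Subgroup (Equiv.Perm V)} {k : ℕ}

/-- Counting disjoint classes of size at least two inside a set of size `b`. -/
lemma card_add_two_mul_le {β κ : Type*} [DecidableEq κ] {W N : Finset β} {c : β → κ}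
    {Q : Finset κ} {q : κ}
    (hq : q ∈ Q) (hQ : ∀ q ∈ Q, (W.filter fun u => c u = q) ⊆ N ∧
      2 ≤ (W.filter fun u => c u = q).card) :
    (W.filter fun u => c u = q).card + 2 * (Q.card - 1) ≤ N.card := by
  have h1 : (Q.biUnion fun q => W.filter fun u => c u = q) ⊆ N := by
    intro u hu
    obtain ⟨q, hq, hu⟩ := mem_biUnion.1 hu
    exact (hQ q hq).1 hu
  have h2 := card_le_card h1
  rw [card_biUnion, ← add_sum_erase Q _ hq] at h2
  · have h3 := card_nsmul_le_sum (Q.erase q) (fun q => (W.filter fun u => c u = q).card) 2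
      fun q' hq' => (hQ q' (mem_of_mem_erase hq')).2
    rw [card_erase_of_mem hq, smul_eq_mul] at h3
    omega
  · intro q₁ _ q₂ _ hne
    rw [Function.onFun, Finset.disjoint_left]
    intro u hu huq
    exact hne ((mem_filter.1 hu).2.symm.trans (mem_filter.1 huq).2)

/-- The case of an orbit inducing an independent set. -/
lemma Good.breakable_of_independent (hG : Good k G H Γ)
    (IH : ∀ H' < H, ∀ Γ', Good k G H' Γ' → Breakable H' Γ') {x : V} (hk : (nb H x).card < k)
    (h2 : 2 ≤ (orb Γ x).card)
    (hmin : ∀ u, (nb H u).card < k → 2 ≤ (orb Γ u).card → (orb Γ x).card ≤ (orb Γ u).card)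
    (hnc : ∀ a b, orb Γ a ≠ orb Γ b → (orb Γ a).card ≤ (orb Γ b).card → 2 ≤ (orb Γ b).card →
      ∃ a' ∈ orb Γ a, ∃ b' ∈ orb Γ b, ¬ H.Adj a' b')
    (hind : ∀ v ∈ orb Γ x, ∀ w ∈ orb Γ x, ¬ H.Adj v w) : Breakable H Γ := by
  have hfdeq : ∀ v ∈ orb Γ x, (nb H v).card = (nb H x).card := fun v hv =>
    card_nb_eq_of_mem_orb hG.pres hv
  have hm : (orb Γ x).card ≤ (nb H x).card := hG.orb_le x hk h2
  obtain ⟨O, hO⟩ : ∃ O, O = orb Γ x := ⟨_, rfl⟩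
  obtain ⟨f, finj, flt, -⟩ := exists_enum O
  rw [← hO] at hind hfdeq hm
  obtain ⟨W, hW⟩ : ∃ W : Finset V, W = univ.filter fun u => u ∉ O ∧ (nb H u).card = k := ⟨_, rfl⟩
  obtain ⟨c, hc⟩ : ∃ c : V → Finset V, c = fun u => nb H u ∩ O := ⟨_, rfl⟩
  have hcN : ∀ u, ∀ a, a ∈ c u → u ∈ nb H a := by
    intro u a ha
    rw [hc, mem_inter, mem_nb] at ha
    exact mem_nb.2 ha.1.symm
  let D : V → ℕ := fun a => ((W.image c).filter fun q =>
      a ∈ q ∧ 2 ≤ (W.filter fun u => c u = q).card).card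
  have : Nonempty V := ⟨x⟩
  obtain ⟨S, hS, hpieces⟩ := exists_splitting O (nb H) W c f (fun u _ a _ => hcN u a) hfdeq
    (fun a ha => (flt a ha).le.trans hm) D (fun a _ => le_rfl) O subset_rfl
  let RE : SimpleGraph V := SimpleGraph.fromRel fun a b => a ∈ O ∧ b ∈ S a
  have hRE : ∀ a ∈ O, ∀ b, RE.Adj a b ↔ b ∈ S a := by
    intro a ha b
    simp only [RE, fromRel_adj]
    constructor
    · rintro ⟨-, h | h⟩
      · exact h.2
      · exact absurd (mem_nb.1 ((hS b h.1).1 h.2)) (hind b h.1 a ha)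
    · intro h
      exact ⟨(mem_nb.1 ((hS a ha).1 h)).ne, Or.inl ⟨ha, h⟩⟩
  have hsub : RE ≤ touching H O := by
    intro a b hab
    simp only [RE, fromRel_adj] at hab
    rcases hab.2 with h | h
    · exact ⟨mem_nb.1 ((hS a h.1).1 h.2), Or.inl h.1⟩
    · exact ⟨(mem_nb.1 ((hS b h.1).1 h.2)).symm, Or.inr h.1⟩
  have hRcard : ∀ a ∈ O, (nb RE a).card = f a := by
    intro a ha
    rw [← (hS a ha).2]
    congr 1
    ext b
    rw [mem_nb, hRE a ha]
  have hOinv : ∀ γ ∈ Γ, ∀ v, γ v ∈ O ↔ v ∈ O := by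
    subst hO
    exact fun γ hγ v => apply_mem_orb_iff hγ
  have hfresh : (∀ γ ∈ stab Γ RE, ∀ a ∈ O, γ a = a) → ∀ u ∉ O, (nb H u).card = k →
      (nb H u ∩ O).Nonempty → 2 ≤ (orb (stab Γ RE) u).card →
      (orb (stab Γ RE) u).card + (nb H u ∩ O).card ≤ k := by
    intro hfix u hu huk _ horb2
    obtain ⟨q, hq⟩ : ∃ q, q = c u := ⟨_, rfl⟩
    have hqO : nb H u ∩ O = q := by rw [hq, hc]
    have horb : orb (stab Γ RE) u ⊆ (W.filter fun v => c v = q).filter fun v =>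
        (O.filter fun a => v ∈ S a) = O.filter fun a => u ∈ S a := by
      intro w hw
      obtain ⟨γ, hγ, rfl⟩ := mem_orb.1 hw
      have hP := hG.pres γ hγ.1
      have h1 : γ u ∈ W := by
        rw [hW, mem_filter, hOinv γ hγ.1, hP.card_nb]
        exact ⟨mem_univ _, hu, huk⟩
      have h3 : c (γ u) = q := by
        rw [← hqO, hc]
        exact hP.nb_inter_eq (hfix γ hγ) u
      refine mem_filter.2 ⟨mem_filter.2 ⟨h1, h3⟩, filter_congr fun a ha => ?_⟩
      rw [← hRE a ha, ← hRE a ha]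
      have := hγ.2 a u
      rwa [hfix γ hγ a ha] at this
    have hle := card_le_card horb
    have hpc := card_filter_add_card_image_le (W.filter fun v => c v = q)
      (fun v => O.filter fun a => v ∈ S a) u
    have hmn := hpieces q
    obtain ⟨a, ha⟩ : ∃ a, a = (W.filter fun v => c v = q).card := ⟨_, rfl⟩
    obtain ⟨g, hg⟩ : ∃ g, g = (O.filter fun y =>
      y ∈ q ∧ D y ≤ f y ∧ f y + D y ≤ (nb H x).card).card := ⟨_, rfl⟩
    rw [← ha] at hpc
    rw [← ha, ← hg] at hmn
    have ha2 : 2 ≤ a := by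
      rw [ha]
      exact horb2.trans (card_le_card (horb.trans (filter_subset _ _)))
    have hcl : ∀ y ∈ q, a + 2 * (D y - 1) ≤ (nb H x).card := by
      intro y hy
      have hyO : y ∈ O := (mem_inter.1 (hqO ▸ hy)).2
      rw [← hfdeq y hyO, ha]
      refine card_add_two_mul_le ?_ ?_
      · refine mem_filter.2 ⟨?_, hy, ha ▸ ha2⟩
        rw [hq]
        exact mem_image_of_mem c (by simp [hW, hu, huk])
      · intro q' hq'
        obtain ⟨-, h3, h4⟩ := mem_filter.1 hq'
        refine ⟨fun v hv => hcN v y ?_, h4⟩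
        rw [(mem_filter.1 hv).2]
        exact h3
    have hsplit : q.card ≤ g +
        (q.filter fun y => ¬ (D y ≤ f y ∧ f y + D y ≤ (nb H x).card)).card := by
      rw [← card_filter_add_card_filter_not (s := q)
        (fun y => D y ≤ f y ∧ f y + D y ≤ (nb H x).card), hg]
      refine Nat.add_le_add_right (card_le_card fun y hy => ?_) _
      have hy' := mem_filter.1 hy
      exact mem_filter.2 ⟨(mem_inter.1 (hqO ▸ hy'.1)).2, hy'⟩
    obtain ⟨d, hd⟩ : ∃ d, d = ((nb H x).card - a) / 2 + 1 := ⟨_, rfl⟩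
    have hbad : (q.filter fun y => ¬ (D y ≤ f y ∧ f y + D y ≤ (nb H x).card)).card ≤ k - a := by
      by_cases hne : (q.filter fun y => ¬ (D y ≤ f y ∧ f y + D y ≤ (nb H x).card)).Nonempty
      swap
      · rw [not_nonempty_iff_eq_empty.1 hne, card_empty]
        exact Nat.zero_le _
      obtain ⟨y₀, hy₀⟩ := hne
      have hab := hcl y₀ (mem_filter.1 hy₀).1
      have hinj : Set.InjOn f (q.filter fun y => ¬ (D y ≤ f y ∧ f y + D y ≤ (nb H x).card)) :=
        finj.mono fun y hy => (mem_inter.1 (hqO ▸ (mem_filter.1 hy).1)).2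
      rw [← card_image_of_injOn hinj]
      have hss : (q.filter fun y => ¬ (D y ≤ f y ∧ f y + D y ≤ (nb H x).card)).image f ⊆
          range d ∪ Ico ((nb H x).card + 1 - d) (nb H x).card := by
        intro i hi
        obtain ⟨y, hy, rfl⟩ := mem_image.1 hi
        have hy' := mem_filter.1 hy
        have hyO : y ∈ O := (mem_inter.1 (hqO ▸ hy'.1)).2
        have h1 := hcl y hy'.1
        have h3 := flt y hyO
        have h4 := hy'.2
        simp only [mem_union, mem_range, mem_Ico]
        omega
      have h5 := (card_le_card hss).trans (card_union_le _ _)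
      rw [card_range, Nat.card_Ico] at h5
      omega
    rw [hqO]
    have hak : a ≤ k := by
      rcases q.eq_empty_or_nonempty with h | ⟨y, hy⟩
      · have : (nb H u ∩ O).Nonempty := by assumption
        rw [hqO, h] at this
        exact absurd this not_nonempty_empty
      · have := hcl y hy
        omega
    omega
  subst hO
  exact hG.breakable_of_touching IH hk h2 hmin hnc hsub finj flt hRcard hfresh

/-- Every good configuration can be coloured so as to break all symmetries. -/
theorem Good.breakable (hG : Good k G H Γ) : Breakable H Γ := by
  induction H using WellFoundedLT.induction generalizing Γ with
  | ind H ih =>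
  have IH : ∀ H' < H, ∀ Γ', Good k G H' Γ' → Breakable H' Γ' := fun H' h Γ' hG' => ih H' h hG'
  by_cases htriv : ∀ γ ∈ Γ, γ = 1
  · exact ⟨⊥, bot_le, fun γ hγ _ => htriv γ hγ, fun v ⟨u, hu⟩ => ⟨u, hu, fun h => h⟩⟩
  by_cases hnc : ∀ a b, orb Γ a ≠ orb Γ b → (orb Γ a).card ≤ (orb Γ b).card →
      2 ≤ (orb Γ b).card → ∃ a' ∈ orb Γ a, ∃ b' ∈ orb Γ b, ¬ H.Adj a' b'
  swap
  · push Not at hnc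
    obtain ⟨a, b, hab, hle, h2, hadj⟩ := hnc
    exact hG.breakable_of_complete IH hab hle h2 hadj
  have hmoved : ∃ u, ∃ γ ∈ Γ, γ u ≠ u := by
    by_contra hcon
    push Not at hcon
    exact htriv fun γ hγ => Equiv.ext fun u => hcon u γ hγ
  obtain ⟨v₀, hv₀⟩ := hG.fix
  obtain ⟨u₀, hu₀⟩ := hmoved
  obtain ⟨w, u, hwu, hw, hu⟩ : ∃ w u, G.Adj w u ∧ (∀ γ ∈ Γ, γ w = w) ∧ ∃ γ ∈ Γ, γ u ≠ u := by
    obtain ⟨p⟩ := hG.conn v₀ u₀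
    have hu₀' : u₀ ∉ {v | ∀ γ ∈ Γ, γ v = v} := fun h => by
      obtain ⟨γ, hγ, hne⟩ := hu₀
      exact hne (h γ hγ)
    obtain ⟨d, -, hd1, hd2⟩ := p.exists_boundary_dart {v | ∀ γ ∈ Γ, γ v = v} hv₀ hu₀'
    simp only [Set.mem_ofPred_eq] at hd2
    push Not at hd2
    exact ⟨d.fst, d.snd, d.adj, hd1, hd2⟩
  have hu2 : 2 ≤ (orb Γ u).card := by
    obtain ⟨γ, hγ, hne⟩ := hu
    exact two_le_card_orb hγ hne
  have huk : (nb H u).card < k := by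
    have hnadj : ¬ H.Adj w u := by
      intro hadj
      have hne : orb Γ w ≠ orb Γ u := fun h => by
        rw [← h, card_orb_eq_one hw] at hu2
        omega
      obtain ⟨a, ha, b, hb, hab⟩ := hnc w u hne (by rw [card_orb_eq_one hw]; omega) hu2
      rw [orb_eq_singleton hw, mem_singleton] at ha
      subst ha
      obtain ⟨γ, hγ, rfl⟩ := mem_orb.1 hb
      have := (hG.pres γ hγ a u).2 hadj
      rw [hw γ hγ] at this
      exact hab this
    rw [← hG.deg u]
    refine card_lt_card ⟨nb_mono hG.le u, fun h => hnadj ?_⟩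
    exact (mem_nb.1 (h (mem_nb.2 hwu.symm))).symm
  obtain ⟨x, hx, hmin⟩ := exists_min_image
    (univ.filter fun v => (nb H v).card < k ∧ 2 ≤ (orb Γ v).card) (fun v => (orb Γ v).card)
    ⟨u, by simp [huk, hu2]⟩
  obtain ⟨-, hxk, hx2⟩ := mem_filter.1 hx
  have hmin' : ∀ u, (nb H u).card < k → 2 ≤ (orb Γ u).card →
      (orb Γ x).card ≤ (orb Γ u).card := fun u h1 h2 => hmin u (by simp [h1, h2])
  obtain ⟨s, hs⟩ : ∃ s, s = (nb H x ∩ orb Γ x).card := ⟨_, rfl⟩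
  have hdeg : ∀ v ∈ orb Γ x, (nb H v ∩ orb Γ x).card = s := by
    intro v hv
    obtain ⟨γ, hγ, rfl⟩ := mem_orb.1 hv
    have := (hG.pres γ hγ).card_filter_nb (· ∈ orb Γ x) (fun w => apply_mem_orb_iff hγ) x
    rw [filter_mem_eq_inter, filter_mem_eq_inter] at this
    rw [this, hs]
  have hsm : s < (orb Γ x).card := by
    rw [hs]
    refine card_lt_card ⟨inter_subset_right, fun h => ?_⟩
    exact (mem_nb.1 (mem_inter.1 (h self_mem_orb)).1).ne rfl
  rcases Nat.eq_zero_or_pos s with h0 | hpos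
  · refine hG.breakable_of_independent IH hxk hx2 hmin' hnc fun v hv w hw hvw => ?_
    have h1 := hdeg v hv
    rw [h0, card_eq_zero] at h1
    exact notMem_empty w (h1 ▸ mem_inter.2 ⟨mem_nb.2 hvw, hw⟩)
  · by_cases hcl : s + 1 = (orb Γ x).card
    · refine hG.breakable_of_clique IH hxk hx2 hmin' hnc fun v hv => ?_
      rw [hdeg v hv]
      omega
    · exact hG.breakable_of_inside IH hdeg hpos (by omega) hxk

end Independent

section Root

variable {G : SimpleGraph V} {k : ℕ} {S : Finset V}

/-- The automorphisms of `G` fixing `S` pointwise. -/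
def autFix (G : SimpleGraph V) (S : Finset V) : Subgroup (Equiv.Perm V) where
  carrier := {γ | Pres γ G ∧ ∀ v ∈ S, γ v = v}
  mul_mem' := fun {a b} ha hb => ⟨fun u v => (ha.1 _ _).trans (hb.1 u v), fun v hv => by
    rw [Equiv.Perm.mul_apply, hb.2 v hv, ha.2 v hv]⟩
  one_mem' := ⟨fun _ _ => Iff.rfl, fun _ _ => rfl⟩
  inv_mem' := fun {a} ha => ⟨fun u v => by
    simpa using (ha.1 (a⁻¹ u) (a⁻¹ v)).symm, fun v hv => by
    rw [Equiv.Perm.inv_eq_iff_eq, ha.2 v hv]⟩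

lemma apply_mem_iff_of_mem_autFix {γ : Equiv.Perm V} (hγ : γ ∈ autFix G S) (v : V) :
    γ v ∈ S ↔ v ∈ S := by
  constructor
  · intro h
    have := γ.injective (hγ.2 _ h)
    rwa [this] at h
  · intro h
    rwa [hγ.2 v h]

/-- There is a red subgraph of `G` preserved by no nontrivial automorphism of `G`. -/
def IsBreakable (G : SimpleGraph V) : Prop :=
  ∃ R ≤ G, ∀ γ : Equiv.Perm V, Pres γ G → Pres γ R → γ = 1

lemma base_autFix (hconn : G.Connected) (hdeg : ∀ v, (nb G v).card = k) (hS : S.Nonempty) :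
    Base k G (G \ touching G S) (autFix G S) where
  le := sdiff_le
  conn := hconn
  deg := hdeg
  presG := fun _ hγ => hγ.1
  pres := fun _ hγ => hγ.1.sdiff (hγ.1.touching (apply_mem_iff_of_mem_autFix hγ))
  fix := hS.imp fun v hv _ hγ => hγ.2 v hv

lemma card_nb_sdiff_touching {v : V} (hv : v ∉ S) :
    (nb (G \ touching G S) v).card = (nb G v).card - (nb G v ∩ S).card := by
  rw [card_nb_sdiff touching_le, nb_touching_of_notMem hv]

lemma Breakable.exists_extension (h : Breakable (G \ touching G S) (autFix G S)) :
    ∃ c ≤ G, (∀ v ∈ S, nb c v = nb G v) ∧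
      (∀ v ∉ S, (nb G v ∩ S).card < (nb G v).card → (nb c v).card < (nb G v).card) ∧
      ∀ γ ∈ autFix G S, Pres γ c → γ = 1 := by
  obtain ⟨R, hR, htriv, hblue⟩ := h
  have hRS : ∀ a b, R.Adj a b → ¬ (touching G S).Adj a b := fun a b hab => (hR hab).2
  refine ⟨R ⊔ touching G S, sup_le (hR.trans sdiff_le) touching_le, ?_, ?_, ?_⟩
  · intro v hv
    ext w
    simp only [mem_nb, sup_adj, touching_adj]
    exact ⟨fun h => h.elim (fun h => (hR h).1) And.left, fun h => Or.inr ⟨h, Or.inl hv⟩⟩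
  · intro v hv hlt
    rw [← Nat.sub_pos_iff_lt, ← card_nb_sdiff_touching hv, card_nb_pos_iff] at hlt
    obtain ⟨u, hu, hu'⟩ := hblue v hlt
    refine card_lt_card ⟨nb_mono (sup_le (hR.trans sdiff_le) touching_le) v, fun hss => ?_⟩
    have := mem_nb.1 (hss (mem_nb.2 hu.1))
    exact this.elim hu' hu.2
  · intro γ hγ hP
    refine htriv γ hγ ?_
    have h1 := hP.sdiff (hγ.1.touching (apply_mem_iff_of_mem_autFix hγ))
    have h2 : (R ⊔ touching G S) \ touching G S = R := by
      ext a b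
      simp only [sdiff_adj, sup_adj]
      have := hRS a b
      tauto
    rwa [h2] at h1

lemma IsBreakable.of_root (hdeg : ∀ v, (nb G v).card = k) (hk : 2 ≤ k) {r : V}
    (h : Breakable (G \ touching G {r}) (autFix G {r})) : IsBreakable G := by
  obtain ⟨c, hc, hr, hb, htriv⟩ := h.exists_extension
  refine ⟨c, hc, fun γ hγ hγc => htriv γ ⟨hγ, ?_⟩ hγc⟩
  intro v hv
  rw [mem_singleton] at hv
  subst hv
  by_contra hne
  have h1 := hb (γ v) (by simpa using hne) (by
    rw [hdeg]
    have := card_le_card (inter_subset_right (s₁ := nb G (γ v)) (s₂ := {v}))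
    rw [card_singleton] at this
    omega)
  rw [hγc.card_nb, hr v (mem_singleton_self v), hdeg, hdeg] at h1
  omega

end Root

section Complete

lemma isBreakable_of_complete {G : SimpleGraph V} (hG : ∀ a b, a ≠ b → G.Adj a b)
    (hcard : 6 ≤ Fintype.card V) : IsBreakable G := by
  obtain ⟨f, finj, flt, fsurj⟩ := exists_enum (univ : Finset V)
  have finj' : ∀ {a b}, f a = f b → a = b := fun h => finj (by simp) (by simp) h
  rw [card_univ] at fsurj
  have flt' : ∀ a, f a < Fintype.card V := fun a => flt a (mem_univ a)
  let R : SimpleGraph V := SimpleGraph.fromRel fun a b =>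
    (f a = 0 ∧ 2 ≤ f b) ∨ (1 ≤ f a ∧ f b = f a + 1)
  have hR : ∀ a b, R.Adj a b ↔ ((f a = 0 ∧ 2 ≤ f b) ∨ (1 ≤ f a ∧ f b = f a + 1)) ∨
      ((f b = 0 ∧ 2 ≤ f a) ∨ (1 ≤ f b ∧ f a = f b + 1)) := by
    intro a b
    simp only [R, fromRel_adj]
    refine ⟨fun h => h.2, fun h => ⟨?_, h⟩⟩
    rintro rfl
    omega
  refine ⟨R, fun a b h => hG a b h.ne, fun γ _ hγ => ?_⟩
  obtain ⟨r, -, hr⟩ := fsurj 0 (by omega)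
  have hrdeg : (nb R r).card = Fintype.card V - 2 := by
    have h1 : nb R r = univ.filter fun b => 2 ≤ f b := by
      ext b
      simp only [mem_nb, hR, mem_filter, mem_univ, true_and]
      omega
    rw [h1, card_filter_enum finj flt (by rwa [card_univ]) (fun j => 2 ≤ j), card_univ]
    have h2 : (range (Fintype.card V)).filter (fun j => 2 ≤ j) = Ico 2 (Fintype.card V) := by
      ext j
      simp only [mem_filter, mem_range, mem_Ico]
      omega
    rw [h2, Nat.card_Ico]
  have hother : ∀ v, f v ≠ 0 → (nb R v).card ≤ 3 := by
    intro v hv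
    rw [← card_image_of_injOn (finj.mono (by simp) : Set.InjOn f (nb R v))]
    refine (card_le_card (t := {0, f v - 1, f v + 1}) fun i hi => ?_).trans card_le_three
    obtain ⟨w, hw, rfl⟩ := mem_image.1 hi
    rw [mem_nb, hR] at hw
    simp only [mem_insert, mem_singleton]
    omega
  have hfixr : γ r = r := by
    refine finj' ?_
    rw [hr]
    by_contra h
    have h1 := hother _ h
    rw [hγ.card_nb, hrdeg] at h1
    omega
  have hfix : ∀ i v, f v ≤ i → γ v = v := by
    intro i
    induction i with
    | zero =>
      intro v hv
      have : v = r := finj' (by omega)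
      rw [this, hfixr]
    | succ i ih =>
      intro v hv
      rcases Nat.lt_or_ge (f v) (i + 1) with h | h
      · exact ih v (by omega)
      have hvi : f v = i + 1 := by omega
      have hne : f (γ v) ≠ 0 := fun h0 => by
        have h1 : γ v = γ r := by
          rw [hfixr]
          exact finj' (by omega)
        have := γ.injective h1
        rw [this] at hvi
        omega
      rcases Nat.eq_zero_or_pos i with rfl | hi
      · have h1 := (hγ r v).not
        rw [hfixr, hR, hR] at h1
        exact finj' (by omega)
      · obtain ⟨w, -, hw⟩ := fsurj i (by have := flt' v; omega)
        have h1 := (hγ w v).2 ((hR w v).2 (by omega))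
        rw [ih w hw.le, hR] at h1
        by_contra hcon
        have h2 : f (γ v) ≠ i + 1 := fun h => hcon (finj' (by omega))
        have h3 := ih (γ v) (by omega)
        exact hcon (γ.injective h3)
  exact Equiv.ext fun v => hfix (f v) v le_rfl

end Complete

section Neighbourhood

variable {G H : SimpleGraph V} {Γ : Subgroup (Equiv.Perm V)} {k s : ℕ} {O : Finset V}

lemma Base.breakable_of_sparse (hB : Base k G H Γ) (hinv : ∀ γ ∈ Γ, ∀ v, γ v ∈ O ↔ v ∈ O)
    (hOc : O.card = k) (hH : ∀ v ∈ O, (nb H v).card = k - 1)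
    (hout : ∀ v ∉ O, (nb H v).card < k → ∀ γ ∈ Γ, γ v = v)
    (hin : ∀ v ∈ O, (nb H v ∩ O).card = s) (hs : 1 ≤ s) (hsk : s + 3 ≤ k) : Breakable H Γ := by
  have hdeg : ∀ v ∈ O, (nb (inside H O) v).card = s := fun v hv => by rw [nb_inside hv, hin v hv]
  have hpres : ∀ γ ∈ Γ, Pres γ (inside H O) := fun γ hγ => (hB.pres γ hγ).inside (hinv γ hγ)
  obtain ⟨R, hR, -, -, -, -, horb⟩ := exists_inner_coloring O (inside H O)
    (fun a b h => h.2.2) hdeg hs (by omega)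
  refine Breakable.of_sdiff inside_le hR hpres ?_
    (hB.good_sdiff inside_le hpres ?_ ?_).breakable
  · rintro v ⟨u, hu⟩
    left
    rw [← card_nb_pos_iff, card_nb_sdiff inside_le, hdeg v hu.2.1, hH v hu.2.1]
    omega
  · rintro v ⟨u, hu⟩ -
    have h1 := horb (stab Γ R) (fun γ hγ => ⟨hinv γ hγ.1, hpres γ hγ.1, hγ.2⟩) v hu.2.1
    rw [hdeg v hu.2.1, hH v hu.2.1]
    omega
  · intro v hv hlt h2
    by_cases hvO : v ∈ O
    · obtain ⟨u, hu⟩ := card_nb_pos_iff.1 (hs.trans (hdeg v hvO).ge)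
      exact absurd hu (hv u)
    · rw [card_orb_eq_one (hout v hvO hlt)] at h2
      omega

/-- `R` together with the edges of `H` leaving `O` at vertices satisfying `p`. -/
def withOutward (R H : SimpleGraph V) (O : Finset V) (p : V → Prop) : SimpleGraph V where
  Adj a b := R.Adj a b ∨ H.Adj a b ∧ ((a ∈ O ∧ p a ∧ b ∉ O) ∨ (b ∈ O ∧ p b ∧ a ∉ O))
  symm := ⟨fun _ _ h => h.imp Adj.symm fun h => ⟨h.1.symm, h.2.symm⟩⟩
  loopless := ⟨fun _ h => h.elim (fun h => h.ne rfl) fun h => h.1.ne rfl⟩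

lemma withOutward_adj {R : SimpleGraph V} {p : V → Prop} {a b : V} : (withOutward R H O p).Adj a b ↔
    R.Adj a b ∨ H.Adj a b ∧ ((a ∈ O ∧ p a ∧ b ∉ O) ∨ (b ∈ O ∧ p b ∧ a ∉ O)) := Iff.rfl

lemma Base.breakable_of_dense (hB : Base k G H Γ) (hinv : ∀ γ ∈ Γ, ∀ v, γ v ∈ O ↔ v ∈ O)
    (hOc : O.card = k) (hH : ∀ v ∈ O, (nb H v).card = k - 1)
    (hout : ∀ v ∉ O, (nb H v).card < k → ∀ γ ∈ Γ, γ v = v)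
    (hiso : ∀ v ∉ O, (nb H v).card < k → ∀ u, ¬ H.Adj v u)
    (hin : ∀ v ∈ O, (nb H v ∩ O).card = s) (hs : 2 ≤ s) (hsk : s + 2 = k) : Breakable H Γ := by
  have hdeg : ∀ v ∈ O, (nb (inside H O) v).card = s := fun v hv => by rw [nb_inside hv, hin v hv]
  have hpres : ∀ γ ∈ Γ, Pres γ (inside H O) := fun γ hγ => (hB.pres γ hγ).inside (hinv γ hγ)
  have hpresT : ∀ γ ∈ Γ, Pres γ (touching H O) := fun γ hγ => (hB.pres γ hγ).touching (hinv γ hγ)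
  obtain ⟨R, hR, x, hx, hxR, hlt, horb⟩ := exists_inner_coloring O (inside H O)
    (fun a b h => h.2.2) hdeg (by omega) (by omega)
  have horb2 : ∀ v ∈ O, (orb (stab Γ R) v).card ≤ 2 := by
    intro v hv
    have := horb (stab Γ R) (fun γ hγ => ⟨hinv γ hγ.1, hpres γ hγ.1, hγ.2⟩) v hv
    omega
  have hsdiff : ∀ v ∈ O, (nb H v \ O).card = 1 := by
    intro v hv
    have h1 := card_inter_add_card_sdiff (nb H v) O
    rw [hin v hv, hH v hv] at h1
    omega
  have hunique : ∀ v ∈ O, ∀ a b, H.Adj v a → a ∉ O → H.Adj v b → b ∉ O → a = b := by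
    intro v hv a b ha ha' hb hb'
    exact card_le_one.1 (hsdiff v hv).le a (by simp [ha, ha']) b (by simp [hb, hb'])
  have hexists : ∀ v ∈ O, ∃ u, H.Adj v u ∧ u ∉ O := by
    intro v hv
    obtain ⟨u, hu⟩ := card_pos.1 (by rw [hsdiff v hv]; exact one_pos)
    rw [mem_sdiff, mem_nb] at hu
    exact ⟨u, hu⟩
  have hfixx : ∀ γ ∈ stab Γ R, γ x = x := by
    intro γ hγ
    by_contra hne
    have h1 := hlt hs (γ x) ((hinv γ hγ.1 x).2 hx) hne
    rw [hγ.2.card_nb, hxR, hdeg x hx] at h1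
    omega
  obtain ⟨f, finj, -, -⟩ := exists_enum (univ : Finset V)
  obtain ⟨p, hp⟩ : ∃ p : V → Prop, p = fun a => ∃ b ∈ orb (stab Γ R) a, f a < f b := ⟨_, rfl⟩
  have hpx : ¬ p x := by
    rw [hp]
    rintro ⟨b, hb, hlt⟩
    rw [orb_eq_singleton hfixx, mem_singleton] at hb
    rw [hb] at hlt
    omega
  have hRle : withOutward R H O p ≤ touching H O := by
    rintro a b (h | ⟨h, h' | h'⟩)
    · exact ⟨(hR h).1, Or.inl (hR h).2.1⟩
    · exact ⟨h, Or.inl h'.1⟩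
    · exact ⟨h, Or.inr h'.1⟩
  have hstab : ∀ γ ∈ stab Γ (withOutward R H O p), γ ∈ stab Γ R := by
    intro γ hγ
    have h1 : ∀ a b, R.Adj a b ↔ (withOutward R H O p).Adj a b ∧ a ∈ O ∧ b ∈ O := by
      intro a b
      rw [withOutward_adj]
      refine ⟨fun h => ⟨Or.inl h, (hR h).2⟩, ?_⟩
      rintro ⟨h | ⟨-, h | h⟩, ha, hb⟩
      · exact h
      · exact absurd hb h.2.2
      · exact absurd ha h.2.2
    refine ⟨hγ.1, fun a b => ?_⟩
    rw [h1, h1, hγ.2, hinv γ hγ.1, hinv γ hγ.1]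
  have hp' : ∀ v ∈ O, p v ↔ ∃ u, u ∉ O ∧ (withOutward R H O p).Adj v u := by
    intro v hv
    constructor
    · intro h
      obtain ⟨u, hu, hu'⟩ := hexists v hv
      exact ⟨u, hu', Or.inr ⟨hu, Or.inl ⟨hv, h, hu'⟩⟩⟩
    · rintro ⟨u, hu, h | ⟨-, h | h⟩⟩
      · exact absurd (hR h).2.2 hu
      · exact h.2.1
      · exact absurd h.1 hu
  have hfix : ∀ γ ∈ stab Γ (withOutward R H O p), ∀ v ∈ O, γ v = v := by
    intro γ hγ v hv
    by_contra hne
    have hγR := hstab γ hγ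
    have hγv := (hinv γ hγ.1 v).2 hv
    have hiff : p (γ v) ↔ p v := by
      rw [hp' _ hγv, hp' v hv]
      constructor
      · rintro ⟨u, hu, h⟩
        obtain ⟨w, rfl⟩ := γ.surjective u
        exact ⟨w, fun hw => hu ((hinv γ hγ.1 w).2 hw), (hγ.2 v w).1 h⟩
      · rintro ⟨u, hu, h⟩
        exact ⟨γ u, fun hw => hu ((hinv γ hγ.1 u).1 hw), (hγ.2 v u).2 h⟩
    have horbv : orb (stab Γ R) v = {v, γ v} := by
      refine (eq_of_subset_of_card_le ?_ ?_).symm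
      · rw [insert_subset_iff, singleton_subset_iff]
        exact ⟨self_mem_orb, apply_mem_orb hγR⟩
      · rw [card_pair (Ne.symm hne)]
        exact horb2 v hv
    have hf : f v ≠ f (γ v) := fun h => hne (finj (by simp) (by simp) h.symm)
    rw [hp] at hiff
    simp only [orb_eq_of_mem (apply_mem_orb hγR : γ v ∈ orb (stab Γ R) v), horbv, mem_insert,
      mem_singleton, exists_eq_or_imp, exists_eq_left, lt_irrefl, false_or, or_false] at hiff
    omega
  refine Breakable.of_sdiff touching_le hRle hpresT ?_
    (hB.good_sdiff touching_le hpresT ?_ ?_).breakable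
  · rintro v ⟨u, hu⟩
    by_cases hv : v ∈ O
    · right
      by_cases hvx : v = x
      · subst hvx
        obtain ⟨w, hw, hw'⟩ := hexists v hv
        refine ⟨w, ⟨hw, Or.inl hv⟩, ?_⟩
        rintro (h | ⟨-, h | h⟩)
        · exact hw' (hR h).2.2
        · exact hpx h.2.1
        · exact hw' h.1
      · have h1 := hlt hs v hv hvx
        rw [← hdeg v hv] at h1
        obtain ⟨w, hw, hw'⟩ := exists_mem_notMem_of_card_lt_card h1
        rw [mem_nb] at hw hw'
        refine ⟨w, ⟨hw.1, Or.inl hv⟩, ?_⟩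
        rintro (h | ⟨-, h | h⟩)
        · exact hw' h
        · exact h.2.2 hw.2.2
        · exact h.2.2 hv
    · by_cases hw : ∃ w, H.Adj v w ∧ w ∉ O
      · obtain ⟨w, hw, hw'⟩ := hw
        exact Or.inl ⟨w, hw, fun h => h.2.elim hv hw'⟩
      · right
        push Not at hw
        have hc : (nb H v).card = k := by
          by_contra hne
          exact hiso v hv (lt_of_le_of_ne (hB.card_nb_le v) hne) u hu.1
        have heq : nb H v = O := eq_of_subset_of_card_le (fun w h => hw w (mem_nb.1 h)) (by omega)
        have hvx : H.Adj v x := by rwa [← mem_nb, heq]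
        refine ⟨x, ⟨hvx, Or.inr hx⟩, ?_⟩
        rintro (h | ⟨-, h | h⟩)
        · exact hv (hR h).2.1
        · exact hv h.1
        · exact hpx h.2.1
  · rintro v ⟨u, hu⟩ h2
    suffices h : ∀ γ ∈ stab Γ (withOutward R H O p), γ v = v by
      rw [card_orb_eq_one h] at h2
      omega
    intro γ hγ
    by_cases hv : v ∈ O
    · exact hfix γ hγ v hv
    · have huO := hu.2.resolve_left hv
      have h1 := (hB.pres γ hγ.1 u v).2 hu.1.symm
      rw [hfix γ hγ u huO] at h1
      exact hunique u huO _ _ h1 (fun h => hv ((hinv γ hγ.1 v).1 h)) hu.1.symm hv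
  · intro v hv hlt h2
    by_cases hvO : v ∈ O
    · obtain ⟨u, hu, -⟩ := hexists v hvO
      exact absurd ⟨hu, Or.inl hvO⟩ (hv u)
    · rw [card_orb_eq_one (hout v hvO hlt)] at h2
      omega

lemma isBreakable_of_triangles (hconn : G.Connected) (hdeg : ∀ v, (nb G v).card = k) (hk : 5 ≤ k)
    (htri : ∀ a b, G.Adj a b → ∃ c, G.Adj a c ∧ G.Adj b c) : IsBreakable G := by
  obtain ⟨r⟩ := hconn.nonempty
  obtain ⟨O, hO⟩ : ∃ O, O = nb G r := ⟨_, rfl⟩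
  have hOm : ∀ v, v ∈ O ↔ G.Adj r v := fun v => by rw [hO, mem_nb]
  have hrO : r ∉ O := fun h => ((hOm r).1 h).ne rfl
  have hOc : O.card = k := by rw [hO, hdeg]
  have hB := base_autFix hconn hdeg (singleton_nonempty r)
  obtain ⟨H, hHdef⟩ : ∃ H, H = G \ touching G {r} := ⟨_, rfl⟩
  obtain ⟨Γ, hΓ⟩ : ∃ Γ, Γ = autFix G {r} := ⟨_, rfl⟩
  have hroot := IsBreakable.of_root (G := G) hdeg (r := r) (by omega)
  rw [← hHdef, ← hΓ] at hB hroot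
  have hHadj : ∀ a b, H.Adj a b ↔ G.Adj a b ∧ a ≠ r ∧ b ≠ r := by
    intro a b
    rw [hHdef, sdiff_adj, touching_adj]
    simp only [mem_singleton]
    tauto
  have hrfix : ∀ γ ∈ Γ, γ r = r := fun γ hγ => by
    rw [hΓ] at hγ
    exact hγ.2 r (mem_singleton_self r)
  have hinv : ∀ γ ∈ Γ, ∀ v, γ v ∈ O ↔ v ∈ O := by
    intro γ hγ v
    rw [hOm, hOm, ← hB.presG γ hγ r v, hrfix γ hγ]
  have hH : ∀ v ∈ O, (nb H v).card = k - 1 := by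
    intro v hv
    have h1 : nb H v = (nb G v).erase r := by
      ext w
      rw [mem_nb, hHadj, mem_erase, mem_nb]
      have : v ≠ r := fun h => hrO (h ▸ hv)
      tauto
    rw [h1, card_erase_of_mem (mem_nb.2 ((hOm v).1 hv).symm), hdeg]
  have hH' : ∀ v ∉ O, (nb H v).card < k → v = r := by
    intro v hv hlt
    by_contra hne
    have h1 : nb H v = nb G v := by
      ext w
      rw [mem_nb, hHadj, mem_nb]
      refine ⟨And.left, fun h => ⟨h, hne, ?_⟩⟩
      rintro rfl
      exact hv ((hOm v).2 h.symm)
    rw [h1, hdeg] at hlt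
    omega
  have hout : ∀ v ∉ O, (nb H v).card < k → ∀ γ ∈ Γ, γ v = v := by
    intro v hv hlt
    rw [hH' v hv hlt]
    exact hrfix
  have hiso : ∀ v ∉ O, (nb H v).card < k → ∀ u, ¬ H.Adj v u := by
    intro v hv hlt u
    rw [hH' v hv hlt, hHadj]
    tauto
  by_cases horb : ∃ w ∈ O, orb Γ w = O
  · obtain ⟨w, hw, hwO⟩ := horb
    have hin : ∀ v ∈ O, (nb H v ∩ O).card = (nb H w ∩ O).card := by
      intro v hv
      rw [← hwO] at hv
      obtain ⟨γ, hγ, rfl⟩ := mem_orb.1 hv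
      have := (hB.pres γ hγ).card_filter_nb (· ∈ O) (hinv γ hγ) w
      rwa [filter_mem_eq_inter, filter_mem_eq_inter] at this
    have hs1 : 1 ≤ (nb H w ∩ O).card := by
      obtain ⟨c, hc, hc'⟩ := htri r w ((hOm w).1 hw)
      refine card_pos.2 ⟨c, ?_⟩
      rw [mem_inter, mem_nb, hHadj, hOm]
      exact ⟨⟨hc', fun h => hrO (h ▸ hw), hc.ne'⟩, hc⟩
    have hsle : (nb H w ∩ O).card ≤ k - 1 := (card_le_card inter_subset_left).trans (hH w hw).le
    rcases Nat.lt_or_ge (nb H w ∩ O).card (k - 2) with h | h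
    · exact hroot (hB.breakable_of_sparse hinv hOc hH hout hin hs1 (by omega))
    rcases Nat.lt_or_ge (nb H w ∩ O).card (k - 1) with h' | h'
    · exact hroot (hB.breakable_of_dense hinv hOc hH hout hiso hin (by omega) (by omega))
    have hsub : ∀ v ∈ O, ∀ u, G.Adj v u → u = r ∨ u ∈ O := by
      intro v hv u hu
      rw [or_iff_not_imp_left]
      intro hur
      have h1 : nb H v ∩ O = nb H v := eq_of_subset_of_card_le inter_subset_left (by
        rw [hin v hv, hH v hv]
        exact h')
      have h2 : u ∈ nb H v := by
        rw [mem_nb, hHadj]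
        exact ⟨hu, fun h => hrO (h ▸ hv), hur⟩
      rw [← h1] at h2
      exact (mem_inter.1 h2).2
    have hall : ∀ v, v = r ∨ v ∈ O := by
      intro v
      have hreach : Relation.ReflTransGen G.Adj r v :=
        (G.reachable_iff_reflTransGen r v).1 (hconn.preconnected r v)
      induction hreach with
      | refl => exact Or.inl rfl
      | tail _ hbc ih =>
        rcases ih with rfl | hb
        · exact Or.inr ((hOm _).2 hbc)
        · exact hsub _ hb _ hbc
    have huniv : (univ : Finset V) = insert r O := by
      ext v
      simpa using hall v
    have hcard : Fintype.card V = k + 1 := by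
      rw [← card_univ, huniv, card_insert_of_notMem hrO, hOc]
    refine isBreakable_of_complete (fun a b hab => ?_) (by omega)
    have h1 : nb G a = univ.erase a := by
      refine eq_of_subset_of_card_le (fun c hc => ?_) ?_
      · exact mem_erase.2 ⟨(mem_nb.1 hc).ne', mem_univ c⟩
      · rw [card_erase_of_mem (mem_univ a), card_univ, hdeg]
        omega
    rw [← mem_nb, h1]
    exact mem_erase.2 ⟨hab.symm, mem_univ b⟩
  · push Not at horb
    refine hroot (Good.breakable (k := k) (G := G) ⟨hB, fun v hlt h2 => ?_⟩)
    by_cases hv : v ∈ O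
    · have h1 : orb Γ v ⊆ O := by
        intro u hu
        obtain ⟨γ, hγ, rfl⟩ := mem_orb.1 hu
        exact (hinv γ hγ v).2 hv
      have h3 := card_lt_card (h1.ssubset_of_ne (horb v hv))
      rw [hH v hv]
      omega
    · rw [card_orb_eq_one (hout v hv hlt)] at h2
      omega

end Neighbourhood

section TriangleFree

variable {G c : SimpleGraph V} {k : ℕ} {r x : V}

/-- An edge `r x` in no triangle, with a colouring whose only vertices without blue edges are `r`
and `x`, and which is distinguishing once `r` and `x` are fixed. -/
structure Rooted (k : ℕ) (G c : SimpleGraph V) (r x : V) : Prop where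
  deg : ∀ v, (nb G v).card = k
  adj : G.Adj r x
  not_common : ∀ v, G.Adj r v → ¬ G.Adj x v
  le : c ≤ G
  nb_left : nb c r = nb G r
  nb_right : nb c x = nb G x
  lt : ∀ v, v ≠ r → v ≠ x → (nb c v).card < k
  eq_one : ∀ γ : Equiv.Perm V, Pres γ G → γ r = r → γ x = x → Pres γ c → γ = 1

lemma Rooted.symm (h : Rooted k G c r x) : Rooted k G c x r where
  deg := h.deg
  adj := h.adj.symm
  not_common := fun v hx hr => h.not_common v hr hx
  le := h.le
  nb_left := h.nb_right
  nb_right := h.nb_left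
  lt := fun v hx hr => h.lt v hr hx
  eq_one := fun γ hG hx hr => h.eq_one γ hG hr hx

lemma exists_rooted (hconn : G.Connected) (hdeg : ∀ v, (nb G v).card = k) (hk : 3 ≤ k)
    (hrx : G.Adj r x) (hnc : ∀ v, G.Adj r v → ¬ G.Adj x v) : ∃ c, Rooted k G c r x := by
  have hB := base_autFix hconn hdeg (S := {r, x}) ⟨r, by simp⟩
  have hgood : Good k G (G \ touching G {r, x}) (autFix G {r, x}) := by
    refine ⟨hB, fun v hlt h2 => ?_⟩
    by_cases hv : v ∈ ({r, x} : Finset V)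
    · have hfix : ∀ γ ∈ autFix G {r, x}, γ v = v := fun γ hγ => hγ.2 v hv
      rw [card_orb_eq_one hfix] at h2
      omega
    have key : ∀ a b, a ∈ ({r, x} : Finset V) → b ∈ ({r, x} : Finset V) → G.Adj a b →
        G.Adj a v → (orb (autFix G {r, x}) v).card ≤ k - 1 := by
      intro a b ha hb hab hav
      rw [← hdeg a, ← card_erase_of_mem (mem_nb.2 hab)]
      refine card_le_card fun u hu => ?_
      obtain ⟨γ, hγ, rfl⟩ := mem_orb.1 hu
      rw [mem_erase, mem_nb]
      constructor
      · intro h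
        exact hv ((apply_mem_iff_of_mem_autFix hγ v).1 (h ▸ hb))
      · have := (hγ.1 a v).2 hav
        rwa [hγ.2 a ha] at this
    rw [card_nb_sdiff_touching hv, hdeg] at hlt ⊢
    have hle : (nb G v ∩ {r, x}).card ≤ 1 := by
      refine card_le_one.2 fun a ha b hb => ?_
      simp only [mem_inter, mem_nb, mem_insert, mem_singleton] at ha hb
      obtain ⟨ha, rfl | rfl⟩ := ha <;> obtain ⟨hb, rfl | rfl⟩ := hb
      · rfl
      · exact absurd hb.symm (hnc v ha.symm)
      · exact absurd ha.symm (hnc v hb.symm)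
      · rfl
    have hne : (nb G v ∩ {r, x}).Nonempty := card_pos.1 (by omega)
    obtain ⟨a, ha⟩ := hne
    have hcard : (orb (autFix G {r, x}) v).card ≤ k - 1 := by
      simp only [mem_inter, mem_nb, mem_insert, mem_singleton] at ha
      obtain ⟨ha, rfl | rfl⟩ := ha
      · exact key a x (by simp) (by simp) hrx ha.symm
      · exact key a r (by simp) (by simp) hrx.symm ha.symm
    omega
  obtain ⟨c, hc, hS, hlt, htriv⟩ := hgood.breakable.exists_extension
  refine ⟨c, hdeg, hrx, hnc, hc, hS r (by simp), hS x (by simp), fun v hvr hvx => ?_,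
    fun γ hγ hr hx hγc => htriv γ ⟨hγ, ?_⟩ hγc⟩
  · rw [← hdeg v]
    refine hlt v (by simp [hvr, hvx]) ?_
    rw [hdeg]
    have := card_le_card (inter_subset_right (s₁ := nb G v) (s₂ := {r, x}))
    have := card_le_two (a := r) (b := x)
    omega
  · intro v hv
    rw [mem_insert, mem_singleton] at hv
    obtain rfl | rfl := hv
    · exact hr
    · exact hx

/-- The graph `c` without the edges between `r` and `X`. -/
def flip (c : SimpleGraph V) (r : V) (X : Finset V) : SimpleGraph V where
  Adj a b := c.Adj a b ∧ ¬ (a = r ∧ b ∈ X) ∧ ¬ (b = r ∧ a ∈ X)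
  symm := ⟨fun _ _ h => ⟨h.1.symm, h.2.2, h.2.1⟩⟩
  loopless := ⟨fun _ h => h.1.ne rfl⟩

lemma flip_adj {X : Finset V} {a b : V} :
    (flip c r X).Adj a b ↔ c.Adj a b ∧ ¬ (a = r ∧ b ∈ X) ∧ ¬ (b = r ∧ a ∈ X) := Iff.rfl

lemma flip_le {X : Finset V} : flip c r X ≤ c := fun _ _ h => h.1

lemma nb_flip_of_notMem {X : Finset V} {v : V} (hr : v ≠ r) (hX : v ∉ X) :
    nb (flip c r X) v = nb c v := by
  ext w
  simp [flip_adj, hr, hX]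

lemma Rooted.isBreakable_of_flip (h : Rooted k G c r x) {X : Finset V}
    (hX : X ⊆ (nb G r).erase x) (hne : X.Nonempty)
    (hφ : ∀ φ : Equiv.Perm V, Pres φ G → Pres φ (flip c r X) → φ r ∈ (nb G x).erase r →
      φ r ∉ X → (nb c (φ r)).card + X.card = k → False) : IsBreakable G := by
  have hxX : x ∉ X := fun hx => (mem_erase.1 (hX hx)).1 rfl
  have hXr : ∀ v ∈ X, G.Adj r v := fun v hv => mem_nb.1 (mem_erase.1 (hX hv)).2
  have hnbr : nb (flip c r X) r = nb G r \ X := by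
    have hrX : r ∉ X := fun hr => (hXr r hr).ne rfl
    ext w
    rw [mem_nb, flip_adj, mem_sdiff, ← h.nb_left, mem_nb]
    tauto
  have hXsub : X ⊆ nb G r := hX.trans (erase_subset _ _)
  have hcardr : (nb (flip c r X) r).card = k - X.card := by
    rw [hnbr, card_sdiff_of_subset hXsub, h.deg]
  have hXk : X.card ≤ k := (card_le_card hXsub).trans (h.deg r).le
  have hXpos := card_pos.2 hne
  have hnbx : (nb (flip c r X) x).card = k := by
    rw [nb_flip_of_notMem h.adj.ne' hxX, h.nb_right, h.deg]
  refine ⟨flip c r X, flip_le.trans h.le, fun φ hG hc => ?_⟩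
  have hfixx : φ x = x := by
    by_contra hcon
    have h1 := hc.card_nb x
    rw [hnbx] at h1
    by_cases hr : φ x = r
    · rw [hr, hcardr] at h1
      omega
    · have h2 := h.lt (φ x) hr hcon
      have h3 := card_le_card (nb_mono (flip_le : flip c r X ≤ c) (φ x))
      omega
  have hadj : G.Adj (φ r) x := by
    have := (hG r x).2 h.adj
    rwa [hfixx] at this
  by_cases hr : φ r = r
  · refine h.eq_one φ hG hr hfixx fun a b => ?_
    have hiff : ∀ a b, c.Adj a b ↔ (flip c r X).Adj a b ∨ G.Adj a b ∧ (a = r ∨ b = r) := by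
      intro a b
      have hl : ∀ b, G.Adj r b → c.Adj r b := fun b hb => by
        rwa [← mem_nb, h.nb_left, mem_nb]
      rw [flip_adj]
      constructor
      · intro hab
        have := h.le hab
        tauto
      · rintro (hab | ⟨hab, rfl | rfl⟩)
        · exact hab.1
        · exact hl b hab
        · exact (hl a hab.symm).symm
    have heq : ∀ a, φ a = r ↔ a = r := fun a => by
      conv_lhs => rw [← hr]
      exact φ.injective.eq_iff
    rw [hiff, hiff, hc, hG, heq, heq]
  · exfalso
    have hrX : φ r ∉ X := fun hmem => h.not_common _ (hXr _ hmem) hadj.symm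
    refine hφ φ hG hc (mem_erase.2 ⟨hr, mem_nb.2 hadj.symm⟩) hrX ?_
    have h1 := hc.card_nb r
    rw [hcardr, nb_flip_of_notMem hr hrX] at h1
    omega

lemma Rooted.exists_card_nb (h : Rooted k G c r x) (hG : ¬ IsBreakable G) {i : ℕ} (hi : 1 ≤ i)
    (hik : i < k) : ∃ z ∈ (nb G x).erase r, (nb c z).card + i = k := by
  by_contra! hcon
  have hcard : i ≤ ((nb G r).erase x).card := by
    rw [card_erase_of_mem (mem_nb.2 h.adj), h.deg]
    omega
  obtain ⟨X, hX, rfl⟩ := exists_subset_card_eq hcard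
  exact hG (h.isBreakable_of_flip hX (card_pos.1 hi) fun φ _ _ hφ _ => hcon _ hφ)

lemma Rooted.exists_forall_card_nb (h : Rooted k G c r x) (hG : ¬ IsBreakable G) (hk : 2 ≤ k) :
    ∃ w, ∀ a ∈ (nb G r).erase x, a ≠ w → (nb c a).card = (nb c w).card + 1 := by
  have hinj : Set.InjOn (fun z => (nb c z).card) ((nb G x).erase r) := by
    refine injOn_of_surjOn_of_card_le (t := Icc 1 (k - 1)) _ (fun z hz => ?_) (fun i hi => ?_) ?_
    · have hz' := mem_erase.1 (mem_coe.1 hz)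
      have hzx := mem_nb.1 hz'.2
      have h1 := h.lt z hz'.1 hzx.ne'
      have h2 : 0 < (nb c z).card := card_nb_pos_iff.2 ⟨x, by
        rw [c.adj_comm, ← mem_nb, h.nb_right]
        exact hz'.2⟩
      rw [coe_Icc, Set.mem_Icc]
      exact ⟨h2, by omega⟩
    · rw [coe_Icc, Set.mem_Icc] at hi
      obtain ⟨z, hz, hzi⟩ := h.exists_card_nb hG (i := k - i) (by omega) (by omega)
      exact ⟨z, hz, by dsimp only; omega⟩
    · rw [card_erase_of_mem (mem_nb.2 h.adj.symm), h.deg, Nat.card_Icc]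
      omega
  obtain ⟨z, hz, hz1⟩ := h.exists_card_nb hG le_rfl (by omega)
  have hzx : G.Adj x z := mem_nb.1 (mem_erase.1 hz).2
  have hblue : (nb G z \ nb c z).card = 1 := by
    rw [card_sdiff_of_subset (nb_mono h.le z), h.deg]
    omega
  obtain ⟨w, hw⟩ := card_eq_one.1 hblue
  have hzw : G.Adj z w := by
    have := mem_singleton_self w
    rw [← hw, mem_sdiff, mem_nb] at this
    exact this.1
  have hwr : w ≠ r := by
    rintro rfl
    exact h.not_common z hzw.symm hzx
  refine ⟨w, fun a ha haw => ?_⟩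
  have hra : G.Adj r a := mem_nb.1 (mem_erase.1 ha).2
  by_contra hne
  refine hG (h.isBreakable_of_flip (singleton_subset_iff.2 ha) (singleton_nonempty a) ?_)
  intro φ hφG hφc hφr hφX hcard
  rw [card_singleton] at hcard
  have hφz : φ r = z := hinj hφr hz (by dsimp only; omega)
  rw [hφz] at hφr hφX
  have hφa : φ a = w := by
    rw [← mem_singleton, ← hw, mem_sdiff, mem_nb, ← nb_flip_of_notMem (mem_erase.1 hφr).1 hφX,
      mem_nb, ← hφz, hφG, hφc, flip_adj]
    simp [hra]
  have h1 := hφc.card_nb a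
  rw [hφa, nb_flip_of_notMem hwr (by simpa using Ne.symm haw)] at h1
  have h2 : nb (flip c r {a}) a = (nb c a).erase r := by
    ext u
    simp [flip_adj, hra.ne', and_comm]
  have har : r ∈ nb c a := by
    rw [mem_nb, c.adj_comm, ← mem_nb, h.nb_left, mem_nb]
    exact hra
  rw [h2, card_erase_of_mem har] at h1
  have := card_pos.2 ⟨r, har⟩
  omega

lemma Rooted.isBreakable (h : Rooted k G c r x) (hk : 4 ≤ k) : IsBreakable G := by
  by_contra hG
  obtain ⟨w, hw⟩ := h.exists_forall_card_nb hG (by omega)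
  have hval : ∀ a ∈ (nb G r).erase x, (nb c a).card = (nb c w).card ∨
      (nb c a).card = (nb c w).card + 1 := by
    intro a ha
    by_cases haw : a = w
    · exact Or.inl (by rw [haw])
    · exact Or.inr (hw a ha haw)
  obtain ⟨a₁, ha₁, h₁⟩ := h.symm.exists_card_nb hG (i := 1) le_rfl (by omega)
  obtain ⟨a₂, ha₂, h₂⟩ := h.symm.exists_card_nb hG (i := 2) (by omega) (by omega)
  obtain ⟨a₃, ha₃, h₃⟩ := h.symm.exists_card_nb hG (i := 3) (by omega) (by omega)
  have := hval a₁ ha₁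
  have := hval a₂ ha₂
  have := hval a₃ ha₃
  omega

end TriangleFree

theorem isBreakable_of_regular {G : SimpleGraph V} {k : ℕ} (hconn : G.Connected)
    (hdeg : ∀ v, (nb G v).card = k) (hk : 5 ≤ k) : IsBreakable G := by
  by_cases htri : ∀ a b, G.Adj a b → ∃ c, G.Adj a c ∧ G.Adj b c
  · exact isBreakable_of_triangles hconn hdeg hk htri
  · push Not at htri
    obtain ⟨r, x, hrx, hnc⟩ := htri
    obtain ⟨c, hc⟩ := exists_rooted hconn hdeg (by omega) hrx hnc
    exact hc.isBreakable (by omega)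

end SimpleGraph.RegularDistinguishing

theorem distinguishingIndex_le_two_of_isRegular
    {V : Type*} [Fintype V] (G : SimpleGraph V) [DecidableRel G.Adj] (k : ℕ)
    (hconn : G.Connected) (hreg : G.IsRegularOfDegree k) (hk : 5 ≤ k) :
    G.distinguishingIndex ≤ 2 := by
  classical
  have hdeg : ∀ v, (SimpleGraph.RegularDistinguishing.nb G v).card = k := by
    intro v
    rw [← hreg v, ← G.card_neighborFinset_eq_degree]
    congr 1
    ext w
    simp
  obtain ⟨R, hR, htriv⟩ :=
    SimpleGraph.RegularDistinguishing.isBreakable_of_regular hconn hdeg hk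
  refine Nat.sInf_le ⟨fun e => if (e : Sym2 V) ∈ R.edgeSet then 0 else 1, fun φ hφ v => ?_⟩
  suffices h : φ.toEquiv = 1 from Equiv.congr_fun h v
  refine htriv _ (fun a b => φ.map_adj_iff) fun a b => ?_
  by_cases hab : G.Adj a b
  · have h1 := hφ ⟨s(a, b), hab⟩
    have h2 : ((φ.mapEdgeSet ⟨s(a, b), hab⟩ : G.edgeSet) : Sym2 V) = s(φ a, φ b) := rfl
    simp only [h2, SimpleGraph.mem_edgeSet] at h1
    change R.Adj (φ a) (φ b) ↔ R.Adj a b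
    split_ifs at h1 <;> simp_all
  · exact iff_of_false (fun h => hab (φ.map_adj_iff.1 (hR h))) fun h => hab (hR h)
end

section
/- Let G be a finite connected k-regular simple graph with k ≥ 2. Then D'(G) ≤ 3, i.e. G admits a distinguishing edge labeling with 3 labels. -/
namespace SimpleGraph

variable {V : Type*} {G : SimpleGraph V}

/-- To bound the distinguishing index by `3` it suffices to label all unordered pairs of vertices so
that no nontrivial automorphism preserves the labels of edges. -/
lemma distinguishingIndex_le_three_of_label (f : Sym2 V → Fin 3)
    (hf : ∀ φ : G ≃g G, (∀ u v, G.Adj u v → f s(φ u, φ v) = f s(u, v)) → ∀ v, φ v = v) :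
    G.distinguishingIndex ≤ 3 := by
  refine Nat.sInf_le ⟨fun e => f e.1, fun φ hφ => hf φ fun u v huv => ?_⟩
  exact hφ ⟨s(u, v), huv⟩

/-- A set that contains, with each of its vertices, all neighbours of that vertex is everything. -/
lemma Connected.mem_of_adj_closed (hconn : G.Connected) {C : Set V} {a : V} (ha : a ∈ C)
    (hC : ∀ u ∈ C, ∀ v, G.Adj u v → v ∈ C) (b : V) : b ∈ C := by
  obtain ⟨p⟩ := hconn.preconnected a b
  induction p with
  | nil => exact ha
  | cons h _ ih => exact ih (hC _ ha _ h)

/-- Two edges at a vertex with labels of their own destroy all symmetries of a cycle. -/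
lemma distinguishingIndex_le_three_of_isRegularOfDegree_two [Fintype V] [DecidableRel G.Adj]
    (hconn : G.Connected) (hreg : G.IsRegularOfDegree 2) : G.distinguishingIndex ≤ 3 := by
  classical
  have hnbr : ∀ w, ∃ p q, p ≠ q ∧ ∀ v, G.Adj w v ↔ v = p ∨ v = q := by
    intro w
    obtain ⟨p, q, hpq, h⟩ := Finset.card_eq_two.1 (hreg w)
    refine ⟨p, q, hpq, fun v => ?_⟩
    rw [← mem_neighborFinset, h]
    simp
  obtain ⟨c⟩ := hconn.nonempty
  obtain ⟨a, b, hab, hc⟩ := hnbr c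
  have hca : G.Adj c a := (hc a).2 (.inl rfl)
  have hcb : G.Adj c b := (hc b).2 (.inr rfl)
  refine distinguishingIndex_le_three_of_label
    (fun e => if e = s(c, a) then 0 else if e = s(c, b) then 1 else 2) fun φ hφ => ?_
  have hea : s(φ c, φ a) = s(c, a) := by
    have := hφ c a hca
    by_contra hne
    simp only [hne, if_false, if_true] at this
    split_ifs at this <;> simp at this
  have heb : s(φ c, φ b) = s(c, b) := by
    have := hφ c b hcb
    have hne : s(c, b) ≠ s(c, a) := by simp [hab.symm, hca.ne]
    by_contra hne'
    simp only [hne', hne, if_false, if_true] at this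
    split_ifs at this <;> simp at this
  have hfix : φ c = c ∧ φ a = a ∧ φ b = b := by
    have := hca.ne
    have := hcb.ne
    simp only [Sym2.eq_iff] at hea heb
    grind
  refine fun v => (hconn.mem_of_adj_closed (C := {u | φ u = u ∧ ∀ w, G.Adj u w → φ w = w})
    (a := c) ⟨hfix.1, fun w hw => ?_⟩ ?_ v).1
  · rcases (hc w).1 hw with rfl | rfl
    exacts [hfix.2.1, hfix.2.2]
  · rintro u ⟨hu, hu'⟩ w huw
    refine ⟨hu' w huw, fun z hz => ?_⟩
    obtain ⟨p, q, hpq, hw⟩ := hnbr w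
    have h1 := (hw u).1 huw.symm
    have h2 := (hw z).1 hz
    have h3 : G.Adj w (φ z) := by
      have := φ.map_adj_iff.2 hz
      rwa [hu' w huw] at this
    have h4 := (hw (φ z)).1 h3
    have h5 : φ z = φ u → z = u := fun h => φ.injective h
    grind

/-- `G.IsPiece W C` says that `C` is the vertex set of a connected component of the subgraph of `G`
induced on `W`. -/
def IsPiece (G : SimpleGraph V) (W C : Set V) : Prop :=
  C ⊆ W ∧ C.Nonempty ∧ (∀ a ∈ C, ∀ b ∈ W, G.Adj a b → b ∈ C) ∧
    ∀ D ⊆ C, D.Nonempty → (∀ a ∈ D, ∀ b ∈ C, G.Adj a b → b ∈ D) → C ⊆ D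

lemma IsPiece.self {W C : Set V} (h : G.IsPiece W C) : G.IsPiece C C :=
  ⟨subset_rfl, h.2.1, fun _ _ _ hb _ => hb, h.2.2.2⟩

lemma IsPiece.subset_of_mem {W C C' : Set V} (h : G.IsPiece W C) (h' : G.IsPiece W C') {v : V}
    (hv : v ∈ C) (hv' : v ∈ C') : C ⊆ C' := by
  refine (h.2.2.2 (C ∩ C') Set.inter_subset_left ⟨v, hv, hv'⟩ ?_).trans Set.inter_subset_right
  exact fun a ha b hb hab => ⟨hb, h'.2.2.1 a ha.2 b (h.1 hb) hab⟩

lemma IsPiece.eq_of_mem {W C C' : Set V} (h : G.IsPiece W C) (h' : G.IsPiece W C') {v : V}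
    (hv : v ∈ C) (hv' : v ∈ C') : C = C' :=
  (h.subset_of_mem h' hv hv').antisymm (h'.subset_of_mem h hv' hv)

lemma exists_isPiece {W : Set V} {v : V} (hv : v ∈ W) : ∃ C, G.IsPiece W C ∧ v ∈ C := by
  let P : Set V → Prop := fun D => v ∈ D ∧ ∀ a ∈ D, ∀ b ∈ W, G.Adj a b → b ∈ D
  let C : Set V := {u | u ∈ W ∧ ∀ D, P D → u ∈ D}
  have hvC : v ∈ C := ⟨hv, fun D hD => hD.1⟩
  have hC : ∀ a ∈ C, ∀ b ∈ W, G.Adj a b → b ∈ C := fun a ha b hb hab =>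
    ⟨hb, fun D hD => hD.2 a (ha.2 D hD) b hb hab⟩
  refine ⟨C, ⟨fun u hu => hu.1, ⟨v, hvC⟩, hC, fun D hDC hD hcl => ?_⟩, hvC⟩
  by_cases hvD : v ∈ D
  · exact fun u hu => hu.2 D ⟨hvD, fun a ha b hb hab => hcl a ha b (hC a (hDC ha) b hb hab) hab⟩
  · obtain ⟨u, hu⟩ := hD
    refine absurd hu ((hDC hu).2 (C \ D) ⟨⟨hvC, hvD⟩, fun a ha b hb hab => ?_⟩).2
    exact ⟨hC a ha.1 b hb hab, fun hbD => ha.2 (hcl b hbD a ha.1 hab.symm)⟩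

lemma IsPiece.image {W C : Set V} (h : G.IsPiece W C) (σ : Equiv.Perm V)
    (hW : ∀ u, σ u ∈ W ↔ u ∈ W) (hadj : ∀ u ∈ W, ∀ v, G.Adj (σ u) (σ v) ↔ G.Adj u v) :
    G.IsPiece W (σ '' C) := by
  refine ⟨?_, h.2.1.image σ, ?_, fun D hD hne hcl => ?_⟩
  · rintro _ ⟨u, hu, rfl⟩
    exact (hW u).2 (h.1 hu)
  · rintro _ ⟨u, hu, rfl⟩ b hb hab
    obtain ⟨v, rfl⟩ := σ.surjective b
    exact ⟨v, h.2.2.1 u hu v ((hW v).1 hb) ((hadj u (h.1 hu) v).1 hab), rfl⟩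
  · rw [Set.image_subset_iff]
    refine h.2.2.2 (σ ⁻¹' D) (fun u hu => ?_) ?_ fun a ha b hb hab => ?_
    · obtain ⟨w, hw, hwu⟩ := hD hu
      rwa [← σ.injective hwu]
    · obtain ⟨d, hd⟩ := hne
      exact ⟨σ.symm d, by simpa using hd⟩
    · exact hcl _ ha _ ⟨b, hb, rfl⟩ ((hadj b (h.1 hb) a).2 hab.symm).symm

/-- `σ` carries the part of `G` at `S`, labeled by `f`, to the part at `S'`, labeled by `f'`, and
fixes the neighbours of `S` outside `S`. -/
def IsLabelIso (G : SimpleGraph V) (S S' : Set V) (f f' : Sym2 V → Fin 3)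
    (σ : Equiv.Perm V) : Prop :=
  (∀ u, σ u ∈ S' ↔ u ∈ S) ∧ (∀ u ∈ S, ∀ v ∉ S, G.Adj u v → σ v = v) ∧
    ∀ u ∈ S, ∀ v, (G.Adj (σ u) (σ v) ↔ G.Adj u v) ∧
      (G.Adj u v → f' s(σ u, σ v) = f s(u, v))

lemma IsLabelIso.refl (S : Set V) (f : Sym2 V → Fin 3) : G.IsLabelIso S S f f 1 := by
  simp [IsLabelIso]

lemma IsLabelIso.symm {S S' : Set V} {f f' : Sym2 V → Fin 3} {σ : Equiv.Perm V}
    (h : G.IsLabelIso S S' f f' σ) : G.IsLabelIso S' S f' f σ⁻¹ := by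
  have hmem : ∀ u, σ⁻¹ u ∈ S ↔ u ∈ S' := fun u => by simpa using (h.1 (σ⁻¹ u)).symm
  refine ⟨hmem, fun u hu v hv huv => ?_, fun u hu v => ?_⟩
  · have h3 := h.2.2 _ ((hmem u).2 hu) (σ⁻¹ v)
    have h2 := h.2.1 _ ((hmem u).2 hu) (σ⁻¹ v) (fun hv' => hv ((hmem v).1 hv'))
    simp only [σ.apply_symm_apply, Equiv.Perm.inv_def] at h2 h3 ⊢
    exact (h2 (h3.1.1 huv)).symm
  · have h3 := h.2.2 _ ((hmem u).2 hu) (σ⁻¹ v)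
    simp only [σ.apply_symm_apply, Equiv.Perm.inv_def] at h3 ⊢
    exact ⟨h3.1.symm, fun huv => (h3.2 (h3.1.1 huv)).symm⟩

lemma IsLabelIso.trans {S S' S'' : Set V} {f f' f'' : Sym2 V → Fin 3} {σ τ : Equiv.Perm V}
    (h : G.IsLabelIso S S' f f' σ) (h' : G.IsLabelIso S' S'' f' f'' τ) :
    G.IsLabelIso S S'' f f'' (τ * σ) := by
  refine ⟨fun u => (h'.1 _).trans (h.1 u), fun u hu v hv huv => ?_, fun u hu v => ?_⟩
  · have h3 := h'.2.1 _ ((h.1 u).2 hu) (σ v) (fun hv' => hv ((h.1 v).1 hv'))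
      ((h.2.2 u hu v).1.2 huv)
    rw [Equiv.Perm.mul_apply, h3, h.2.1 u hu v hv huv]
  · have h1 := h.2.2 u hu v
    have h2 := h'.2.2 _ ((h.1 u).2 hu) (σ v)
    exact ⟨h2.1.trans h1.1, fun huv => (h2.2 (h1.1.2 huv)).trans (h1.2 huv)⟩

/-- Exactly one edge at `u` has label `1`, and all others have label `0`. -/
def IsRootLike (G : SimpleGraph V) (f : Sym2 V → Fin 3) (u : V) : Prop :=
  ∃ w, G.Adj u w ∧ f s(u, w) = 1 ∧ ∀ v, G.Adj u v → v ≠ w → f s(u, v) = 0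

/-- The labeling `f` of the edges at `S` singles out `y` among the neighbours of `x` in `S` (by the
label `1`) and no vertex of `S` resembles the root `r`. -/
def IsGoodLabel (G : SimpleGraph V) (r x y : V) (S : Set V) (f : Sym2 V → Fin 3) : Prop :=
  f s(y, x) ≠ 0 ∧ ((∃ u ∈ S, u ≠ y) → f s(y, x) = 1) ∧
    (∀ u ∈ S, ∀ v ∉ S, G.Adj u v → ¬(u = y ∧ v = x) →
      f s(u, v) ≠ 1 ∧ (v = r → f s(u, v) = 0)) ∧
    ∀ u ∈ S, ¬ G.IsRootLike f u

/-- Sets of distinct representatives: fewer than `k` sets of size `k` have at least `k` of them. -/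
lemma exists_distinct_transversals {J Q : Type*} [Finite J] {k : ℕ} (hJ : 0 < Nat.card J)
    (hJk : Nat.card J < k) (q : J → Fin k → Q) (hq : ∀ j, Function.Injective (q j)) :
    ∃ t : Fin k → J → Fin k, (∀ i, Function.Injective fun j => q j (t i j)) ∧
      ∀ i i', Set.range (fun j => q j (t i j)) = Set.range (fun j => q j (t i' j)) → i = i' := by
  classical
  have := Fintype.ofFinite J
  rw [Nat.card_eq_fintype_card] at hJ hJk
  obtain ⟨g, hg, hgT⟩ := (Finset.all_card_le_biUnion_card_iff_exists_injective
    (fun j => Finset.univ.image (q j))).1 (fun s => by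
      rcases s.eq_empty_or_nonempty with rfl | ⟨j, hj⟩
      · simp
      · calc s.card ≤ Fintype.card J := s.card_le_univ
          _ ≤ k := hJk.le
          _ = (Finset.univ.image (q j)).card := by
            rw [Finset.card_image_of_injective _ (hq j), Finset.card_univ, Fintype.card_fin]
          _ ≤ _ := Finset.card_le_card
            (Finset.subset_biUnion_of_mem (fun j => Finset.univ.image (q j)) hj))
  have hs : ∀ j, ∃ i, q j i = g j := fun j => by simpa using hgT j
  choose s hs using hs
  let A : J → Finset (Fin k) := fun j => {i | ∀ j', q j i ≠ g j'}
  have hA : ∀ j, k - Fintype.card J ≤ (A j).card := by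
    intro j
    have h1 : (A j)ᶜ.card ≤ Fintype.card J := by
      calc (A j)ᶜ.card = ((A j)ᶜ.image (q j)).card :=
            (Finset.card_image_of_injective _ (hq j)).symm
        _ ≤ (Finset.univ.image g).card := Finset.card_le_card fun x hx => by
            simp only [A, Finset.mem_image, Finset.mem_compl, Finset.mem_filter] at hx ⊢
            obtain ⟨i, hi, rfl⟩ := hx
            push Not at hi
            obtain ⟨j', hj'⟩ := hi (Finset.mem_univ _)
            exact ⟨j', Finset.mem_univ _, hj'.symm⟩
        _ ≤ Fintype.card J := Finset.card_image_le
    rw [Finset.card_compl, Fintype.card_fin] at h1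
    omega
  have hcard : Fintype.card (Fin k) ≤ Fintype.card (Option (Σ j, A j)) := by
    rw [Fintype.card_fin, Fintype.card_option, Fintype.card_sigma]
    have h1 : Fintype.card J * (k - Fintype.card J) ≤ ∑ j, Fintype.card (A j) := by
      rw [← smul_eq_mul, ← Finset.card_univ]
      exact Finset.card_nsmul_le_sum _ _ _ fun j _ => by simpa using hA j
    obtain ⟨c, hc⟩ := Nat.exists_eq_add_of_lt hJk
    have h2 : k - Fintype.card J = c + 1 := by omega
    rw [h2] at h1
    nlinarith
  obtain ⟨e⟩ := Function.Embedding.nonempty_of_card_le hcard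
  let t : Option (Σ j, A j) → J → Fin k := fun o =>
    o.elim s fun p => Function.update s p.1 p.2
  have hA' : ∀ (p : Σ j, A j) j', q p.1 p.2 ≠ g j' := fun p => by
    exact (Finset.mem_filter.1 p.2.2).2
  have htn : ∀ j, q j (t none j) = g j := hs
  have hts : ∀ p j, q j (t (some p) j) = if j = p.1 then q p.1 p.2 else g j := by
    intro p j
    rcases eq_or_ne j p.1 with rfl | h
    · simp [t]
    · simp [t, h, hs]
  refine ⟨fun i => t (e i), fun i => ?_, fun i i' h => e.injective ?_⟩
  · dsimp only
    generalize e i = o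
    rcases o with _ | p
    · simpa only [htn] using hg
    · intro j j' h
      simp only [hts] at h
      split_ifs at h with h1 h2 h2
      · exact h1.trans h2.symm
      · exact absurd h (hA' p _)
      · exact absurd h.symm (hA' p _)
      · exact hg h
  · have key : ∀ o o' : Option (Σ j, A j), Set.range (fun j => q j (t o j)) =
        Set.range (fun j => q j (t o' j)) → ∀ p, o = some p → o' = some p := by
      rintro o o' h p rfl
      have h1 : q p.1 p.2 ∈ Set.range (fun j => q j (t o' j)) := by
        rw [← h]
        exact ⟨p.1, by simp [hts]⟩
      obtain ⟨j, hj⟩ := h1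
      rcases o' with _ | p'
      · exact absurd (hj.symm.trans (htn j)) (hA' p j)
      · simp only [hts] at hj
        split_ifs at hj with hjp
        · have h2 : p.1 = p'.1 := by
            by_contra hne
            have h3 : g p.1 ∈ Set.range (fun j => q j (t (some p) j)) := by
              rw [h]
              exact ⟨p.1, by simp [hts, hne]⟩
            obtain ⟨j', hj'⟩ := h3
            simp only [hts] at hj'
            split_ifs at hj' with h4
            · exact hA' p _ hj'
            · exact h4 (hg hj')
          obtain ⟨a, b⟩ := p
          obtain ⟨a', b'⟩ := p'
          obtain rfl : a = a' := h2
          obtain rfl : b' = b := Subtype.ext (hq a hj)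
          rfl
        · exact absurd hj.symm (hA' p j)
    rcases ho : e i with _ | p
    · rcases ho' : e i' with _ | p'
      · rfl
      · rw [← ho, key _ _ h.symm p' ho']
    · exact (key _ _ h p ho).symm

/-- The edges at a vertex can be labeled independently. -/
lemma exists_label_star (y : V) (g : V → Fin 3) : ∃ f : Sym2 V → Fin 3, ∀ v, f s(y, v) = g v := by
  classical
  refine ⟨Sym2.lift ⟨fun u v => if u = y then g v else if v = y then g u else 0, ?_⟩, ?_⟩
  · intro u v
    dsimp only
    split_ifs <;> simp_all
  · simp

/-- A single vertex has many good labelings. -/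
lemma exists_goodLabel_singleton [Finite V] {k : ℕ} (hk : 3 ≤ k) {r x y : V}
    (hdeg : (G.neighborSet y).ncard = k) (hyx : G.Adj y x) :
    ∃ F : Fin k → Sym2 V → Fin 3, (∀ i, G.IsGoodLabel r x y {y} (F i)) ∧
      ∀ i j σ, G.IsLabelIso {y} {y} (F i) (F j) σ → i = j ∧ ∀ u ∈ ({y} : Set V), σ u = u := by
  classical
  have := Fintype.ofFinite V
  let N : Finset V := (G.neighborFinset y).erase x |>.erase r
  have hN : k ≤ N.card + 2 := by
    have h1 : (G.neighborFinset y).card = k := by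
      rw [← hdeg, Set.ncard_eq_toFinset_card']
      rfl
    have h2 := Finset.pred_card_le_card_erase (s := G.neighborFinset y) (a := x)
    have h3 := Finset.pred_card_le_card_erase (s := (G.neighborFinset y).erase x) (a := r)
    change _ ≤ N.card at h3
    omega
  let O : Finset (Bool × Finset V) := (Finset.univ ×ˢ N.powerset).erase (true, ∅)
  have hO : Fintype.card (Fin k) ≤ Fintype.card O := by
    rw [Fintype.card_fin, Fintype.card_coe, Finset.card_erase_of_mem (by simp),
      Finset.card_product, Finset.card_powerset, Finset.card_univ, Fintype.card_bool]
    have : N.card < 2 ^ N.card := Nat.lt_two_pow_self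
    omega
  obtain ⟨e⟩ := Function.Embedding.nonempty_of_card_le hO
  have hOm : ∀ i, (e i).1.2 ⊆ N ∧ ((e i).1.1 = true → (e i).1.2 ≠ ∅) := by
    intro i
    have := (e i).2
    simp only [O, Finset.mem_erase, Finset.mem_product, Finset.mem_powerset] at this
    exact ⟨this.2.2, fun h h' => this.1 (Prod.ext h h')⟩
  have hmemN : ∀ i, ∀ v ∈ (e i).1.2, G.Adj y v ∧ v ≠ x ∧ v ≠ r := by
    intro i v hv
    have := (hOm i).1 hv
    simp only [N, Finset.mem_erase, mem_neighborFinset] at this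
    exact ⟨this.2.2, this.2.1, this.1⟩
  choose f hf using fun i => exists_label_star y (fun v =>
    if v = x then (if (e i).1.1 then 1 else 2) else if v ∈ (e i).1.2 then 2 else 0)
  refine ⟨f, fun i => ⟨?_, ?_, ?_, ?_⟩, fun i j σ h => ?_⟩
  · rw [hf]
    split_ifs <;> simp_all
  · rintro ⟨u, rfl, h⟩
    exact absurd rfl h
  · rintro u rfl v - huv hne
    have hvx : v ≠ x := fun h => hne ⟨rfl, h⟩
    rw [hf, if_neg hvx]
    refine ⟨by split_ifs <;> simp, fun hvr => if_neg fun hv => (hmemN i v hv).2.2 hvr⟩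
  · rintro u rfl ⟨w, huw, hw, hall⟩
    have hwx : w = x := by
      by_contra hne
      rw [hf, if_neg hne] at hw
      split_ifs at hw <;> simp at hw
    subst hwx
    have htrue : (e i).1.1 = true := by
      by_contra h
      rw [hf, if_pos rfl, if_neg h] at hw
      simp at hw
    obtain ⟨v, hv⟩ := Finset.nonempty_iff_ne_empty.2 ((hOm i).2 htrue)
    have h1 := hall v (hmemN i v hv).1 (hmemN i v hv).2.1
    rw [hf, if_neg (hmemN i v hv).2.1, if_pos hv] at h1
    simp at h1
  · have hy : σ y = y := by simpa using (h.1 y).2 rfl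
    refine ⟨?_, by simpa using hy⟩
    have heq : ∀ v, G.Adj y v → f j s(y, v) = f i s(y, v) := by
      intro v hv
      have h1 := (h.2.2 y rfl v).2 hv
      rwa [hy, h.2.1 y rfl v (by simpa using hv.ne') hv] at h1
    refine e.injective (Subtype.ext (Prod.ext ?_ ?_))
    · have := heq x hyx
      rw [hf, hf, if_pos rfl, if_pos rfl] at this
      cases h1 : (e i).1.1 <;> cases h2 : (e j).1.1 <;> simp_all
    · have : ∀ i j, (∀ v, G.Adj y v → f j s(y, v) = f i s(y, v)) → (e i).1.2 ⊆ (e j).1.2 := by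
        intro i j heq v hv
        have := heq v (hmemN i v hv).1
        rw [hf, hf, if_neg (hmemN i v hv).2.1, if_neg (hmemN i v hv).2.1, if_pos hv] at this
        by_contra hv'
        rw [if_neg hv'] at this
        simp at this
      exact (this i j heq).antisymm (this j i fun v hv => (heq v hv).symm)

/-- Labelings of the edges at the pieces of `W`, together with a labeling of the remaining edges,
fit together. -/
lemma exists_label_glue {W : Set V} (F : {C // G.IsPiece W C} → Sym2 V → Fin 3)
    (f₀ : Sym2 V → Fin 3) :
    ∃ f : Sym2 V → Fin 3,
      (∀ C : {C // G.IsPiece W C}, ∀ u ∈ C.1, ∀ v, G.Adj u v → f s(u, v) = F C s(u, v)) ∧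
      ∀ u ∉ W, ∀ v ∉ W, f s(u, v) = f₀ s(u, v) := by
  classical
  refine ⟨fun e => if h : ∃ C : {C // G.IsPiece W C}, ∃ u ∈ C.1, u ∈ e then F h.choose e else f₀ e,
    fun C u hu v huv => ?_, fun u hu v hv => dif_neg ?_⟩
  · have h : ∃ C : {C // G.IsPiece W C}, ∃ w ∈ C.1, w ∈ s(u, v) := ⟨C, u, hu, by simp⟩
    obtain ⟨w, hw, hwe⟩ := h.choose_spec
    have hC : h.choose = C := by
      refine Subtype.ext ?_
      rcases Sym2.mem_iff.1 hwe with rfl | rfl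
      · exact h.choose.2.eq_of_mem C.2 hw hu
      · exact h.choose.2.eq_of_mem C.2 hw (C.2.2.2.1 u hu w (h.choose.2.1 hw) huv)
    dsimp only
    rw [dif_pos h, hC]
  · rintro ⟨C, w, hw, hwe⟩
    rcases Sym2.mem_iff.1 hwe with rfl | rfl
    exacts [hu (C.2.1 hw), hv (C.2.1 hw)]

/-- A connected vertex set avoiding the root has `k` good labelings that are rigid and pairwise
inequivalent. -/
lemma exists_goodLabel [Finite V] {k : ℕ} (hk : 3 ≤ k)
    (hdeg : ∀ v, (G.neighborSet v).ncard = k) (r : V) (S : Set V) :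
    ∀ x y, G.IsPiece S S → r ∉ S → x ∉ S → y ∈ S → G.Adj y x →
      ∃ F : Fin k → Sym2 V → Fin 3, (∀ i, G.IsGoodLabel r x y S (F i)) ∧
        ∀ i j σ, G.IsLabelIso S S (F i) (F j) σ → i = j ∧ ∀ u ∈ S, σ u = u := by
  classical
  induction S using WellFoundedLT.induction with
  | ind S ih =>
  intro x y hS hr hx hy hyx
  by_cases hsing : S = {y}
  · subst hsing
    exact exists_goodLabel_singleton hk (hdeg y) hyx
  obtain ⟨z, hz, hzy⟩ : ∃ z ∈ S, z ≠ y := by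
    by_contra! h
    exact hsing (Set.eq_singleton_iff_unique_mem.2 ⟨hy, h⟩)
  let W : Set V := S \ {y}
  have hWS : W ⊆ S := Set.sdiff_subset
  have hyW : y ∉ W := fun h => h.2 rfl
  let J := {C // G.IsPiece W C}
  have hnbr : ∀ C : J, ∃ u ∈ C.1, G.Adj u y := by
    intro C
    by_contra! h
    refine hyW (C.2.1 (hS.2.2.2 C.1 (C.2.1.trans hWS) C.2.2.1 (fun a ha b hb hab => ?_) hy))
    refine C.2.2.2.1 a ha b ⟨hb, ?_⟩ hab
    rintro rfl
    exact h a ha hab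
  choose n hnC hny using hnbr
  have hninj : Function.Injective n := fun C C' h =>
    Subtype.ext (C.2.eq_of_mem C'.2 (hnC C) (h ▸ hnC C'))
  have hJ : 0 < Nat.card J := by
    obtain ⟨C, hC, -⟩ := exists_isPiece (G := G) (W := W) (v := z) ⟨hz, hzy⟩
    have : Nonempty J := ⟨⟨C, hC⟩⟩
    exact Nat.card_pos
  have hJk : Nat.card J < k := by
    rw [← Set.ncard_univ, ← Set.ncard_image_of_injective _ hninj, ← hdeg y]
    refine Set.ncard_lt_ncard ⟨?_, fun h => ?_⟩
    · rintro _ ⟨C, -, rfl⟩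
      exact (hny C).symm
    · obtain ⟨C, -, hC⟩ := h hyx
      exact hx (hWS (C.2.1 (hC ▸ hnC C)))
  have hih : ∀ C : J, ∃ F : Fin k → Sym2 V → Fin 3, (∀ i, G.IsGoodLabel r y (n C) C.1 (F i)) ∧
      ∀ i j σ, G.IsLabelIso C.1 C.1 (F i) (F j) σ → i = j ∧ ∀ u ∈ C.1, σ u = u := fun C =>
    ih C.1 (lt_of_le_of_lt C.2.1 ⟨hWS, fun h => hyW (h hy)⟩) y (n C) C.2.self
      (fun h => hr (hWS (C.2.1 h))) (fun h => hyW (C.2.1 h)) (hnC C) (hny C)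
  choose F hgood hrigid using hih
  let R : Setoid (J × Fin k) :=
    { r := fun p p' => ∃ σ, G.IsLabelIso p.1.1 p'.1.1 (F p.1 p.2) (F p'.1 p'.2) σ
      iseqv := ⟨fun _ => ⟨1, .refl _ _⟩, fun ⟨σ, h⟩ => ⟨σ⁻¹, h.symm⟩,
        fun ⟨_, h⟩ ⟨_, h'⟩ => ⟨_, h.trans h'⟩⟩ }
  let q : J → Fin k → Quotient R := fun C i => Quotient.mk R (C, i)
  obtain ⟨t, htinj, htrange⟩ := exists_distinct_transversals hJ hJk q fun C i j h => by
    obtain ⟨σ, hσ⟩ := Quotient.exact h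
    exact (hrigid C i j σ hσ).1
  choose f hfC hf₀ using fun i => exists_label_glue (fun C : J => F C (t i C))
    (fun e => if e = s(y, x) then 1 else 0)
  have hfyx : ∀ i, f i s(y, x) = 1 := fun i => by
    rw [hf₀ i y hyW x (fun h => hx (hWS h)), if_pos rfl]
  have hbdry : ∀ i, ∀ u ∈ S, ∀ v ∉ S, G.Adj u v → ¬(u = y ∧ v = x) →
      f i s(u, v) ≠ 1 ∧ (v = r → f i s(u, v) = 0) := by
    intro i u hu v hv huv hne
    by_cases huy : u = y
    · subst huy
      have hvx : v ≠ x := fun h => hne ⟨rfl, h⟩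
      rw [hf₀ i u hyW v (fun h => hv (hWS h)), if_neg (by simp [hvx, hyx.ne])]
      simp
    · obtain ⟨C, hC, huC⟩ := exists_isPiece (G := G) (W := W) (v := u) ⟨hu, huy⟩
      rw [hfC i ⟨C, hC⟩ u huC v huv]
      refine (hgood ⟨C, hC⟩ _).2.2.1 u huC v (fun h => hv (hWS (hC.1 h))) huv ?_
      rintro ⟨-, rfl⟩
      exact hv hy
  have hroot : ∀ i, ∀ u ∈ S, ¬ G.IsRootLike (f i) u := by
    rintro i u hu ⟨w, huw, hw, hall⟩
    by_cases huy : u = y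
    · subst huy
      have hxw : x = w := by
        by_contra h
        have := hall x hyx h
        rw [hfyx] at this
        simp at this
      subst hxw
      obtain ⟨C⟩ : Nonempty J := (Nat.card_pos_iff.1 hJ).1
      have h1 := hall (n C) (hny C).symm (fun h => hx (hWS (C.2.1 (h ▸ hnC C))))
      rw [Sym2.eq_swap, hfC i C _ (hnC C) _ (hny C)] at h1
      exact (hgood C _).1 h1
    · obtain ⟨C, hC, huC⟩ := exists_isPiece (G := G) (W := W) (v := u) ⟨hu, huy⟩
      refine (hgood ⟨C, hC⟩ (t i ⟨C, hC⟩)).2.2.2 u huC ⟨w, huw, ?_, fun v huv hvw => ?_⟩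
      · rw [← hfC i ⟨C, hC⟩ u huC w huw, hw]
      · rw [← hfC i ⟨C, hC⟩ u huC v huv, hall v huv hvw]
  have hσy : ∀ i i' σ, G.IsLabelIso S S (f i) (f i') σ → σ y = y := by
    intro i i' σ h
    have hσx : σ x = x := h.2.1 y hy x hx hyx
    have h1 := h.2.2 y hy x
    rw [hσx] at h1
    by_contra hne
    exact (hbdry i' (σ y) ((h.1 y).2 hy) x hx (h1.1.2 hyx) (fun h => hne h.1)).1
      ((h1.2 hyx).trans (hfyx i))
  have hstep : ∀ i i' σ, G.IsLabelIso S S (f i) (f i') σ → ∀ C : J, ∃ C' : J,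
      G.IsLabelIso C.1 C'.1 (F C (t i C)) (F C' (t i' C')) σ := by
    intro i i' σ h C
    have hy' := hσy i i' σ h
    have hWmem : ∀ u, σ u ∈ W ↔ u ∈ W := fun u => by
      have : σ u = y ↔ u = y := by
        conv_lhs => rw [← hy']
        exact σ.injective.eq_iff
      simp only [W, Set.mem_sdiff, Set.mem_singleton_iff, h.1, this]
    have hC' := C.2.image σ hWmem fun u hu v => (h.2.2 u (hWS hu) v).1
    refine ⟨⟨_, hC'⟩, fun u => ?_, fun u hu v hv huv => ?_, fun u hu v => ?_⟩
    · simp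
    · by_cases hvS : v ∈ S
      · by_cases hvy : v = y
        · rw [hvy, hy']
        · exact absurd (C.2.2.2.1 u hu v ⟨hvS, hvy⟩ huv) hv
      · exact h.2.1 u (hWS (C.2.1 hu)) v hvS huv
    · have h1 := h.2.2 u (hWS (C.2.1 hu)) v
      refine ⟨h1.1, fun huv => ?_⟩
      rw [← hfC i C u hu v huv, ← h1.2 huv]
      exact (hfC i' ⟨_, hC'⟩ (σ u) ⟨u, hu, rfl⟩ (σ v) (h1.1.2 huv)).symm
  refine ⟨f, fun i => ⟨by simp [hfyx], fun _ => hfyx i, hbdry i, hroot i⟩, fun i i' σ h => ?_⟩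
  have hsub : ∀ i i' σ, G.IsLabelIso S S (f i) (f i') σ →
      Set.range (fun C => q C (t i C)) ⊆ Set.range (fun C => q C (t i' C)) := by
    rintro i i' σ h _ ⟨C, rfl⟩
    obtain ⟨C', hC'⟩ := hstep i i' σ h C
    exact ⟨C', (Quotient.sound ⟨σ, hC'⟩ : q C (t i C) = q C' (t i' C')).symm⟩
  obtain rfl : i = i' := htrange i i' ((hsub i i' σ h).antisymm (hsub i' i _ h.symm))
  refine ⟨rfl, fun u hu => ?_⟩
  by_cases huy : u = y
  · rw [huy, hσy i i σ h]
  · obtain ⟨C, hC, huC⟩ := exists_isPiece (G := G) (W := W) (v := u) ⟨hu, huy⟩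
    obtain ⟨C', hC'⟩ := hstep i i σ h ⟨C, hC⟩
    obtain rfl : (⟨C, hC⟩ : J) = C' :=
      htinj i (Quotient.sound ⟨σ, hC'⟩ : q ⟨C, hC⟩ (t i ⟨C, hC⟩) = q C' (t i C'))
    exact (hrigid _ _ _ σ hC').2 u huC

end SimpleGraph

open SimpleGraph

theorem distinguishingIndex_le_three_of_isRegular
    {V : Type*} [Fintype V] (G : SimpleGraph V) [DecidableRel G.Adj] (k : ℕ)
    (hconn : G.Connected) (hreg : G.IsRegularOfDegree k) (hk : 2 ≤ k) :
    G.distinguishingIndex ≤ 3 := by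
  classical
  obtain rfl | hk3 : k = 2 ∨ 3 ≤ k := by omega
  · exact distinguishingIndex_le_three_of_isRegularOfDegree_two hconn hreg
  have hdeg : ∀ v, (G.neighborSet v).ncard = k := fun v => by
    rw [← hreg v, Set.ncard_eq_toFinset_card']
    rfl
  have hnt : Nontrivial V := by
    obtain ⟨c⟩ := hconn.nonempty
    obtain ⟨v, hv⟩ := (G.degree_pos_iff_exists_adj c).1 (by rw [hreg c]; omega)
    exact ⟨c, v, hv.ne⟩
  obtain ⟨r, hr⟩ := hconn.exists_connected_induce_compl_singleton_of_finite_nontrivial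
  obtain ⟨y, hry⟩ := (G.degree_pos_iff_exists_adj r).1 (by rw [hreg r]; omega)
  have hS : G.IsPiece {r}ᶜ {r}ᶜ := by
    refine ⟨subset_rfl, ⟨y, hry.ne'⟩, fun _ _ _ hb _ => hb, fun D hD ⟨d, hd⟩ hcl v hv => ?_⟩
    exact hr.mem_of_adj_closed (C := Subtype.val ⁻¹' D) (a := ⟨d, hD hd⟩) hd
      (fun a ha b hab => hcl a ha b b.2 hab) ⟨v, hv⟩
  obtain ⟨F, hgood, hrigid⟩ := exists_goodLabel hk3 hdeg r {r}ᶜ r y hS (by simp) (by simp)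
    hry.ne' hry.symm
  obtain ⟨-, hyr, hbdry, hroot⟩ := hgood ⟨0, by omega⟩
  set f := F ⟨0, by omega⟩
  have hyr : f s(y, r) = 1 := by
    refine hyr ?_
    have h2 : 1 < (G.neighborFinset r).card := by
      rw [card_neighborFinset_eq_degree, hreg r]
      omega
    obtain ⟨u, hu, huy⟩ := Finset.exists_mem_ne h2 y
    exact ⟨u, ((G.mem_neighborFinset r u).1 hu).ne', huy⟩
  have hrr : G.IsRootLike f r := by
    refine ⟨y, hry, by rwa [Sym2.eq_swap], fun v hv hvy => ?_⟩
    rw [Sym2.eq_swap]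
    exact (hbdry v hv.ne' r (by simp) hv.symm fun h => hvy h.1).2 rfl
  refine distinguishingIndex_le_three_of_label f fun φ hφ => ?_
  have hφr : φ r = r := by
    by_contra hne
    obtain ⟨w, hw, hw1, hall⟩ := hrr
    refine hroot (φ r) hne ⟨φ w, φ.map_adj_iff.2 hw, by rw [hφ r w hw, hw1], fun v hv hvw => ?_⟩
    obtain ⟨v, rfl⟩ := φ.surjective v
    have hv' := φ.map_adj_iff.1 hv
    rw [hφ r v hv', hall v hv' fun h => hvw (h ▸ rfl)]
  have hiso : G.IsLabelIso {r}ᶜ {r}ᶜ f f φ.toEquiv := by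
    refine ⟨fun u => ?_, fun u hu v hv huv => ?_, fun u hu v => ⟨φ.map_adj_iff, hφ u v⟩⟩
    · have : φ u = r ↔ u = r := by
        conv_lhs => rw [← hφr]
        exact φ.injective.eq_iff
      exact not_congr this
    · obtain rfl : v = r := by simpa using hv
      exact hφr
  intro v
  by_cases hv : v = r
  · rw [hv, hφr]
  · exact (hrigid _ _ _ hiso).2 v hv
end
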